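/- Let X be a complete irreducible variety of dimension n over an algebraically closed field of characteristic 0, and let f : X → ℙ^r be an unramified morphism. If 2n > r, then f is a closed embedding. -/

import Mathlib

/-!
Common framework: classical projective varieties over an algebraically closed
field, formalized via `Projectivization`.
-/

open MvPolynomial Module Set Filter

namespace PinchPaper

variable (k : Type) [Field k]

/-- The classical points of projective `N`-space over `k`. -/
abbrev Pr (N : ℕ) := Projectivization k (Fin (N + 1) → k)

variable {k}

/-- A (homogeneous) polynomial vanishes at a point of projective space. -/
def Vanishes {N : ℕ} (f : MvPolynomial (Fin (N + 1)) k) (p : Pr k N) : Prop :=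
  ∀ (v : Fin (N + 1) → k) (hv : v ≠ 0), Projectivization.mk k v hv = p → eval v f = 0

/-- Zariski-closed (projective algebraic) subsets of projective space: common zero
loci of families of homogeneous polynomials. -/
def IsAlgSet {N : ℕ} (Z : Set (Pr k N)) : Prop :=
  ∃ S : Set (MvPolynomial (Fin (N + 1)) k),
    (∀ f ∈ S, ∃ d, f.IsHomogeneous d) ∧ Z = {p | ∀ f ∈ S, Vanishes f p}

/-- A projective variety: a nonempty algebraic set which is irreducible. -/
def IsVariety {N : ℕ} (Z : Set (Pr k N)) : Prop :=
  IsAlgSet Z ∧ Z.Nonempty ∧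
    ∀ Z₁ Z₂ : Set (Pr k N), IsAlgSet Z₁ → IsAlgSet Z₂ → Z ⊆ Z₁ ∪ Z₂ → Z ⊆ Z₁ ∨ Z ⊆ Z₂

/-- `Z` has dimension `n`, via lengths of chains of subvarieties. -/
def HasDim {N : ℕ} (Z : Set (Pr k N)) (n : ℕ) : Prop :=
  Order.krullDim {W : Set (Pr k N) // IsVariety W ∧ W ⊆ Z} = (n : ℕ∞)

/-- The polynomials vanishing identically on `Z` (as a `k`-submodule). -/
noncomputable def vanishingIdeal {N : ℕ} (Z : Set (Pr k N)) :
    Submodule k (MvPolynomial (Fin (N + 1)) k) :=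
  ⨅ p ∈ Z, LinearMap.ker (MvPolynomial.aeval (R := k) (Projectivization.rep p)).toLinearMap

/-- The Hilbert function of the homogeneous coordinate ring of `Z`. -/
noncomputable def hilb {N : ℕ} (Z : Set (Pr k N)) (m : ℕ) : ℕ :=
  finrank k (↥(homogeneousSubmodule (Fin (N + 1)) k m) ⧸
    (Submodule.comap (homogeneousSubmodule (Fin (N + 1)) k m).subtype (vanishingIdeal Z)))

/-- `Z` (of dimension `n`) has degree `d`: the Hilbert polynomial of `Z` has degree `n`
and leading coefficient `d / n!`. -/
def HasDegree {N : ℕ} (Z : Set (Pr k N)) (n d : ℕ) : Prop :=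
  ∃ P : Polynomial ℚ, P.degree = (n : ℕ) ∧ P.leadingCoeff * (n.factorial : ℚ) = (d : ℚ) ∧
    ∀ᶠ m : ℕ in atTop, (hilb Z m : ℚ) = P.eval (m : ℚ)

/-- A curve `B` has (arithmetic, hence for smooth curves geometric) genus `g`:
its Hilbert polynomial is `P(m) = d·m + (1 - g)`. -/
def HasGenus {N : ℕ} (B : Set (Pr k N)) (g : ℕ) : Prop :=
  ∃ d : ℕ, ∀ᶠ m : ℕ in atTop, (hilb B m : ℤ) = d * m + 1 - g

/-- A line in projective space: the set of points lying in a 2-dimensional linear subspace. -/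
def IsLine {N : ℕ} (L : Set (Pr k N)) : Prop :=
  ∃ W : Submodule k (Fin (N + 1) → k), finrank k W = 2 ∧
    L = {p | Projectivization.submodule p ≤ W}

/-- A 2-plane in projective space. -/
def Is2Plane {N : ℕ} (L : Set (Pr k N)) : Prop :=
  ∃ W : Submodule k (Fin (N + 1) → k), finrank k W = 3 ∧
    L = {p | Projectivization.submodule p ≤ W}

/-- `Y` is non-degenerate: no nonzero linear form vanishes on it. -/
def Nondegenerate {N : ℕ} (Y : Set (Pr k N)) : Prop :=
  ∀ f : MvPolynomial (Fin (N + 1)) k, f.IsHomogeneous 1 → (∀ p ∈ Y, Vanishes f p) → f = 0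

/-- `Y` is ruled by lines: it contains infinitely many lines (equivalently, its Fano
scheme of lines is positive-dimensional). -/
def RuledByLines {N : ℕ} (Y : Set (Pr k N)) : Prop :=
  {L : Set (Pr k N) | IsLine L ∧ L ⊆ Y}.Infinite

/-- The differential of `f` at `v`, as a linear functional. -/
noncomputable def diffAt {N : ℕ} (f : MvPolynomial (Fin (N + 1)) k) (v : Fin (N + 1) → k) :
    (Fin (N + 1) → k) →ₗ[k] k :=
  ∑ j, eval v (pderiv j f) • (LinearMap.proj j : (Fin (N + 1) → k) →ₗ[k] k)

/-- The affine cone over the embedded Zariski tangent space of `Z` at `p`. -/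
noncomputable def embTangent {N : ℕ} (Z : Set (Pr k N)) (p : Pr k N) :
    Submodule k (Fin (N + 1) → k) :=
  ⨅ f ∈ {f : MvPolynomial (Fin (N + 1)) k |
      (∃ d, f.IsHomogeneous d) ∧ ∀ q ∈ Z, Vanishes f q},
    LinearMap.ker (diffAt f (Projectivization.rep p))

/-- A smooth projective surface (embedded in some projective space). -/
def IsSmoothSurface {N : ℕ} (Z : Set (Pr k N)) : Prop :=
  IsVariety Z ∧ HasDim Z 2 ∧ ∀ p ∈ Z, finrank k (embTangent Z p) = 3

/-- A smooth projective curve. -/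
def IsSmoothCurve {N : ℕ} (Z : Set (Pr k N)) : Prop :=
  IsVariety Z ∧ HasDim Z 1 ∧ ∀ p ∈ Z, finrank k (embTangent Z p) = 2

/-- `F` is a local homogeneous representation of `φ` near `p ∈ X`. -/
def LocalRep {M N : ℕ} (X : Set (Pr k M)) (φ : Pr k M → Pr k N) (p : Pr k M)
    (F : Fin (N + 1) → MvPolynomial (Fin (M + 1)) k) : Prop :=
  (∃ d, ∀ i, (F i).IsHomogeneous d) ∧
  (fun i => eval (Projectivization.rep p) (F i)) ≠ 0 ∧
  ∀ q ∈ X, ∀ (v : Fin (M + 1) → k) (hv : v ≠ 0), Projectivization.mk k v hv = q →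
    ∀ hFv : (fun i => eval v (F i)) ≠ 0,
      φ q = Projectivization.mk k (fun i => eval v (F i)) hFv

/-- `φ` is a morphism on the projective set `X`: locally given by homogeneous polynomials. -/
def IsMorphismOn {M N : ℕ} (X : Set (Pr k M)) (φ : Pr k M → Pr k N) : Prop :=
  ∀ p ∈ X, ∃ F, LocalRep X φ p F

/-- The Jacobian of a tuple of polynomials at `v`, as a linear map. -/
noncomputable def jacobian {M N : ℕ} (F : Fin (N + 1) → MvPolynomial (Fin (M + 1)) k)
    (v : Fin (M + 1) → k) : (Fin (M + 1) → k) →ₗ[k] (Fin (N + 1) → k) :=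
  Matrix.mulVecLin (Matrix.of fun i j => eval v (pderiv j (F i)))

/-- `φ` (defined on the surface `X`) is ramified at `p`: its differential has rank ≤ 1,
i.e. the image of the affine tangent cone has rank ≤ 2. -/
def RamifiedAt {M N : ℕ} (X : Set (Pr k M)) (φ : Pr k M → Pr k N) (p : Pr k M) : Prop :=
  ∀ F, LocalRep X φ p F →
    finrank k ((embTangent X p).map (jacobian F (Projectivization.rep p))) ≤ 2

/-- The ramification locus of `φ` on `X`. -/
def RamLocus {M N : ℕ} (X : Set (Pr k M)) (φ : Pr k M → Pr k N) : Set (Pr k M) :=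
  {p | p ∈ X ∧ RamifiedAt X φ p}

/-- `φ` is unramified at `p` (injective differential on Zariski tangent spaces). -/
def UnramifiedAt {M N : ℕ} (X : Set (Pr k M)) (φ : Pr k M → Pr k N) (p : Pr k M) : Prop :=
  ∀ F, LocalRep X φ p F → ∀ w ∈ embTangent X p,
    jacobian F (Projectivization.rep p) w ∈
      Submodule.span k {(fun i => eval (Projectivization.rep p) (F i))} →
    w ∈ Submodule.span k {Projectivization.rep p}

/-- `φ` is a closed embedding on `X`: injective, closed image, unramified, and the
embedded tangent spaces of the image match those of `X`. -/
def IsClosedEmbeddingOn {M N : ℕ} (X : Set (Pr k M)) (φ : Pr k M → Pr k N) : Prop :=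
  InjOn φ X ∧ IsAlgSet (φ '' X) ∧ (∀ p ∈ X, UnramifiedAt X φ p) ∧
    ∀ p ∈ X, finrank k (embTangent (φ '' X) (φ p)) = finrank k (embTangent X p)

/-- `φ` is generically injective on `X` (i.e. birational onto its image). -/
def GenericallyInjectiveOn {M N : ℕ} (X : Set (Pr k M)) (φ : Pr k M → Pr k N) : Prop :=
  ∃ Z : Set (Pr k M), IsAlgSet Z ∧ ¬ X ⊆ Z ∧ InjOn φ (X \ Z)

/-- An uncrumpled map: a morphism with non-degenerate image, birational onto its
image, with finite ramification locus. -/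
def Uncrumpled {M N : ℕ} (X : Set (Pr k M)) (φ : Pr k M → Pr k N) : Prop :=
  IsMorphismOn X φ ∧ Nondegenerate (φ '' X) ∧ GenericallyInjectiveOn X φ ∧
    (RamLocus X φ).Finite

/-- The ramification locus of the composite of `φ` with the linear projection given by
the matrix `L`; ramification means the image of the affine tangent cone has rank ≤ `r`. -/
def ProjRamLocus {M N T : ℕ} (X : Set (Pr k M)) (φ : Pr k M → Pr k N)
    (L : Matrix (Fin T) (Fin (N + 1)) k) (r : ℕ) : Set (Pr k M) :=
  {p | p ∈ X ∧ ∀ F, LocalRep X φ p F →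
    finrank k ((embTangent X p).map
      ((Matrix.mulVecLin L).comp (jacobian F (Projectivization.rep p)))) ≤ r}

/-- A property holds for a general matrix: it holds on a nonempty Zariski-open set. -/
def ForGenericMatrix {a b : ℕ} (P : Matrix (Fin a) (Fin b) k → Prop) : Prop :=
  ∃ G : MvPolynomial (Fin a × Fin b) k, G ≠ 0 ∧
    ∀ L : Matrix (Fin a) (Fin b) k, eval (fun ij => L ij.1 ij.2) G ≠ 0 → P L

/-- A property holds for a general vector. -/
def ForGenericVector {b : ℕ} (P : (Fin b → k) → Prop) : Prop :=
  ∃ G : MvPolynomial (Fin b) k, G ≠ 0 ∧ ∀ a : Fin b → k, eval a G ≠ 0 → P a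

/-- A property holds for a general point of `X`: it holds away from a proper closed subset. -/
def ForGeneralPointOn {M : ℕ} (X : Set (Pr k M)) (P : Pr k M → Prop) : Prop :=
  ∃ Z : Set (Pr k M), IsAlgSet Z ∧ ¬ X ⊆ Z ∧ ∀ x ∈ X \ Z, P x

/-- The pinch point scheme length: `𝔓(φ) = n` iff the composition of `φ` with a general
linear projection to `ℙ³` has exactly `n` pinch (ramification) points.  (By
[Eisenbud–Harris, 12.6] this equals `deg (6ζ² + 4ζK + K² − c₂)`.) -/
def HasPinch {M N : ℕ} (X : Set (Pr k M)) (φ : Pr k M → Pr k N) (n : ℕ) : Prop :=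
  ForGenericMatrix (fun L : Matrix (Fin 4) (Fin (N + 1)) k =>
    (∀ p ∈ X, L.mulVec (Projectivization.rep (φ p)) ≠ 0) ∧
    (ProjRamLocus X φ L 2).ncard = n ∧ (ProjRamLocus X φ L 2).Finite)

/-- A rational normal scroll in `ℙ^N`: a smooth non-degenerate surface of minimal
degree `N − 1` which is ruled by lines. -/
def IsRationalNormalScroll {N : ℕ} (Y : Set (Pr k N)) : Prop :=
  IsSmoothSurface Y ∧ Nondegenerate Y ∧ RuledByLines Y ∧ HasDegree Y 2 (N - 1)

/-- The exceptional fiber of `β` over `x`. -/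
def ExcFiber {M' M : ℕ} (Xt : Set (Pr k M')) (β : Pr k M' → Pr k M) (x : Pr k M) :
    Set (Pr k M') := {q | q ∈ Xt ∧ β q = x}

/-- `β : X̃ → X` is the blow-up of the surface `X` at the (smooth) point `x`:
a birational morphism which is an isomorphism away from `x`, whose fiber over `x`
is an irreducible curve, smooth along that fiber. -/
def IsBlowupAt {M' M : ℕ} (Xt : Set (Pr k M')) (X : Set (Pr k M))
    (β : Pr k M' → Pr k M) (x : Pr k M) : Prop :=
  x ∈ X ∧ IsVariety Xt ∧ HasDim Xt 2 ∧ IsMorphismOn Xt β ∧ β '' Xt = X ∧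
    InjOn β {q | q ∈ Xt ∧ β q ≠ x} ∧
    IsVariety (ExcFiber Xt β x) ∧ HasDim (ExcFiber Xt β x) 1 ∧
    ∀ q ∈ ExcFiber Xt β x, finrank k (embTangent Xt q) = 3

/-- `φ̃ : X̃ → ℙ^{N'}` resolves the inner projection of `φ : X → ℙ^N` from `y = φ x`
(via the blow-up `β : X̃ → X` and with projection given by a linear map `L` whose
kernel is the line of `y`). -/
def ResolvesInnerProj {M M' N N' : ℕ} (X : Set (Pr k M)) (φ : Pr k M → Pr k N)
    (x : Pr k M) (Xt : Set (Pr k M')) (β : Pr k M' → Pr k M)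
    (φt : Pr k M' → Pr k N') (L : (Fin (N + 1) → k) →ₗ[k] (Fin (N' + 1) → k)) : Prop :=
  IsMorphismOn Xt φt ∧ LinearMap.ker L = Projectivization.submodule (φ x) ∧
    ∀ q ∈ Xt, β q ≠ x → ∀ (v : Fin (N + 1) → k) (hv : v ≠ 0),
      Projectivization.mk k v hv = φ (β q) → ∀ hLv : L v ≠ 0,
        φt q = Projectivization.mk k (L v) hLv

/-- The standard quadratic (Veronese) monomials. -/
def veroneseVec (v : Fin 3 → k) : Fin 6 → k :=
  ![v 0 * v 0, v 0 * v 1, v 0 * v 2, v 1 * v 1, v 1 * v 2, v 2 * v 2]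

/-- The image of the Veronese embedding `ℙ² → ℙ⁵`. -/
def veroneseImage (k : Type) [Field k] : Set (Pr k 5) :=
  {p | ∃ (v : Fin 3 → k) (hv : veroneseVec v ≠ 0), p = Projectivization.mk k (veroneseVec v) hv}

/-- `Y` is (projectively equivalent to) the Veronese surface in `ℙ⁵`
(the existence of the linear isomorphism forces `N = 5`). -/
def IsVeroneseSurface {N : ℕ} (Y : Set (Pr k N)) : Prop :=
  ∃ σ : (Fin 6 → k) ≃ₗ[k] (Fin (N + 1) → k),
    Y = Projectivization.map σ.toLinearMap σ.injective '' veroneseImage k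

/-- `Y ⊂ ℙ^N` is linearly normal: it is not an isomorphic linear projection of a
non-degenerate variety in `ℙ^{N+1}`. -/
def LinearlyNormal {N : ℕ} (Y : Set (Pr k N)) : Prop :=
  ¬ ∃ (Y' : Set (Pr k (N + 1))) (π : Pr k (N + 1) → Pr k N)
      (L : (Fin (N + 1 + 1) → k) →ₗ[k] (Fin (N + 1) → k)),
      IsVariety Y' ∧ Nondegenerate Y' ∧
      (∀ q ∈ Y', ∀ (v : Fin (N + 1 + 1) → k) (hv : v ≠ 0),
        Projectivization.mk k v hv = q →
          ∃ hLv : L v ≠ 0, π q = Projectivization.mk k (L v) hLv) ∧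
      π '' Y' = Y ∧ InjOn π Y' ∧
      ∀ q ∈ Y', Disjoint (LinearMap.ker L) (embTangent Y' q)

/-- A del Pezzo surface of degree `d` in `ℙ^N`: a smooth non-degenerate linearly normal
surface of degree `d` (for `d = N` this characterizes anticanonically embedded del
Pezzo surfaces). -/
def IsDelPezzoOfDegree {N : ℕ} (Y : Set (Pr k N)) (d : ℕ) : Prop :=
  IsSmoothSurface Y ∧ Nondegenerate Y ∧ LinearlyNormal Y ∧ HasDegree Y 2 d

/-- `F` is isomorphic to `ℙ¹` (as a projective variety). -/
def IsIsoToP1 {M : ℕ} (F : Set (Pr k M)) : Prop :=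
  ∃ ψ : Pr k 1 → Pr k M, IsMorphismOn Set.univ ψ ∧ Set.BijOn ψ Set.univ F ∧
    ∃ ψ' : Pr k M → Pr k 1, IsMorphismOn F ψ' ∧ ∀ t, ψ' (ψ t) = t

/-- `ρ : X → B` exhibits `X` as a `ℙ¹`-bundle over the curve `B`
(all fibers are isomorphic to `ℙ¹`). -/
def IsP1Bundle {M m : ℕ} (X : Set (Pr k M)) (B : Set (Pr k m))
    (ρ : Pr k M → Pr k m) : Prop :=
  IsMorphismOn X ρ ∧ ρ '' X = B ∧ ∀ b ∈ B, IsIsoToP1 {p | p ∈ X ∧ ρ p = b}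

/-- The hyperplane cut out by the linear form with coefficients `a`. -/
def hyperplaneOf {N : ℕ} (a : Fin (N + 1) → k) : Set (Pr k N) :=
  {p | Vanishes (∑ i, MvPolynomial.C (a i) * MvPolynomial.X i) p}

/-- A rational normal curve of degree `N` in `ℙ^N`: a non-degenerate curve of degree `N`. -/
def IsRationalNormalCurve {N : ℕ} (C : Set (Pr k N)) : Prop :=
  IsVariety C ∧ HasDim C 1 ∧ Nondegenerate C ∧ HasDegree C 1 N

/-- The Gauss degree `γ₁` of an embedded curve `X ⊂ ℙ^N`: the number of ramification
points of a general linear projection `X → ℙ¹`. -/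
def HasGaussDegree {N : ℕ} (X : Set (Pr k N)) (γ : ℕ) : Prop :=
  ForGenericMatrix (fun L : Matrix (Fin 2) (Fin (N + 1)) k =>
    (∀ p ∈ X, L.mulVec (Projectivization.rep p) ≠ 0) ∧
    (ProjRamLocus X id L 1).ncard = γ ∧ (ProjRamLocus X id L 1).Finite)


section WeightedComponents

variable {R σ G : Type*} [CommSemiring R] [AddCancelCommMonoid G] {w : σ → G}

lemma weightedHomogeneousComponent_mul_of_isWeightedHomogeneous {P : MvPolynomial σ R} {e : G}
    (hP : P.IsWeightedHomogeneous w e) (f : G) (c : MvPolynomial σ R) :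
    weightedHomogeneousComponent w (f + e) (c * P) =
      weightedHomogeneousComponent w f c * P := by
  classical
  induction c using MvPolynomial.induction_on' with
  | monomial m a =>
    have hm : (monomial m a : MvPolynomial σ R).IsWeightedHomogeneous w (Finsupp.weight w m) :=
      isWeightedHomogeneous_monomial w m a rfl
    rw [weightedHomogeneousComponent_of_mem (hm.mul hP), weightedHomogeneousComponent_of_mem hm]
    by_cases h : f = Finsupp.weight w m
    · simp [h]
    · rw [if_neg h, if_neg (by simpa using h), zero_mul]
  | add p q hp hq => simp only [add_mul, map_add, hp, hq]

lemma weightedHomogeneousComponent_mul_eq_zero {P : MvPolynomial σ R} {e d : G}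
    (hP : P.IsWeightedHomogeneous w e) (hd : ∀ f, f + e ≠ d) (c : MvPolynomial σ R) :
    weightedHomogeneousComponent w d (c * P) = 0 := by
  classical
  induction c using MvPolynomial.induction_on' with
  | monomial m a =>
    have hm : (monomial m a : MvPolynomial σ R).IsWeightedHomogeneous w (Finsupp.weight w m) :=
      isWeightedHomogeneous_monomial w m a rfl
    rw [weightedHomogeneousComponent_of_mem (hm.mul hP), if_neg (hd _).symm]
  | add p q hp hq => simp only [add_mul, map_add, hp, hq, add_zero]

lemma homogeneousComponent_mul_of_isHomogeneous {P : MvPolynomial σ R} {e : ℕ}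
    (hP : P.IsHomogeneous e) (f : ℕ) (c : MvPolynomial σ R) :
    homogeneousComponent (f + e) (c * P) = homogeneousComponent f c * P :=
  weightedHomogeneousComponent_mul_of_isWeightedHomogeneous hP f c

lemma homogeneousComponent_mul_eq_zero {P : MvPolynomial σ R} {e d : ℕ}
    (hP : P.IsHomogeneous e) (hd : d < e) (c : MvPolynomial σ R) :
    homogeneousComponent d (c * P) = 0 :=
  weightedHomogeneousComponent_mul_eq_zero hP (fun f => by omega) c

end WeightedComponents

section GradedStabilization

variable {R S ι : Type*} [CommRing R] [CommRing S] [Algebra R S]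

lemma aeval_mem_span_range_pow (v : ι → S) {d : ℕ} {P : MvPolynomial ι R}
    (hP : P.IsHomogeneous d) : aeval v P ∈ (Submodule.span R (range v)) ^ d := by
  rw [P.as_sum, map_sum]
  refine Submodule.sum_mem _ fun m hm => ?_
  rw [aeval_monomial, ← Algebra.smul_def]
  refine Submodule.smul_mem _ _ ?_
  have hd : ∑ i ∈ m.support, m i = d := by
    have h : m.degree = d := by
      rw [Finsupp.degree_eq_weight_one]
      exact hP (mem_support_iff.mp hm)
    exact h
  have key : ∀ s : Finset ι,
      ∏ i ∈ s, v i ^ m i ∈ (Submodule.span R (range v)) ^ (∑ i ∈ s, m i) := by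
    classical
    intro s
    induction s using Finset.induction_on with
    | empty => simpa using ⟨1, map_one _⟩
    | insert a s ha ih =>
      rw [Finset.prod_insert ha, Finset.sum_insert ha, pow_add]
      exact Submodule.mul_mem_mul
        (Submodule.pow_mem_pow _ (Submodule.subset_span (mem_range_self a)) _) ih
  rw [← hd]
  exact key m.support

lemma exists_isHomogeneous_aeval_eq (v : ι → S) (d : ℕ) {n : S}
    (hn : n ∈ (Submodule.span R (range v)) ^ d) :
    ∃ P : MvPolynomial ι R, P.IsHomogeneous d ∧ aeval v P = n := by
  have h : (Submodule.span R (range v)) =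
      Submodule.map (aeval v : MvPolynomial ι R →ₐ[R] S).toLinearMap
        (Submodule.span R (range X)) := by
    rw [Submodule.map_span, ← range_comp]
    congr 2
    ext i
    simp
  rw [h, ← Submodule.map_pow] at hn
  obtain ⟨P, hP, rfl⟩ := hn
  refine ⟨P, ?_, rfl⟩
  rw [← mem_homogeneousSubmodule]
  refine (?_ : (Submodule.span R (range X)) ^ d ≤ homogeneousSubmodule ι R d) hP
  rw [← homogeneousSubmodule_one_pow]
  refine pow_le_pow_left' ?_ d
  rw [Submodule.span_le]
  rintro _ ⟨i, rfl⟩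
  exact isHomogeneous_X R i

/-- The ideal generated by the homogeneous polynomials whose values lie in a given filtration. -/
noncomputable def filtIdeal (v : ι → S) (a : ℕ → Submodule R S) : Ideal (MvPolynomial ι R) :=
  Ideal.span {P | ∃ d, P.IsHomogeneous d ∧ aeval v P ∈ a d}

lemma pow_mul_le_of_mul_le {F : Submodule R S} {a : ℕ → Submodule R S}
    (hF : ∀ q, F * a q ≤ a (q + 1)) (j q : ℕ) : F ^ j * a q ≤ a (q + j) := by
  induction j with
  | zero => simp
  | succ j ih =>
    calc F ^ (j + 1) * a q = F * (F ^ j * a q) := by ring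
      _ ≤ F * a (q + j) := by gcongr
      _ ≤ a (q + (j + 1)) := hF _

lemma aeval_mem_of_mem_filtIdeal (v : ι → S) {a : ℕ → Submodule R S}
    (hF : ∀ q, Submodule.span R (range v) * a q ≤ a (q + 1)) {P : MvPolynomial ι R} {d : ℕ}
    (hP : P ∈ filtIdeal v a) (hd : P.IsHomogeneous d) : aeval v P ∈ a d := by
  have key : ∀ P ∈ filtIdeal v a, ∀ d, aeval v (homogeneousComponent d P) ∈ a d := by
    intro P hP
    refine Submodule.closure_induction
      (p := fun P _ => ∀ d, aeval v (homogeneousComponent d P) ∈ a d)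
      ?_ ?_ ?_ hP
    · intro d; simp
    · intro P Q _ _ h1 h2 d
      rw [map_add, map_add]; exact add_mem (h1 d) (h2 d)
    · rintro c P ⟨e, he, hae⟩ d
      rw [smul_eq_mul]
      rcases lt_or_ge d e with h | h
      · rw [homogeneousComponent_mul_eq_zero he h, map_zero]; exact zero_mem _
      · obtain ⟨f, rfl⟩ := Nat.exists_eq_add_of_le' h
        rw [homogeneousComponent_mul_of_isHomogeneous he, map_mul, add_comm]
        exact pow_mul_le_of_mul_le hF f e (Submodule.mul_mem_mul
          (aeval_mem_span_range_pow v (homogeneousComponent_isHomogeneous f c)) hae)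
  have := key P hP d
  rwa [homogeneousComponent_of_mem hd, if_pos rfl] at this

lemma exists_forall_le_mul_of_filtration [IsNoetherianRing R] [Finite ι] (v : ι → S)
    (a : ℕ → Submodule R S) (ha : ∀ q, a q ≤ Submodule.span R (range v) ^ q)
    (hF : ∀ q, Submodule.span R (range v) * a q ≤ a (q + 1)) :
    ∃ q₀, ∀ q ≥ q₀, a (q + 1) ≤ Submodule.span R (range v) * a q := by
  have hfg : (filtIdeal v a).FG := IsNoetherian.noetherian _
  obtain ⟨t, hts, ht⟩ := Submodule.fg_span_iff_fg_span_finset_subset _ |>.mp hfg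
  have hts' : ∀ P ∈ t, ∃ d, P.IsHomogeneous d ∧ aeval v P ∈ a d := fun P hP => hts hP
  choose! deg hdeg hmem using hts'
  refine ⟨t.sup deg, fun q hq n hn => ?_⟩
  obtain ⟨P, hP, rfl⟩ := exists_isHomogeneous_aeval_eq v (q + 1) (ha _ hn)
  have hPI : P ∈ Submodule.span (MvPolynomial ι R) (t : Set (MvPolynomial ι R)) := by
    rw [← ht]; exact Submodule.subset_span ⟨_, hP, hn⟩
  have key : ∀ P ∈ Submodule.span (MvPolynomial ι R) (t : Set (MvPolynomial ι R)),
      aeval v (homogeneousComponent (q + 1) P) ∈ Submodule.span R (range v) * a q := by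
    intro P hP
    refine Submodule.closure_induction (p := fun P _ => aeval v (homogeneousComponent (q + 1) P) ∈
      Submodule.span R (range v) * a q) ?_ ?_ ?_ hP
    · simp
    · intro P Q _ _ h1 h2
      rw [map_add, map_add]; exact add_mem h1 h2
    · intro c P hPt
      have hle : deg P ≤ q := (Finset.le_sup hPt).trans hq
      obtain ⟨f, rfl⟩ := Nat.exists_eq_add_of_le' hle
      rw [smul_eq_mul, show f + deg P + 1 = f + 1 + deg P by omega,
        homogeneousComponent_mul_of_isHomogeneous (hdeg P hPt), map_mul]
      have h1 := Submodule.mul_mem_mul (aeval_mem_span_range_pow v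
        (homogeneousComponent_isHomogeneous (f + 1) c)) (hmem P hPt)
      refine (?_ : _ ≤ Submodule.span R (range v) * a (f + deg P)) h1
      rw [pow_succ', mul_assoc, add_comm f]
      gcongr
      exact pow_mul_le_of_mul_le hF f _
  have := key P hPI
  rwa [homogeneousComponent_of_mem hP, if_pos rfl] at this

lemma fg_of_le_pow [IsNoetherianRing R] [Finite ι] (v : ι → S) (q : ℕ) {N : Submodule R S}
    (hN : N ≤ Submodule.span R (range v) ^ q) : N.FG := by
  have h : (Submodule.span R (range v) ^ q).FG :=
    (Submodule.fg_span (finite_range v)).pow q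
  have := isNoetherian_of_fg_of_noetherian _ h
  exact isNoetherian_submodule.mp this N hN

lemma exists_saturation_bound [IsNoetherianRing R] [Finite ι] (v : ι → S)
    (a : ℕ → Submodule R S)
    (hF : ∀ q, Submodule.span R (range v) * a q ≤ a (q + 1)) :
    ∃ q₀, ∀ q ≥ q₀, ∀ n ∈ Submodule.span R (range v) ^ q, ∀ J,
      (∀ u ∈ Submodule.span R (range v) ^ J, u * n ∈ a (q + J)) → n ∈ a q := by
  set F := Submodule.span R (range v) with hFdef
  let b : ℕ → Submodule R S := fun q =>
    { carrier := {n | n ∈ F ^ q ∧ ∃ J, ∀ u ∈ F ^ J, u * n ∈ a (q + J)}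
      zero_mem' := ⟨zero_mem _, 0, fun u _ => by simp⟩
      add_mem' := by
        rintro x y ⟨hx, J, hJ⟩ ⟨hy, L, hL⟩
        refine ⟨add_mem hx hy, J + L, ?_⟩
        have h1 : F ^ (J + L) * Submodule.span R {x} ≤ a (q + (J + L)) := by
          have : F ^ J * Submodule.span R {x} ≤ a (q + J) := by
            rw [Submodule.mul_le]
            intro u hu z hz
            obtain ⟨c, rfl⟩ := Submodule.mem_span_singleton.mp hz
            rw [mul_smul_comm]; exact Submodule.smul_mem _ _ (hJ u hu)
          calc F ^ (J + L) * Submodule.span R {x}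
            = F ^ L * (F ^ J * Submodule.span R {x}) := by ring
            _ ≤ F ^ L * a (q + J) := by gcongr
            _ ≤ _ := by rw [← add_assoc]; exact pow_mul_le_of_mul_le hF _ _
        have h2 : F ^ (J + L) * Submodule.span R {y} ≤ a (q + (J + L)) := by
          have : F ^ L * Submodule.span R {y} ≤ a (q + L) := by
            rw [Submodule.mul_le]
            intro u hu z hz
            obtain ⟨c, rfl⟩ := Submodule.mem_span_singleton.mp hz
            rw [mul_smul_comm]; exact Submodule.smul_mem _ _ (hL u hu)
          calc F ^ (J + L) * Submodule.span R {y}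
            = F ^ J * (F ^ L * Submodule.span R {y}) := by ring
            _ ≤ F ^ J * a (q + L) := by gcongr
            _ ≤ _ := by
              rw [add_comm J, ← add_assoc]; exact pow_mul_le_of_mul_le hF _ _
        intro u hu
        rw [mul_add]
        exact add_mem (h1 (Submodule.mul_mem_mul hu (Submodule.mem_span_singleton_self x)))
          (h2 (Submodule.mul_mem_mul hu (Submodule.mem_span_singleton_self y)))
      smul_mem' := by
        rintro c x ⟨hx, J, hJ⟩
        refine ⟨Submodule.smul_mem _ _ hx, J, fun u hu => ?_⟩
        rw [mul_smul_comm]; exact Submodule.smul_mem _ _ (hJ u hu) }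
  have hb : ∀ q, b q ≤ F ^ q := fun q n hn => hn.1
  have hFb : ∀ q, F * b q ≤ b (q + 1) := by
    intro q
    rw [Submodule.mul_le]
    rintro u hu n ⟨hn, J, hJ⟩
    refine ⟨by rw [pow_succ']; exact Submodule.mul_mem_mul hu hn, J, fun u' hu' => ?_⟩
    rw [show u' * (u * n) = u * (u' * n) by ring, show q + 1 + J = q + J + 1 by omega]
    exact hF _ (Submodule.mul_mem_mul hu (hJ u' hu'))
  obtain ⟨q₁, hq₁⟩ := exists_forall_le_mul_of_filtration v b hb hFb
  obtain ⟨s, hs⟩ := fg_of_le_pow v q₁ (hb q₁)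
  have hsb : ∀ x ∈ s, ∃ J, ∀ u ∈ F ^ J, u * x ∈ a (q₁ + J) := fun x hx =>
    (show x ∈ b q₁ by rw [← hs]; exact Submodule.subset_span hx).2
  choose! J hJ using hsb
  have hL : F ^ (s.sup J) * b q₁ ≤ a (q₁ + s.sup J) := by
    rw [← hs, Submodule.mul_le]
    intro u hu x hx
    refine Submodule.span_induction ?_ ?_ ?_ ?_ hx
    · intro x hx
      obtain ⟨e, he⟩ := Nat.exists_eq_add_of_le' (Finset.le_sup (f := J) hx)
      have hux : u * x ∈ F ^ e * (F ^ J x * Submodule.span R {x}) := by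
        rw [← mul_assoc, ← pow_add, ← he]
        exact Submodule.mul_mem_mul hu (Submodule.mem_span_singleton_self x)
      have h2 : F ^ J x * Submodule.span R {x} ≤ a (q₁ + J x) := by
        rw [Submodule.mul_le]
        intro u hu z hz
        obtain ⟨c, rfl⟩ := Submodule.mem_span_singleton.mp hz
        rw [mul_smul_comm]; exact Submodule.smul_mem _ _ (hJ x hx u hu)
      rw [he, add_comm e, ← add_assoc]
      exact pow_mul_le_of_mul_le hF _ _ ((show _ ≤ F ^ e * a (q₁ + J x) by gcongr) hux)
    · simp
    · intro x y _ _ h1 h2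
      rw [mul_add]; exact add_mem h1 h2
    · intro c x _ h
      rw [mul_smul_comm]; exact Submodule.smul_mem _ _ h
  have hle : ∀ j, b (q₁ + j) ≤ F ^ j * b q₁ := by
    intro j
    induction j with
    | zero => simp
    | succ j ih =>
      calc b (q₁ + (j + 1)) ≤ F * b (q₁ + j) := hq₁ _ (Nat.le_add_right _ _)
        _ ≤ F * (F ^ j * b q₁) := by gcongr
        _ = F ^ (j + 1) * b q₁ := by ring
  refine ⟨q₁ + s.sup J, fun q hq n hn L hnL => ?_⟩
  obtain ⟨e, rfl⟩ := Nat.exists_eq_add_of_le hq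
  have hnb : n ∈ b (q₁ + s.sup J + e) := ⟨hn, L, hnL⟩
  rw [add_assoc] at hnb
  have h3 := hle _ hnb
  rw [pow_add, mul_comm (F ^ _) (F ^ e), mul_assoc] at h3
  exact pow_mul_le_of_mul_le hF _ _ ((show _ ≤ F ^ e * a (q₁ + s.sup J) by gcongr) h3)

end GradedStabilization

section GenericElement

variable {k R S ι : Type*} [Field k] [Infinite k] [CommRing R] [Algebra k R]
  [CommRing S] [Algebra R S]

lemma exists_linear_notMem_of_primes [Fintype ι] (s : Finset (Ideal (MvPolynomial ι R)))
    (hs : ∀ 𝔭 ∈ s, ∃ i, (X i : MvPolynomial ι R) ∉ 𝔭) :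
    ∃ c : ι → k, ∀ 𝔭 ∈ s, ∑ i, C (algebraMap k R (c i)) * X i ∉ 𝔭 := by
  classical
  let L : (ι → k) →ₗ[k] MvPolynomial ι R :=
    ∑ i, (LinearMap.proj i : (ι → k) →ₗ[k] k).smulRight (X i : MvPolynomial ι R)
  have hL : ∀ c, L c = ∑ i, C (algebraMap k R (c i)) * X i := by
    intro c
    simp only [L, LinearMap.sum_apply, LinearMap.smulRight_apply, LinearMap.proj_apply]
    refine Finset.sum_congr rfl fun i _ => ?_
    rw [Algebra.smul_def, IsScalarTower.algebraMap_apply k R (MvPolynomial ι R),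
      MvPolynomial.algebraMap_eq]
  let t : Finset (Submodule k (ι → k)) := s.image fun 𝔭 => (𝔭.restrictScalars k).comap L
  have ht : ⊤ ∉ t := by
    intro h
    obtain ⟨𝔭, h𝔭, h⟩ := Finset.mem_image.mp h
    obtain ⟨i, hi⟩ := hs 𝔭 h𝔭
    apply hi
    have : (Pi.single i 1 : ι → k) ∈ (𝔭.restrictScalars k).comap L := by rw [h]; trivial
    rw [Submodule.mem_comap, hL] at this
    simpa [Pi.single_apply, Finset.sum_ite_eq] using this
  obtain ⟨c, hc⟩ := (Set.ne_univ_iff_exists_notMem _).mp (Subspace.biUnion_ne_univ_of_top_notMem ht)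
  refine ⟨c, fun 𝔭 h𝔭 hmem => hc ?_⟩
  simp only [mem_iUnion]
  refine ⟨_, Finset.mem_image_of_mem _ h𝔭, ?_⟩
  change L c ∈ 𝔭
  rwa [hL]

/-- A general `k`-linear combination of generators is almost a nonzerodivisor modulo a
filtration. -/
lemma exists_generic_linear_combination [IsNoetherianRing R] [Fintype ι] (v : ι → S)
    (a : ℕ → Submodule R S)
    (hF : ∀ q, Submodule.span R (range v) * a q ≤ a (q + 1)) (k : Type*) [Field k] [Infinite k]
    [Algebra k R] :
    ∃ z ∈ Submodule.span R (range v), ∃ q₀, ∀ q ≥ q₀, ∀ n ∈ Submodule.span R (range v) ^ q,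
      z * n ∈ a (q + 1) → n ∈ a q := by
  classical
  obtain ⟨s, hs, hprim⟩ := Submodule.isLasker (MvPolynomial ι R) (MvPolynomial ι R) (filtIdeal v a)
  obtain ⟨c, hc⟩ := exists_linear_notMem_of_primes (k := k)
    ((s.image Ideal.radical).filter fun 𝔭 => ∃ i, (X i : MvPolynomial ι R) ∉ 𝔭)
    (fun 𝔭 h => (Finset.mem_filter.mp h).2)
  obtain ⟨q₀, hq₀⟩ := exists_saturation_bound v a hF
  let Z : MvPolynomial ι R := ∑ i, C (algebraMap k R (c i)) * X i
  have hZ : Z.IsHomogeneous 1 := IsHomogeneous.sum _ _ _ fun i _ => isHomogeneous_C_mul_X _ _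
  refine ⟨aeval v Z, by simpa using aeval_mem_span_range_pow v hZ, q₀, fun q hq n hn hzn => ?_⟩
  obtain ⟨P, hP, rfl⟩ := exists_isHomogeneous_aeval_eq v q hn
  have hZP : Z * P ∈ filtIdeal v a := Ideal.subset_span
    ⟨q + 1, by rw [add_comm q]; exact hZ.mul hP, by rwa [map_mul]⟩
  let I₀ : Ideal (MvPolynomial ι R) := idealOfVars ι R
  have hJ : ∀ 𝔮 ∈ s, ∃ J, ∀ U ∈ I₀ ^ J, U * P ∈ 𝔮 := by
    intro 𝔮 h𝔮
    have hle : filtIdeal v a ≤ 𝔮 := by rw [← hs]; exact Finset.inf_le h𝔮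
    have h𝔮p : Ideal.IsPrimary 𝔮 := hprim h𝔮
    by_cases h : ∃ i, (X i : MvPolynomial ι R) ∉ Ideal.radical 𝔮
    · have hZ' := hc _ (Finset.mem_filter.mpr ⟨Finset.mem_image_of_mem _ h𝔮, h⟩)
      refine ⟨0, fun U _ => Ideal.mul_mem_left _ _ ?_⟩
      have := (Ideal.isPrimary_iff.mp h𝔮p).2 (x := P) (y := Z) (by rw [mul_comm]; exact hle hZP)
      tauto
    · push Not at h
      have hI₀ : I₀ ≤ Ideal.radical 𝔮 := by
        rw [Ideal.span_le]; rintro _ ⟨i, rfl⟩; exact h i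
      obtain ⟨J, hJ⟩ := Ideal.exists_pow_le_of_le_radical_of_fg hI₀ (IsNoetherian.noetherian _)
      exact ⟨J, fun U hU => Ideal.mul_mem_right _ _ (hJ hU)⟩
  choose! J hJ using hJ
  refine hq₀ q hq _ hn (s.sup J) fun u hu => ?_
  obtain ⟨U, hU, rfl⟩ := exists_isHomogeneous_aeval_eq v _ hu
  have hUI : U ∈ I₀ ^ (s.sup J) := by
    rw [mem_pow_idealOfVars_iff]
    intro m hm
    rw [Finsupp.degree_eq_weight_one]
    exact (hU (mem_support_iff.mp hm)).ge
  rw [← map_mul, add_comm q]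
  refine aeval_mem_of_mem_filtIdeal v hF ?_ (hU.mul hP)
  rw [← hs, Submodule.mem_finsetInf]
  intro 𝔮 h𝔮
  exact hJ 𝔮 h𝔮 U (Ideal.pow_le_pow_right (Finset.le_sup h𝔮) hUI)

end GenericElement

section Lifting

variable {R S : Type*} [CommRing R] [CommRing S] [Algebra R S]

lemma mem_span_singleton_pow_mul {t n : S} {m : ℕ} {N : Submodule R S} :
    n ∈ Submodule.span R {t} ^ m * N ↔ ∃ y ∈ N, t ^ m * y = n := by
  rw [Submodule.span_pow, Set.singleton_pow, Submodule.mem_span_singleton_mul]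

lemma span_singleton_algebraMap_mul_le (τ : R) (N : Submodule R S) :
    Submodule.span R {algebraMap R S τ} * N ≤ N := by
  rw [Submodule.mul_le]
  intro x hx n hn
  obtain ⟨c, rfl⟩ := Submodule.mem_span_singleton.mp hx
  rw [smul_mul_assoc, ← Algebra.smul_def]
  exact Submodule.smul_mem _ _ (Submodule.smul_mem _ _ hn)

lemma span_singleton_algebraMap_pow_mul_le (τ : R) (m : ℕ) (N : Submodule R S) :
    Submodule.span R {algebraMap R S τ} ^ m * N ≤ N := by
  rw [Submodule.span_pow, Set.singleton_pow, ← map_pow]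
  exact span_singleton_algebraMap_mul_le _ _

lemma sup_pow_two_mul_le (b c : Submodule R S) (J : ℕ) :
    (b ⊔ c) ^ (2 * J) ≤ b ^ J * (b ⊔ c) ^ J ⊔ c ^ J * (b ⊔ c) ^ J := by
  rw [← Submodule.add_eq_sup b c, add_pow]
  have hcast : ∀ n : ℕ, (n : Submodule R S) ≤ 1 := by
    intro n
    induction n with
    | zero => simp
    | succ n ih => rw [Nat.cast_succ, Submodule.add_eq_sup]; exact sup_le ih le_rfl
  have hb : b ≤ b + c := by rw [Submodule.add_eq_sup]; exact le_sup_left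
  have hc : c ≤ b + c := by rw [Submodule.add_eq_sup]; exact le_sup_right
  refine Finset.sum_induction _ (· ≤ b ^ J * (b + c) ^ J ⊔ c ^ J * (b + c) ^ J)
    (fun x y hx hy => by rw [Submodule.add_eq_sup]; exact sup_le hx hy) bot_le fun m hm => ?_
  have hm' : m ≤ 2 * J := by simpa [Nat.lt_succ_iff] using hm
  calc b ^ m * c ^ (2 * J - m) * ((2 * J).choose m : Submodule R S)
      ≤ b ^ m * c ^ (2 * J - m) * 1 := by gcongr; exact hcast _
    _ = b ^ m * c ^ (2 * J - m) := mul_one _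
    _ ≤ _ := by
      rcases le_total J m with h | h
      · obtain ⟨e, rfl⟩ := Nat.exists_eq_add_of_le h
        refine le_sup_of_le_left ?_
        calc b ^ (J + e) * c ^ (2 * J - (J + e))
            ≤ b ^ J * ((b + c) ^ e * (b + c) ^ (2 * J - (J + e))) := by
              rw [pow_add, mul_assoc]; gcongr
          _ = b ^ J * (b + c) ^ J := by rw [← pow_add]; congr 2; omega
      · refine le_sup_of_le_right ?_
        calc b ^ m * c ^ (2 * J - m) = c ^ J * (b ^ m * c ^ (J - m)) := by
              rw [show 2 * J - m = J + (J - m) by omega, pow_add]; ring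
          _ ≤ c ^ J * ((b + c) ^ m * (b + c) ^ (J - m)) := by gcongr
          _ = c ^ J * (b + c) ^ J := by rw [← pow_add]; congr 2; omega

/-- Division by powers of a generic element, modulo powers of `τ`. -/
lemma mem_pow_mul_of_mul_mem [IsDomain S] {F : Submodule R S} {τ : R} {z : S}
    (ht : algebraMap R S τ ≠ 0)
    {q₀ : ℕ} (hz : z ∈ F)
    (h2 : ∀ q ≥ q₀, ∀ n ∈ F ^ q, z * n ∈ Submodule.span R {algebraMap R S τ} * F ^ (q + 1) →
      n ∈ Submodule.span R {algebraMap R S τ} * F ^ q) (m : ℕ) :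
    ∀ j, ∀ q ≥ q₀, ∀ n ∈ F ^ q,
      z ^ j * n ∈ Submodule.span R {algebraMap R S τ} ^ m * F ^ (q + j) →
      n ∈ Submodule.span R {algebraMap R S τ} ^ m * F ^ q := by
  set t := algebraMap R S τ
  have one : ∀ m, ∀ q ≥ q₀, ∀ n ∈ F ^ q, z * n ∈ Submodule.span R {t} ^ m * F ^ (q + 1) →
      n ∈ Submodule.span R {t} ^ m * F ^ q := by
    intro m
    induction m with
    | zero => intro q _ n hn _; simpa using hn
    | succ m ih =>
      intro q hq n hn h
      rw [pow_succ', mul_assoc, Submodule.mem_span_singleton_mul] at h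
      obtain ⟨y, hy, hyz⟩ := h
      have h' : z * n ∈ Submodule.span R {t} * F ^ (q + 1) := by
        rw [Submodule.mem_span_singleton_mul]
        exact ⟨y, span_singleton_algebraMap_pow_mul_le τ m _ hy, hyz⟩
      have h3 := h2 q hq n hn h'
      rw [Submodule.mem_span_singleton_mul] at h3
      obtain ⟨n₁, hn₁, rfl⟩ := h3
      rw [pow_succ', mul_assoc, Submodule.mem_span_singleton_mul]
      refine ⟨n₁, ih q hq n₁ hn₁ ?_, rfl⟩
      have : y = z * n₁ := mul_left_cancel₀ ht (by rw [hyz]; ring)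
      rwa [← this]
  intro j
  induction j with
  | zero => intro q _ n hn h; simpa using h
  | succ j ih =>
    intro q hq n hn h
    refine one m q hq n hn (ih (q + 1) (by omega) _ ?_ ?_)
    · rw [pow_succ']; exact Submodule.mul_mem_mul hz hn
    · rw [← mul_assoc, ← pow_succ, add_assoc, add_comm 1]; exact h

lemma mem_sup_of_forall_mul_mem {F : Submodule R S} {τ : R} {z : S} 
    {q₀ : ℕ} (hz : z ∈ F)
    (h2 : ∀ q ≥ q₀, ∀ n ∈ F ^ q, z * n ∈ Submodule.span R {algebraMap R S τ} * F ^ (q + 1) →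
      n ∈ Submodule.span R {algebraMap R S τ} * F ^ q)
    (h3 : ∀ q ≥ q₀, ∀ n ∈ F ^ (q + 1), ∀ J,
      (∀ u ∈ F ^ J, u * n ∈ Submodule.span R {z} * F ^ (q + J) ⊔
      Submodule.span R {algebraMap R S τ} * F ^ (q + 1 + J)) →
      n ∈ Submodule.span R {z} * F ^ q ⊔ Submodule.span R {algebraMap R S τ} * F ^ (q + 1)) :
    ∀ j, ∀ q ≥ q₀, ∀ n ∈ F ^ (q + j), ∀ J,
      (∀ u ∈ F ^ J, u * n ∈ Submodule.span R {z} ^ j * F ^ (q + J) ⊔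
        Submodule.span R {algebraMap R S τ} * F ^ (q + j + J)) →
      n ∈ Submodule.span R {z} ^ j * F ^ q ⊔
        Submodule.span R {algebraMap R S τ} * F ^ (q + j) := by
  set t := algebraMap R S τ
  have hzF : Submodule.span R {z} ≤ F := by simpa using hz
  intro j
  induction j with
  | zero =>
    intro q _ n hn J _
    exact Submodule.mem_sup_left (by simpa using hn)
  | succ j ih =>
    intro q hq n hn J hJ
    have h4 := h3 (q + j) (by omega) n hn J (fun u hu => by
      refine (?_ : _ ≤ (_ : Submodule R S)) (hJ u hu)
      refine sup_le_sup ?_ le_rfl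
      calc Submodule.span R {z} ^ (j + 1) * F ^ (q + J)
          = Submodule.span R {z} * (Submodule.span R {z} ^ j * F ^ (q + J)) := by ring
        _ ≤ Submodule.span R {z} * (F ^ j * F ^ (q + J)) := by gcongr
        _ = _ := by ring)
    rw [Submodule.mem_sup] at h4
    obtain ⟨_, h5, _, h6, rfl⟩ := h4
    rw [Submodule.mem_span_singleton_mul] at h5 h6
    obtain ⟨m, hm, rfl⟩ := h5
    obtain ⟨l, hl, rfl⟩ := h6
    have hmm : m ∈ Submodule.span R {z} ^ j * F ^ q ⊔ Submodule.span R {t} * F ^ (q + j) := by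
      refine ih q hq m hm J fun w hw => ?_
      have h7 := hJ w hw
      rw [Submodule.mem_sup] at h7
      obtain ⟨_, h8, _, h9, he⟩ := h7
      rw [mem_span_singleton_pow_mul] at h8
      rw [Submodule.mem_span_singleton_mul] at h9
      obtain ⟨s, hs, rfl⟩ := h8
      obtain ⟨s', hs', rfl⟩ := h9
      have hzj : z ^ j * s ∈ Submodule.span R {z} ^ j * F ^ (q + J) :=
        mem_span_singleton_pow_mul.mpr ⟨s, hs, rfl⟩
      have hzj' : z ^ j * s ∈ F ^ (q + j + J) := by
        refine (?_ : _ ≤ F ^ (q + j + J)) hzj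
        calc Submodule.span R {z} ^ j * F ^ (q + J) ≤ F ^ j * F ^ (q + J) := by gcongr
          _ = _ := by ring
      have hwm : w * m ∈ F ^ (q + j + J) := by
        rw [add_comm, pow_add]; exact Submodule.mul_mem_mul hw hm
      have h10 : w * m - z ^ j * s ∈ Submodule.span R {t} * F ^ (q + j + J) := by
        refine h2 _ (by omega) _ (sub_mem hwm hzj') ?_
        rw [Submodule.mem_span_singleton_mul]
        refine ⟨s' - w * l, sub_mem (by convert hs' using 2; ring) ?_, ?_⟩
        · rw [show q + j + J + 1 = J + (q + j + 1) by ring, pow_add]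
          exact Submodule.mul_mem_mul hw hl
        · linear_combination he
      rw [show w * m = z ^ j * s + (w * m - z ^ j * s) by ring]
      exact Submodule.add_mem_sup hzj h10
    rw [Submodule.mem_sup] at hmm
    obtain ⟨_, h5, l', h6, rfl⟩ := hmm
    rw [mem_span_singleton_pow_mul] at h5
    obtain ⟨m', hm', rfl⟩ := h5
    rw [mul_add, add_assoc]
    refine Submodule.add_mem_sup (mem_span_singleton_pow_mul.mpr ⟨m', hm', by ring⟩)
      (add_mem ?_ (Submodule.mem_span_singleton_mul.mpr ⟨l, hl, rfl⟩))
    rw [Submodule.mem_span_singleton_mul] at h6 ⊢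
    obtain ⟨l'', h, rfl⟩ := h6
    refine ⟨z * l'', ?_, by ring⟩
    rw [← add_assoc, pow_succ']; exact Submodule.mul_mem_mul hz h

end Lifting

section Idempotents

variable {R S : Type*} [CommRing R] [CommRing S] [IsDomain S] [Algebra R S]

/-- Lifting a decomposition modulo `τ` to all powers of `τ`. -/
lemma exists_lift_decomposition {F b c : Submodule R S} {τ : R} {z : S}
    (ht : algebraMap R S τ ≠ 0) {q₀ : ℕ} (hz : z ∈ F) (hF : F = b ⊔ c)
    (hbc : b * c ≤ Submodule.span R {algebraMap R S τ} * F ^ 2)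
    (h2 : ∀ q ≥ q₀, ∀ n ∈ F ^ q, z * n ∈ Submodule.span R {algebraMap R S τ} * F ^ (q + 1) →
      n ∈ Submodule.span R {algebraMap R S τ} * F ^ q)
    (h3 : ∀ q ≥ q₀, ∀ n ∈ F ^ (q + 1), ∀ J,
      (∀ u ∈ F ^ J, u * n ∈ Submodule.span R {z} * F ^ (q + J) ⊔
      Submodule.span R {algebraMap R S τ} * F ^ (q + 1 + J)) →
      n ∈ Submodule.span R {z} * F ^ q ⊔ Submodule.span R {algebraMap R S τ} * F ^ (q + 1)) :
    ∀ t, ∀ q ≥ q₀, ∀ x ∈ F ^ q, ∃ y ∈ F ^ q,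
      (∀ w ∈ c ^ t, w * (y - x) ∈ Submodule.span R {algebraMap R S τ} ^ t * F ^ (q + t)) ∧
      (∀ w ∈ b ^ t, w * y ∈ Submodule.span R {algebraMap R S τ} ^ t * F ^ (q + t)) := by
  intro t
  induction t with
  | zero => intro q _ x hx; exact ⟨x, hx, by simp, fun w hw => by
      rw [pow_zero, one_mul, add_zero]
      rw [← one_mul (F ^ q)]
      exact Submodule.mul_mem_mul (by simpa using hw) hx⟩
  | succ t ih =>
    intro q hq x hx
    obtain ⟨y, hy, hcy, hby⟩ := ih q hq x hx
    set T := Submodule.span R {algebraMap R S τ} with hT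
    have hbF : b ≤ F := by rw [hF]; exact le_sup_left
    have hcF : c ≤ F := by rw [hF]; exact le_sup_right
    -- products of high powers of `b` and `c`
    have hbcpow : ∀ m, b ^ m * c ^ m ≤ T ^ m * F ^ (2 * m) := by
      intro m
      calc b ^ m * c ^ m = (b * c) ^ m := (mul_pow _ _ _).symm
        _ ≤ (T * F ^ 2) ^ m := pow_le_pow_left' hbc m
        _ = _ := by rw [mul_pow, ← pow_mul]
    have hsplit : F ^ (2 * (t + 1)) ≤ b ^ (t + 1) * F ^ (t + 1) ⊔ c ^ (t + 1) * F ^ (t + 1) := by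
      have := sup_pow_two_mul_le b c (t + 1)
      rwa [← hF] at this
    have hcy' : ∀ g ∈ c ^ (t + 1) * F ^ (t + 1), g * (y - x) ∈ T ^ t * F ^ (q + 2 * (t + 1)) := by
      intro g hg
      have h : g * (y - x) ∈ (c * F ^ (t + 1)) * (c ^ t * Submodule.span R {y - x}) := by
        rw [show (c * F ^ (t + 1)) * (c ^ t * Submodule.span R {y - x}) =
          (c ^ (t + 1) * F ^ (t + 1)) * Submodule.span R {y - x} by ring]
        exact Submodule.mul_mem_mul hg (Submodule.mem_span_singleton_self _)
      refine (?_ : _ ≤ (_ : Submodule R S)) h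
      have h1 : c ^ t * Submodule.span R {y - x} ≤ T ^ t * F ^ (q + t) := by
        rw [Submodule.mul_le]
        intro w hw z hz
        obtain ⟨r, rfl⟩ := Submodule.mem_span_singleton.mp hz
        rw [mul_smul_comm]; exact Submodule.smul_mem _ _ (hcy w hw)
      calc _ ≤ (F * F ^ (t + 1)) * (T ^ t * F ^ (q + t)) := by gcongr
        _ = _ := by ring
    have hby' : ∀ g ∈ b ^ (t + 1) * F ^ (t + 1), g * y ∈ T ^ t * F ^ (q + 2 * (t + 1)) := by
      intro g hg
      have h : g * y ∈ (b * F ^ (t + 1)) * (b ^ t * Submodule.span R {y}) := by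
        rw [show (b * F ^ (t + 1)) * (b ^ t * Submodule.span R {y}) =
          (b ^ (t + 1) * F ^ (t + 1)) * Submodule.span R {y} by ring]
        exact Submodule.mul_mem_mul hg (Submodule.mem_span_singleton_self _)
      refine (?_ : _ ≤ (_ : Submodule R S)) h
      have h1 : b ^ t * Submodule.span R {y} ≤ T ^ t * F ^ (q + t) := by
        rw [Submodule.mul_le]
        intro w hw z hz
        obtain ⟨r, rfl⟩ := Submodule.mem_span_singleton.mp hz
        rw [mul_smul_comm]; exact Submodule.smul_mem _ _ (hby w hw)
      calc _ ≤ (F * F ^ (t + 1)) * (T ^ t * F ^ (q + t)) := by gcongr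
        _ = _ := by ring
    have hzj : z ^ (2 * (t + 1)) ∈ F ^ (2 * (t + 1)) := Submodule.pow_mem_pow _ hz _
    obtain ⟨β, hβ, γ, hγ, hβγ⟩ := Submodule.mem_sup.mp (hsplit hzj)
    have hn : γ * x - z ^ (2 * (t + 1)) * y ∈ T ^ t * F ^ (q + 2 * (t + 1)) := by
      have : γ * x - z ^ (2 * (t + 1)) * y = - (γ * (y - x)) - β * y := by
        rw [← hβγ]; ring
      rw [this]
      exact sub_mem (neg_mem (hcy' γ hγ)) (hby' β hβ)
    obtain ⟨n', hn', hnn'⟩ := mem_span_singleton_pow_mul.mp hn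
    have hcross : ∀ β' ∈ b ^ (t + 1) * F ^ (t + 1), ∀ γ' ∈ c ^ (t + 1) * F ^ (t + 1),
        β' * γ' * x ∈ T ^ (t + 1) * F ^ (q + 4 * (t + 1)) := by
      intro β' hβ' γ' hγ'
      have := Submodule.mul_mem_mul (Submodule.mul_mem_mul hβ' hγ') hx
      refine (?_ : _ ≤ (_ : Submodule R S)) this
      calc _ = (b ^ (t + 1) * c ^ (t + 1)) * (F ^ (t + 1) * F ^ (t + 1) * F ^ q) := by ring
        _ ≤ (T ^ (t + 1) * F ^ (2 * (t + 1))) * (F ^ (t + 1) * F ^ (t + 1) * F ^ q) := by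
          exact mul_le_mul' (hbcpow _) le_rfl
        _ = _ := by ring
    have hn'mem : n' ∈ Submodule.span R {z} ^ (2 * (t + 1)) * F ^ q ⊔
        T * F ^ (q + 2 * (t + 1)) := by
      refine mem_sup_of_forall_mul_mem hz h2 h3 _ q hq n' hn' (2 * (t + 1)) fun u hu => ?_
      obtain ⟨β', hβ', γ', hγ', rfl⟩ := Submodule.mem_sup.mp (hsplit hu)
      have e1 : γ' * x - (β' + γ') * y ∈ T ^ t * F ^ (q + 2 * (t + 1)) := by
        have : γ' * x - (β' + γ') * y = - (γ' * (y - x)) - β' * y := by ring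
        rw [this]
        exact sub_mem (neg_mem (hcy' γ' hγ')) (hby' β' hβ')
      obtain ⟨g, hg, hge⟩ := mem_span_singleton_pow_mul.mp e1
      have e2 := sub_mem (hcross β' hβ' γ hγ) (hcross β hβ γ' hγ')
      obtain ⟨g', hg', hge'⟩ := mem_span_singleton_pow_mul.mp e2
      have e3 : (β' + γ') * n' = z ^ (2 * (t + 1)) * g + algebraMap R S τ * g' := by
        apply mul_left_cancel₀ (pow_ne_zero t ht)
        have e4 : algebraMap R S τ ^ t * (z ^ (2 * (t + 1)) * g + algebraMap R S τ * g') =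
          z ^ (2 * (t + 1)) * (algebraMap R S τ ^ t * g) + algebraMap R S τ ^ (t + 1) * g' := by
          ring
        rw [e4, hge, hge', ← hβγ, show algebraMap R S τ ^ t * ((β' + γ') * n') =
          (β' + γ') * (algebraMap R S τ ^ t * n') by ring, hnn', ← hβγ]
        ring
      rw [e3]
      refine Submodule.add_mem_sup (mem_span_singleton_pow_mul.mpr ⟨g, hg, rfl⟩)
        (Submodule.mem_span_singleton_mul.mpr ⟨g', ?_, rfl⟩)
      convert hg' using 2; ring
    obtain ⟨_, h5, _, h6, he⟩ := Submodule.mem_sup.mp hn'mem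
    obtain ⟨δ, hδ, rfl⟩ := mem_span_singleton_pow_mul.mp h5
    obtain ⟨ε, hε, rfl⟩ := Submodule.mem_span_singleton_mul.mp h6
    have hzy : z ^ (2 * (t + 1)) * (y + algebraMap R S τ ^ t * δ) =
        γ * x - algebraMap R S τ ^ (t + 1) * ε := by
      rw [← he] at hnn'
      linear_combination hnn'
    have hy' : y + algebraMap R S τ ^ t * δ ∈ F ^ q :=
      add_mem hy (span_singleton_algebraMap_pow_mul_le τ t _
        (mem_span_singleton_pow_mul.mpr ⟨δ, hδ, rfl⟩))
    have hε' : ∀ w ∈ F ^ (t + 1), algebraMap R S τ ^ (t + 1) * (w * ε) ∈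
        T ^ (t + 1) * F ^ (q + (t + 1) + 2 * (t + 1)) := by
      intro w hw
      refine mem_span_singleton_pow_mul.mpr ⟨w * ε, ?_, rfl⟩
      rw [show q + (t + 1) + 2 * (t + 1) = (t + 1) + (q + 2 * (t + 1)) by ring, pow_add]
      exact Submodule.mul_mem_mul hw hε
    refine ⟨_, hy', fun w hw => ?_, fun w hw => ?_⟩
    · have hwF : w ∈ F ^ (t + 1) := pow_le_pow_left' hcF _ hw
      refine mem_pow_mul_of_mul_mem ht hz h2 (t + 1) (2 * (t + 1)) _ (by omega) _ ?_ ?_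
      · rw [add_comm q, pow_add]
        exact Submodule.mul_mem_mul hwF (sub_mem hy' hx)
      · have : z ^ (2 * (t + 1)) * (w * (y + algebraMap R S τ ^ t * δ - x)) =
            - (w * β * x) - algebraMap R S τ ^ (t + 1) * (w * ε) := by
          linear_combination w * hzy + w * x * hβγ
        rw [this]
        refine sub_mem (neg_mem ?_) (hε' w hwF)
        have := Submodule.mul_mem_mul (Submodule.mul_mem_mul hw hβ) hx
        refine (?_ : _ ≤ (_ : Submodule R S)) this
        calc _ = (b ^ (t + 1) * c ^ (t + 1)) * (F ^ (t + 1) * F ^ q) := by ring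
          _ ≤ (T ^ (t + 1) * F ^ (2 * (t + 1))) * (F ^ (t + 1) * F ^ q) := by
            exact mul_le_mul' (hbcpow _) le_rfl
          _ = _ := by ring
    · have hwF : w ∈ F ^ (t + 1) := pow_le_pow_left' hbF _ hw
      refine mem_pow_mul_of_mul_mem ht hz h2 (t + 1) (2 * (t + 1)) _ (by omega) _ ?_ ?_
      · rw [add_comm q, pow_add]
        exact Submodule.mul_mem_mul hwF hy'
      · have : z ^ (2 * (t + 1)) * (w * (y + algebraMap R S τ ^ t * δ)) =
            w * γ * x - algebraMap R S τ ^ (t + 1) * (w * ε) := by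
          linear_combination w * hzy
        rw [this]
        refine sub_mem ?_ (hε' w hwF)
        have := Submodule.mul_mem_mul (Submodule.mul_mem_mul hw hγ) hx
        refine (?_ : _ ≤ (_ : Submodule R S)) this
        calc _ = (b ^ (t + 1) * c ^ (t + 1)) * (F ^ (t + 1) * F ^ q) := by ring
          _ ≤ (T ^ (t + 1) * F ^ (2 * (t + 1))) * (F ^ (t + 1) * F ^ q) := by
            exact mul_le_mul' (hbcpow _) le_rfl
          _ = _ := by ring

/-- Two lifts are proportional modulo `τ ^ t`. -/
lemma lift_proportional {F b c : Submodule R S} {τ : R} {z : S}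
    (ht : algebraMap R S τ ≠ 0) {q₀ : ℕ} (hz : z ∈ F) (hF : F = b ⊔ c)
    (h2 : ∀ q ≥ q₀, ∀ n ∈ F ^ q, z * n ∈ Submodule.span R {algebraMap R S τ} * F ^ (q + 1) →
      n ∈ Submodule.span R {algebraMap R S τ} * F ^ q) {t q : ℕ} (hq : q ≥ q₀) {x y x' y' : S}
    (hx : x ∈ F ^ q) (hy : y ∈ F ^ q) (hx' : x' ∈ F ^ q) (hy' : y' ∈ F ^ q)
    (h : ∀ w ∈ c ^ t, w * (y - x) ∈ Submodule.span R {algebraMap R S τ} ^ t * F ^ (q + t))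
    (hb : ∀ w ∈ b ^ t, w * y ∈ Submodule.span R {algebraMap R S τ} ^ t * F ^ (q + t))
    (h' : ∀ w ∈ c ^ t, w * (y' - x') ∈ Submodule.span R {algebraMap R S τ} ^ t * F ^ (q + t))
    (hb' : ∀ w ∈ b ^ t, w * y' ∈ Submodule.span R {algebraMap R S τ} ^ t * F ^ (q + t)) :
    x' * y - x * y' ∈ Submodule.span R {algebraMap R S τ} ^ t * F ^ (q + q) := by
  set T := Submodule.span R {algebraMap R S τ} with hT
  refine mem_pow_mul_of_mul_mem ht hz h2 t (2 * t) _ (by omega) _ ?_ ?_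
  · rw [pow_add]
    exact sub_mem (Submodule.mul_mem_mul hx' hy) (Submodule.mul_mem_mul hx hy')
  have hsplit : F ^ (2 * t) ≤ b ^ t * F ^ t ⊔ c ^ t * F ^ t := by
    have := sup_pow_two_mul_le b c t
    rwa [← hF] at this
  obtain ⟨β, hβ, γ, hγ, hβγ⟩ := Submodule.mem_sup.mp (hsplit (Submodule.pow_mem_pow _ hz _))
  have key : ∀ (B : Submodule R S) (s u : S), (∀ w ∈ B ^ t, w * s ∈ T ^ t * F ^ (q + t)) →
      u ∈ F ^ q → ∀ g ∈ B ^ t * F ^ t, g * (u * s) ∈ T ^ t * F ^ (q + q + 2 * t) := by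
    intro B s u hs hu g hg
    have h1 : B ^ t * Submodule.span R {s} ≤ T ^ t * F ^ (q + t) := by
      rw [Submodule.mul_le]
      intro w hw z hz
      obtain ⟨r, rfl⟩ := Submodule.mem_span_singleton.mp hz
      rw [mul_smul_comm]; exact Submodule.smul_mem _ _ (hs w hw)
    have := Submodule.mul_mem_mul hg
      (Submodule.mul_mem_mul hu (Submodule.mem_span_singleton_self (R := R) s))
    refine (?_ : _ ≤ (_ : Submodule R S)) this
    calc _ = (B ^ t * Submodule.span R {s}) * (F ^ t * F ^ q) := by ring
      _ ≤ (T ^ t * F ^ (q + t)) * (F ^ t * F ^ q) := by gcongr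
      _ = _ := by ring
  have : z ^ (2 * t) * (x' * y - x * y') = (β * (x' * y) - β * (x * y')) +
      (γ * (x' * (y - x)) - γ * (x * (y' - x'))) := by rw [← hβγ]; ring
  rw [this]
  exact add_mem (sub_mem (key b y x' hb hx' β hβ) (key b y' x hb' hx β hβ))
    (sub_mem (key c _ x' h hx' γ hγ) (key c _ x h' hx γ hγ))

end Idempotents

section Retractions

lemma exists_mem_ker_sup_of_pow_smul {R A B : Type*} [CommRing R] [IsNoetherianRing R]
    [AddCommGroup A] [Module R A] [AddCommGroup B] [Module R B] [Module.Finite R B]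
    (I : Ideal R) (φ : A →ₗ[R] B) (y : ℕ → A)
    (hy : ∀ t, φ (y t) ∈ (I ^ t • ⊤ : Submodule R B)) :
    ∃ t ≥ 1, y t ∈ LinearMap.ker φ ⊔ (I • ⊤ : Submodule R A) := by
  obtain ⟨m, hm⟩ := Ideal.exists_pow_inf_eq_pow_smul I (LinearMap.range φ)
  refine ⟨m + 1, by omega, ?_⟩
  have h1 : φ (y (m + 1)) ∈ (I ^ (m + 1) • ⊤ ⊓ LinearMap.range φ : Submodule R B) :=
    ⟨hy _, LinearMap.mem_range_self _ _⟩
  rw [hm (m + 1) (by omega), Nat.add_sub_cancel_left, pow_one] at h1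
  have h2 : φ (y (m + 1)) ∈ (I • ⊤ : Submodule R A).map φ := by
    rw [Submodule.map_smul'', Submodule.map_top]
    exact Submodule.smul_mono le_rfl inf_le_right h1
  have h3 : y (m + 1) ∈ ((I • ⊤ : Submodule R A).map φ).comap φ := h2
  rwa [Submodule.comap_map_eq, sup_comm] at h3

variable {R S : Type*} [CommRing R] [CommRing S] [Algebra R S]

lemma eq_zero_of_homogeneous_relation [IsDomain S] (p : S →ₐ[R] R) {x y : S} (hx : p x = 1)
    (hy : p y = 0) (d : ℕ) (a : ℕ → R) (ha : a d = 1)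
    (h : ∑ i ∈ Finset.range (d + 1), algebraMap R S (a i) * y ^ i * x ^ (d - i) = 0) : y = 0 := by
  induction d generalizing a with
  | zero => simp [ha] at h
  | succ d ih =>
    rw [Finset.sum_range_succ'] at h
    have h0 : a 0 = 0 := by
      have := congrArg p h
      simpa [hx, hy, map_sum] using this
    rw [h0] at h
    have h1 : y * ∑ i ∈ Finset.range (d + 1),
        algebraMap R S (a (i + 1)) * y ^ i * x ^ (d - i) = 0 := by
      rw [← h, Finset.mul_sum]
      simp only [map_zero, zero_mul, add_zero]
      refine Finset.sum_congr rfl fun i _ => ?_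
      rw [Nat.add_sub_add_right]; ring
    rcases mul_eq_zero.mp h1 with h2 | h2
    · exact h2
    · exact ih (fun i => a (i + 1)) ha h2

lemma eq_smul_of_mul_mem [IsDomain S] (p : S →ₐ[R] R) {N : Submodule R S} (hN : N.FG) {x y : S}
    (hxN : x ∈ N) (hx : p x = 1) (hy : ∀ w ∈ N, ∃ w' ∈ N, w * y = x * w') :
    y = algebraMap R S (p y) * x := by
  have hx0 : x ≠ 0 := by rintro rfl; simp at hx; exact one_ne_zero (α := S) (by
    rw [← map_one (algebraMap R S), ← hx, map_zero])
  let K := FractionRing S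
  have hxK : algebraMap S K x ≠ 0 := by
    rwa [Ne, FaithfulSMul.algebraMap_eq_zero_iff]
  set y' := y - algebraMap R S (p y) * x with hy'
  have hy'N : ∀ w ∈ N, ∃ w' ∈ N, w * y' = x * w' := by
    intro w hw
    obtain ⟨w', hw', h⟩ := hy w hw
    refine ⟨w' - p y • w, sub_mem hw' (Submodule.smul_mem _ _ hw), ?_⟩
    rw [hy', mul_sub, h, Algebra.smul_def]; ring
  have hint : IsIntegral R (algebraMap S K y' / algebraMap S K x) := by
    refine isIntegral_of_smul_mem_submodule
      (N.map (IsScalarTower.toAlgHom R S K).toLinearMap) ?_ (hN.map _) _ ?_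
    · intro h
      have : algebraMap S K x ∈ (N.map (IsScalarTower.toAlgHom R S K).toLinearMap) :=
        ⟨x, hxN, rfl⟩
      rw [h] at this
      exact hxK this
    · rintro _ ⟨w, hw, rfl⟩
      obtain ⟨w', hw', h⟩ := hy'N w hw
      refine ⟨w', hw', ?_⟩
      have := congrArg (algebraMap S K) h
      rw [map_mul, map_mul] at this
      change algebraMap S K w' = (algebraMap S K y' / algebraMap S K x) * algebraMap S K w
      rw [div_mul_eq_mul_div, eq_div_iff hxK]
      linear_combination -this
  obtain ⟨g, hg, hge⟩ := hint
  have : y' = 0 := by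
    refine eq_zero_of_homogeneous_relation p hx (by simp [hy', hx]) g.natDegree g.coeff hg ?_
    rw [← FaithfulSMul.algebraMap_eq_zero_iff S K, map_sum]
    rw [Polynomial.eval₂_eq_sum_range] at hge
    rw [← zero_mul (algebraMap S K x ^ g.natDegree), ← hge, Finset.sum_mul]
    refine Finset.sum_congr rfl fun i hi => ?_
    rw [Finset.mem_range] at hi
    rw [map_mul, map_mul, map_pow, map_pow, ← IsScalarTower.algebraMap_apply, div_pow,
      ← Nat.sub_add_cancel (show i ≤ g.natDegree by omega), pow_add, Nat.add_sub_cancel_right,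
      mul_div_assoc', div_mul_eq_mul_div, eq_div_iff (pow_ne_zero _ hxK)]
    ring
  exact sub_eq_zero.mp this

/-- Two retractions of a domain `S` over `R` cannot be separated by a decomposition of a finite
module which is orthogonal modulo a nonunit `τ`. -/
theorem false_of_separated_retractions (k : Type*) [Field k] [Infinite k] [IsNoetherianRing R]
    [Algebra k R] [IsDomain S] {ι : Type*} [Fintype ι] (v : ι → S) {b c : Submodule R S} {τ : R}
    (hF : Submodule.span R (range v) = b ⊔ c) (hτ : τ ≠ 0) (hτu : ¬ IsUnit τ)
    (hbc : b * c ≤ Submodule.span R {algebraMap R S τ} * Submodule.span R (range v) ^ 2)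
    (p q : S →ₐ[R] R) {x₀ b₀ c₀ : S} (hx₀ : x₀ ∈ Submodule.span R (range v))
    (hpx : p x₀ = 1) (hqx : q x₀ = 1) (hc₀ : c₀ ∈ c) (hpc : p c₀ = 1) (hb₀ : b₀ ∈ b)
    (hqb : q b₀ = 1) : False := by
  have ht : algebraMap R S τ ≠ 0 := fun h => hτ (by simpa using congrArg p h)
  set T := Submodule.span R {algebraMap R S τ} with hT
  set F := Submodule.span R (range v) with hFd
  have hFfg : F.FG := ⟨(Set.finite_range v).toFinset, by simp [hFd]⟩
  obtain ⟨z, hz, q₁, h2⟩ := exists_generic_linear_combination v (fun n => T * F ^ n)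
    (fun n => le_of_eq (by ring)) k
  have ha : ∃ a : ℕ → Submodule R S, (∀ n, a (n + 1) = Submodule.span R {z} * F ^ n ⊔
      T * F ^ (n + 1)) ∧ a 0 = T :=
    ⟨fun n => Nat.casesOn n T fun n => Submodule.span R {z} * F ^ n ⊔ T * F ^ (n + 1),
      fun n => rfl, rfl⟩
  obtain ⟨a, ha, ha0⟩ := ha
  obtain ⟨q₂, h3⟩ := exists_saturation_bound v a (by
    rintro (_ | n)
    · rw [ha, ha0]
      exact le_sup_of_le_right (le_of_eq (by ring))
    · rw [ha, ha]
      refine le_of_eq ?_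
      rw [Submodule.mul_sup]
      congr 1 <;> ring)
  obtain ⟨Q, hQ⟩ : ∃ Q, Q = max q₁ q₂ := ⟨_, rfl⟩
  have h2' : ∀ q ≥ Q, ∀ n ∈ F ^ q, z * n ∈ T * F ^ (q + 1) → n ∈ T * F ^ q :=
    fun q hq => h2 q (by omega)
  have h3' : ∀ q ≥ Q, ∀ n ∈ F ^ (q + 1), ∀ J, (∀ u ∈ F ^ J, u * n ∈ Submodule.span R {z} *
      F ^ (q + J) ⊔ T * F ^ (q + 1 + J)) → n ∈ Submodule.span R {z} * F ^ q ⊔ T * F ^ (q + 1) := by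
    intro q hq n hn J h
    rw [← ha]
    refine h3 (q + 1) (by omega) n hn J fun u hu => ?_
    rw [show q + 1 + J = (q + J) + 1 by ring, ha]
    convert h u hu using 3; ring
  have hP := exists_lift_decomposition ht hz hF hbc h2' h3'
  set x := x₀ ^ Q with hx
  have hxF : x ∈ F ^ Q := Submodule.pow_mem_pow _ hx₀ _
  have hpx' : p x = 1 := by rw [hx, map_pow, hpx, one_pow]
  have hqx' : q x = 1 := by rw [hx, map_pow, hqx, one_pow]
  choose y hyF hyc hyb using fun t => hP t Q le_rfl x hxF
  have hprop : ∀ t, ∀ w ∈ F ^ Q, ∃ w' ∈ F ^ Q, w * y t - x * w' ∈ T ^ t * F ^ (Q + Q) := by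
    intro t w hw
    obtain ⟨w', hw', hc', hb'⟩ := hP t Q le_rfl w hw
    exact ⟨w', hw', lift_proportional ht hz hF h2' le_rfl hxF (hyF t) hw hw' (hyc t) (hyb t)
      hc' hb'⟩
  obtain ⟨s, hs⟩ := hFfg.pow Q
  let L : Submodule R ↥(F ^ (Q + Q)) := (Submodule.span R {x} * F ^ Q).submoduleOf _
  have hmulmem : ∀ i ∈ s, ∀ w ∈ F ^ Q, i * w ∈ F ^ (Q + Q) := by
    intro i hi w hw
    rw [pow_add]
    exact Submodule.mul_mem_mul (by rw [← hs]; exact Submodule.subset_span hi) hw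
  let φ : ↥(F ^ Q) →ₗ[R] (s → ↥(F ^ (Q + Q)) ⧸ L) := LinearMap.pi fun i =>
    L.mkQ ∘ₗ ((LinearMap.mulLeft R (i : S)).restrict (hmulmem i i.2))
  have : Module.Finite R ↥(F ^ (Q + Q)) := Module.Finite.iff_fg.mpr (hFfg.pow _)
  obtain ⟨t, ht1, htm⟩ := exists_mem_ker_sup_of_pow_smul (Ideal.span {τ}) φ
    (fun t => ⟨y t, hyF t⟩) (by
      intro t
      have : ∀ i : s, ∃ g : ↥(F ^ (Q + Q)) ⧸ L, φ ⟨y t, hyF t⟩ i = τ ^ t • g := by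
        intro i
        obtain ⟨w', hw', h⟩ := hprop t i (by rw [← hs]; exact Submodule.subset_span i.2)
        obtain ⟨g, hg, h⟩ := mem_span_singleton_pow_mul.mp h
        refine ⟨L.mkQ ⟨g, hg⟩, ?_⟩
        change L.mkQ _ = _
        rw [← map_smul, ← sub_eq_zero, ← map_sub, Submodule.mkQ_apply,
          Submodule.Quotient.mk_eq_zero]
        refine Submodule.mem_span_singleton_mul.mpr ⟨w', hw', ?_⟩
        change x * w' = i * y t - τ ^ t • g
        rw [Algebra.smul_def, map_pow, h]; ring
      choose g hg using this
      have : φ ⟨y t, hyF t⟩ = τ ^ t • g := funext hg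
      rw [this]
      exact Submodule.smul_mem_smul (Ideal.pow_mem_pow (Ideal.mem_span_singleton_self τ) _)
        trivial)
  obtain ⟨y', hy', g, hg, hyg⟩ := Submodule.mem_sup.mp htm
  rw [Submodule.ideal_span_singleton_smul] at hg
  obtain ⟨g, -, rfl⟩ := (Submodule.mem_smul_pointwise_iff_exists _ _ _).mp hg
  have hyg' : (y' : S) = y t - algebraMap R S τ * g := by
    have := congrArg Subtype.val hyg
    rw [Submodule.coe_add, Submodule.coe_smul, Algebra.smul_def] at this
    exact eq_sub_of_add_eq this
  have hker : ∀ w ∈ F ^ Q, ∃ w' ∈ F ^ Q, w * (y' : S) = x * w' := by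
    intro w hw
    rw [← hs] at hw
    induction hw using Submodule.span_induction with
    | mem i hi =>
      have h1 : φ y' ⟨i, hi⟩ = 0 := by rw [LinearMap.mem_ker.mp hy']; rfl
      change L.mkQ _ = 0 at h1
      rw [Submodule.mkQ_apply, Submodule.Quotient.mk_eq_zero] at h1
      obtain ⟨w', hw', h⟩ := Submodule.mem_span_singleton_mul.mp h1
      exact ⟨w', hw', h.symm⟩
    | zero => exact ⟨0, zero_mem _, by simp⟩
    | add u w _ _ hu hw =>
      obtain ⟨u', hu', hu⟩ := hu
      obtain ⟨w', hw', hw⟩ := hw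
      exact ⟨u' + w', add_mem hu' hw', by rw [add_mul, hu, hw, mul_add]⟩
    | smul r w _ hw =>
      obtain ⟨w', hw', hw⟩ := hw
      exact ⟨r • w', Submodule.smul_mem _ _ hw', by rw [smul_mul_assoc, hw, mul_smul_comm]⟩
  have hy'x := eq_smul_of_mul_mem p (hFfg.pow Q) hxF hpx' hker
  have hpq : q y' = p y' := by
    conv_lhs => rw [hy'x]
    rw [map_mul, hqx', AlgHom.commutes, mul_one]; rfl
  have hp1 : τ ∣ p (y t) - 1 := by
    obtain ⟨g', -, h⟩ := mem_span_singleton_pow_mul.mp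
      (hyc t _ (Submodule.pow_mem_pow _ hc₀ t))
    have := congrArg p h
    rw [map_mul, map_mul, map_pow, map_pow, AlgHom.commutes, map_sub, hpc, hpx', one_pow,
      one_mul] at this
    rw [← this]
    exact Dvd.dvd.mul_right (dvd_pow_self _ (by omega)) _
  have hq0 : τ ∣ q (y t) := by
    obtain ⟨g', -, h⟩ := mem_span_singleton_pow_mul.mp
      (hyb t _ (Submodule.pow_mem_pow _ hb₀ t))
    have := congrArg q h
    rw [map_mul, map_mul, map_pow, map_pow, AlgHom.commutes, hqb, one_pow, one_mul] at this
    rw [← this]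
    exact Dvd.dvd.mul_right (dvd_pow_self _ (by omega)) _
  apply hτu
  rw [isUnit_iff_dvd_one]
  have h1 : p (y t) = p y' + τ * p g := by rw [hyg']; simp
  have h2 : q (y t) = q y' + τ * q g := by rw [hyg']; simp
  obtain ⟨e1, he1⟩ := hp1
  obtain ⟨e2, he2⟩ := hq0
  exact ⟨e2 - q g - e1 + p g, by
    have h3 : p (y t) - 1 = τ * e1 := he1
    have h4 : q (y t) = τ * e2 := he2
    linear_combination h1 - h3 - hpq - h2 + h4⟩

end Retractions

section Diagonal

lemma aeval_sub_algebraMap_eval_mem {k R σ : Type*} [Field k] [CommRing R] [Algebra k R]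
    {m : Ideal R} {a : σ → R} {p : σ → k} (ha : ∀ j, a j - algebraMap k R (p j) ∈ m)
    (G : MvPolynomial σ k) : aeval a G - algebraMap k R (eval p G) ∈ m := by
  induction G using MvPolynomial.induction_on with
  | C c => simp
  | add f g hf hg =>
    rw [map_add, map_add, map_add, add_sub_add_comm]; exact add_mem hf hg
  | mul_X f i hf =>
    rw [map_mul, map_mul, map_mul, aeval_X, eval_X]
    have : (aeval a f) * a i - algebraMap k R (eval p f) * algebraMap k R (p i) =
      (aeval a f - algebraMap k R (eval p f)) * a i +
        algebraMap k R (eval p f) * (a i - algebraMap k R (p i)) := by ring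
    rw [this]
    exact add_mem (Ideal.mul_mem_right _ _ hf) (Ideal.mul_mem_left _ _ (ha i))

/-- First order Taylor expansion. -/
lemma aeval_sub_aeval_sub_mem {k R σ : Type*} [Field k] [CommRing R] [Algebra k R] [Fintype σ]
    {m B : Ideal R} {a b : σ → R} {p : σ → k} (ha : ∀ j, a j - algebraMap k R (p j) ∈ m)
    (hb : ∀ j, b j - algebraMap k R (p j) ∈ m) (hab : ∀ j, b j - a j ∈ B)
    (G : MvPolynomial σ k) :
    aeval b G - aeval a G - ∑ j, algebraMap k R (eval p (pderiv j G)) * (b j - a j) ∈ m * B := by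
  classical
  induction G using MvPolynomial.induction_on with
  | C c => simp
  | add f g hf hg =>
    convert add_mem hf hg using 1
    simp only [map_add, add_mul, Finset.sum_add_distrib]
    ring
  | mul_X f i hf =>
    have h1 : ∑ j, algebraMap k R (eval p (pderiv j f)) * (b j - a j) ∈ B :=
      sum_mem fun j _ => Ideal.mul_mem_left _ _ (hab j)
    have h2 : ∑ j, algebraMap k R (eval p (pderiv j (f * X i))) * (b j - a j) =
        algebraMap k R (p i) * ∑ j, algebraMap k R (eval p (pderiv j f)) * (b j - a j) +
        algebraMap k R (eval p f) * (b i - a i) := by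
      simp only [pderiv_mul, pderiv_X, map_add, map_mul, eval_X, add_mul, Finset.sum_add_distrib,
        Finset.mul_sum]
      congr 1
      · exact Finset.sum_congr rfl fun j _ => by ring
      · rw [Finset.sum_eq_single i]
        · simp
        · intro j _ hj
          simp [Ne.symm hj]
        · simp
    have h3 : aeval b (f * X i) - aeval a (f * X i) -
        ∑ j, algebraMap k R (eval p (pderiv j (f * X i))) * (b j - a j) =
        b i * (aeval b f - aeval a f -
          ∑ j, algebraMap k R (eval p (pderiv j f)) * (b j - a j)) +
        (b i - algebraMap k R (p i)) *
          ∑ j, algebraMap k R (eval p (pderiv j f)) * (b j - a j) +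
        (aeval a f - algebraMap k R (eval p f)) * (b i - a i) := by
      rw [h2]; simp only [map_mul, aeval_X]; ring
    rw [h3]
    exact add_mem (add_mem (Ideal.mul_mem_left _ _ hf) (Ideal.mul_mem_mul (hb i) h1))
      (Ideal.mul_mem_mul (aeval_sub_algebraMap_eval_mem ha f) (hab i))

lemma aeval_mul_of_isHomogeneous {k R σ : Type*} [Field k] [CommRing R] [Algebra k R]
    (s : R) (a : σ → R) {G : MvPolynomial σ k} {d : ℕ} (hG : G.IsHomogeneous d) :
    aeval (fun j => s * a j) G = s ^ d * aeval a G := by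
  rw [aeval_def, aeval_def, eval₂_eq, eval₂_eq, Finset.mul_sum]
  refine Finset.sum_congr rfl fun m hm => ?_
  have := hG (mem_support_iff.mp hm)
  rw [← this, Finsupp.weight_apply, Finsupp.sum]
  simp only [Pi.one_apply, smul_eq_mul, mul_one, mul_pow, Finset.prod_mul_distrib,
    Finset.prod_pow_eq_pow_sum]
  ring

lemma rename_eq_aeval {k σ τ : Type*} [Field k] (f : σ → τ) (G : MvPolynomial σ k) :
    rename f G = aeval (fun j => (X (f j) : MvPolynomial τ k)) G := by
  have : (rename f : MvPolynomial σ k →ₐ[k] MvPolynomial τ k) = aeval (fun j => X (f j)) :=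
    MvPolynomial.algHom_ext fun i => by simp
  rw [this]

/-- The `2 × 2` minors of a pair of vectors of variables. -/
noncomputable def minor (k : Type*) [Field k] {σ : Type*} (i j : σ) : MvPolynomial (σ ⊕ σ) k :=
  X (Sum.inl i) * X (Sum.inr j) - X (Sum.inl j) * X (Sum.inr i)

/-- The equations of the fibre product of the map given by `F` with itself. -/
noncomputable def fibreIdeal {k σ ι : Type*} [Field k] (I : Ideal (MvPolynomial σ k))
    (F : ι → MvPolynomial σ k) : Ideal (MvPolynomial (σ ⊕ σ) k) :=
  I.map (rename Sum.inl) ⊔ I.map (rename Sum.inr) ⊔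
    Ideal.span (range fun p : ι × ι => rename Sum.inl (F p.1) * rename Sum.inr (F p.2) -
      rename Sum.inl (F p.2) * rename Sum.inr (F p.1))

/-- Where `F` is unramified, the diagonal is open in the fibre product. -/
theorem exists_mul_minor_mem_fibreIdeal {k σ ι : Type*} [Field k] [Fintype σ]
    (I : Ideal (MvPolynomial σ k))
    (F : ι → MvPolynomial σ k) {d : ℕ} (hF : ∀ i, (F i).IsHomogeneous d) {v : σ → k}
    (hv : v ≠ 0)
    (hun : ∀ w : σ → k, (∀ g ∈ I, ∀ e, g.IsHomogeneous e → ∑ j, eval v (pderiv j g) * w j = 0) →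
      (∀ i l, eval v (F i) * ∑ j, eval v (pderiv j (F l)) * w j =
        eval v (F l) * ∑ j, eval v (pderiv j (F i)) * w j) → ∃ c : k, w = c • v) :
    ∃ c : MvPolynomial (σ ⊕ σ) k, eval (Sum.elim v v) c ≠ 0 ∧
      ∀ i j, c * minor k i j ∈ fibreIdeal I F := by
  classical
  obtain ⟨j₀, hj₀⟩ : ∃ j, v j ≠ 0 := by
    by_contra! h; exact hv (funext h)
  set h : MvPolynomial σ k := C (v j₀)⁻¹ * X j₀ with hh
  have hhv : eval v h = 1 := by simp [hh, hj₀]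
  let R := MvPolynomial (σ ⊕ σ) k
  set hx : R := rename Sum.inl h with hhx
  set hy : R := rename Sum.inr h with hhy
  let m : Ideal R := RingHom.ker (eval (Sum.elim v v))
  set E : Ideal R := fibreIdeal I F with hE
  let B : Ideal R := Ideal.span (range fun p : σ × σ => minor k p.1 p.2)
  let Q : Ideal R := E ⊔ m * B
  have hminor : ∀ i j, minor k i j ∈ B := fun i j => Ideal.subset_span ⟨(i, j), rfl⟩
  have hIl : ∀ g ∈ I, rename Sum.inl g ∈ E := fun g hg =>
    Ideal.mem_sup_left (Ideal.mem_sup_left (Ideal.mem_map_of_mem _ hg))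
  have hIr : ∀ g ∈ I, rename Sum.inr g ∈ E := fun g hg =>
    Ideal.mem_sup_left (Ideal.mem_sup_right (Ideal.mem_map_of_mem _ hg))
  have hEF : ∀ i l, rename Sum.inl (F i) * rename Sum.inr (F l) -
      rename Sum.inl (F l) * rename Sum.inr (F i) ∈ E := fun i l =>
    Ideal.mem_sup_right (Ideal.subset_span ⟨(i, l), rfl⟩)
  have hmx : ∀ G, rename Sum.inl G - algebraMap k R (eval v G) ∈ m := by
    intro G
    change eval _ _ = 0
    rw [map_sub, eval_rename, MvPolynomial.algebraMap_eq, eval_C]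
    simp
  have hmy : ∀ G, rename Sum.inr G - algebraMap k R (eval v G) ∈ m := by
    intro G
    change eval _ _ = 0
    rw [map_sub, eval_rename, MvPolynomial.algebraMap_eq, eval_C]
    simp
  let a : σ → R := fun j => hy * X (Sum.inl j)
  let b : σ → R := fun j => hx * X (Sum.inr j)
  have ha : ∀ j, a j - algebraMap k R (v j) ∈ m := by
    intro j
    change eval _ (hy * X (Sum.inl j) - C (v j)) = 0
    simp [hhy, eval_rename, hhv]
  have hb : ∀ j, b j - algebraMap k R (v j) ∈ m := by
    intro j
    change eval _ (hx * X (Sum.inr j) - C (v j)) = 0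
    simp [hhx, eval_rename, hhv]
  have hab : ∀ j, b j - a j ∈ B := by
    intro j
    have : b j - a j = C (v j₀)⁻¹ * minor k j₀ j := by
      simp only [a, b, hhx, hhy, hh, minor, map_mul, rename_C, rename_X]; ring
    rw [this]
    exact Ideal.mul_mem_left _ _ (hminor _ _)
  have haev : ∀ (G : MvPolynomial σ k) e, G.IsHomogeneous e →
      aeval a G = hy ^ e * rename Sum.inl G := by
    intro G e hG
    rw [aeval_mul_of_isHomogeneous _ _ hG, rename_eq_aeval]
  have hbev : ∀ (G : MvPolynomial σ k) e, G.IsHomogeneous e →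
      aeval b G = hx ^ e * rename Sum.inr G := by
    intro G e hG
    rw [aeval_mul_of_isHomogeneous _ _ hG, rename_eq_aeval]
  have hTaylor := fun G => aeval_sub_aeval_sub_mem ha hb hab G
  -- the space of linear relations
  let W : Submodule k (σ → k) :=
    { carrier := {l | ∑ j, algebraMap k R (l j) * (b j - a j) ∈ Q}
      zero_mem' := by simp
      add_mem' := fun {l l'} hl hl' => by
        simp only [mem_ofPred_eq, Pi.add_apply, map_add, add_mul, Finset.sum_add_distrib] at *
        exact add_mem hl hl'
      smul_mem' := fun c l hl => by
        simp only [mem_ofPred_eq, Pi.smul_apply, smul_eq_mul, map_mul, mul_assoc,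
          ← Finset.mul_sum] at *
        exact Ideal.mul_mem_left _ _ hl }
  have hWI : ∀ g ∈ I, ∀ e, g.IsHomogeneous e → (fun j => eval v (pderiv j g)) ∈ W := by
    intro g hg e hge
    change _ ∈ Q
    have h1 : aeval b g - aeval a g ∈ E := by
      rw [haev g e hge, hbev g e hge]
      exact sub_mem (Ideal.mul_mem_left _ _ (hIr g hg)) (Ideal.mul_mem_left _ _ (hIl g hg))
    have := sub_mem (Submodule.mem_sup_left (T := m * B) h1)
      (Submodule.mem_sup_right (S := E) (hTaylor g))
    simpa using this
  have hbrB : ∀ i, aeval b (F i) - aeval a (F i) ∈ B := by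
    intro i
    have h1 : _ ∈ B := (Ideal.mul_le.mpr fun r _ s hs => Ideal.mul_mem_left B r hs : m * B ≤ B)
      (hTaylor (F i))
    have h2 : ∑ j, algebraMap k R (eval v (pderiv j (F i))) * (b j - a j) ∈ B :=
      sum_mem fun j _ => Ideal.mul_mem_left _ _ (hab j)
    simpa using add_mem h1 h2
  have hWF : ∀ i l, (fun j => eval v (F i) * eval v (pderiv j (F l)) -
      eval v (F l) * eval v (pderiv j (F i))) ∈ W := by
    intro i l
    change _ ∈ Q
    have e1 : ∑ j, algebraMap k R (eval v (F i) * eval v (pderiv j (F l)) -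
        eval v (F l) * eval v (pderiv j (F i))) * (b j - a j) =
        - (algebraMap k R (eval v (F i)) * (aeval b (F l) - aeval a (F l) -
          ∑ j, algebraMap k R (eval v (pderiv j (F l))) * (b j - a j))) +
        algebraMap k R (eval v (F l)) * (aeval b (F i) - aeval a (F i) -
          ∑ j, algebraMap k R (eval v (pderiv j (F i))) * (b j - a j)) -
        (rename Sum.inl (F i) - algebraMap k R (eval v (F i))) * (aeval b (F l) - aeval a (F l)) +
        (rename Sum.inl (F l) - algebraMap k R (eval v (F l))) * (aeval b (F i) - aeval a (F i)) +
        hx ^ d * (rename Sum.inl (F i) * rename Sum.inr (F l) -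
          rename Sum.inl (F l) * rename Sum.inr (F i)) := by
      have e2 : ∑ j, algebraMap k R (eval v (F i) * eval v (pderiv j (F l)) -
          eval v (F l) * eval v (pderiv j (F i))) * (b j - a j) =
          algebraMap k R (eval v (F i)) *
            ∑ j, algebraMap k R (eval v (pderiv j (F l))) * (b j - a j) -
          algebraMap k R (eval v (F l)) *
            ∑ j, algebraMap k R (eval v (pderiv j (F i))) * (b j - a j) := by
        rw [Finset.mul_sum, Finset.mul_sum, ← Finset.sum_sub_distrib]
        refine Finset.sum_congr rfl fun j _ => ?_
        rw [map_sub, map_mul, map_mul]; ring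
      rw [e2, haev _ _ (hF i), haev _ _ (hF l), hbev _ _ (hF i), hbev _ _ (hF l)]
      ring
    rw [e1]
    refine add_mem (add_mem (sub_mem (add_mem (neg_mem ?_) ?_) ?_) ?_) ?_
    · exact Ideal.mul_mem_left _ _ (Ideal.mem_sup_right (hTaylor _))
    · exact Ideal.mul_mem_left _ _ (Ideal.mem_sup_right (hTaylor _))
    · exact Ideal.mem_sup_right (Ideal.mul_mem_mul (hmx _) (hbrB l))
    · exact Ideal.mem_sup_right (Ideal.mul_mem_mul (hmx _) (hbrB i))
    · exact Ideal.mem_sup_left (Ideal.mul_mem_left _ _ (hEF i l))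
  have hWh : Pi.single j₀ 1 ∈ W := by
    change _ ∈ Q
    rw [Finset.sum_eq_single j₀]
    · have : b j₀ - a j₀ = 0 := by
        simp only [a, b, hhx, hhy, hh, map_mul, rename_C, rename_X]; ring
      rw [this, mul_zero]; exact zero_mem _
    · intro j _ hj
      simp [hj]
    · simp
  have hWtop : W = ⊤ := by
    by_contra hne
    obtain ⟨f, hf0, hf⟩ := Submodule.exists_le_ker_of_lt_top W (lt_top_iff_ne_top.mpr hne)
    have hfe : ∀ l : σ → k, f l = ∑ j, l j * f (Pi.single j 1) := by
      intro l
      conv_lhs => rw [LinearMap.pi_apply_eq_sum_univ f l]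
      refine Finset.sum_congr rfl fun j _ => ?_
      rw [smul_eq_mul]
      congr 2
      ext i; simp [Pi.single_apply, eq_comm]
    obtain ⟨c, hc⟩ := hun (fun j => f (Pi.single j 1))
      (fun g hg e hge => by
        have := hf (hWI g hg e hge)
        rwa [LinearMap.mem_ker, hfe] at this)
      (fun i l => by
        have := hf (hWF i l)
        rw [LinearMap.mem_ker, hfe] at this
        rw [Finset.mul_sum, Finset.mul_sum, ← sub_eq_zero, ← Finset.sum_sub_distrib, ← this]
        exact Finset.sum_congr rfl fun j _ => by ring)
    have h1 : f (Pi.single j₀ 1) = 0 := hf hWh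
    have h2 : c = 0 := by
      have := congrFun hc j₀
      simp only [h1, Pi.smul_apply, smul_eq_mul] at this
      exact (mul_eq_zero.mp this.symm).resolve_right hj₀
    apply hf0
    ext j
    have := congrFun hc j
    simp only [h2, zero_smul, Pi.zero_apply] at this
    simpa using this
  have hbQ : ∀ j, b j - a j ∈ Q := by
    intro j
    have : (Pi.single j 1 : σ → k) ∈ W := by rw [hWtop]; trivial
    change _ ∈ Q at this
    rw [Finset.sum_eq_single j] at this
    · simpa using this
    · intro i _ hi; simp [hi]
    · simp
  have hBQ : B ≤ E ⊔ m • B := by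
    refine Ideal.span_le.mpr ?_
    rintro _ ⟨⟨i, j⟩, rfl⟩
    change minor k i j ∈ Q
    have h1 : hx * minor k i j ∈ Q := by
      have : hx * minor k i j = X (Sum.inl i) * (b j - a j) - X (Sum.inl j) * (b i - a i) := by
        simp only [a, b, minor]; ring
      rw [this]
      exact sub_mem (Ideal.mul_mem_left _ _ (hbQ j)) (Ideal.mul_mem_left _ _ (hbQ i))
    have h2 : minor k i j = hx * minor k i j - (hx - algebraMap k R (eval v h)) * minor k i j := by
      rw [hhv, map_one]; ring
    rw [h2]
    exact sub_mem h1 (Ideal.mem_sup_right (Ideal.mul_mem_mul (hmx h) (hminor i j)))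
  obtain ⟨c, hc, hcB⟩ := Submodule.exists_sub_one_mem_and_smul_le_of_fg_of_le_sup
    (⟨(Set.finite_range fun p : σ × σ => minor k p.1 p.2).toFinset, by simp [B, Ideal.span]⟩ : B.FG)
    le_rfl hBQ
  refine ⟨c, ?_, fun i j => ?_⟩
  · have : eval (Sum.elim v v) (c - 1) = 0 := hc
    rw [map_sub, map_one, sub_eq_zero] at this
    rw [this]; exact one_ne_zero
  · exact hcB (Submodule.smul_mem_pointwise_smul _ _ _ (hminor i j))

end Diagonal

section Cone

variable {k : Type} [Field k] {N : ℕ}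

/-- The affine cone over a set of points of projective space. -/
def cone (X : Set (Pr k N)) : Set (Fin (N + 1) → k) :=
  {v | ∀ hv : v ≠ 0, Projectivization.mk k v hv ∈ X}

lemma rep_mem_cone {X : Set (Pr k N)} {p : Pr k N} (hp : p ∈ X) : p.rep ∈ cone X := by
  intro h
  rwa [Projectivization.mk_rep]

lemma zero_mem_cone (X : Set (Pr k N)) : (0 : Fin (N + 1) → k) ∈ cone X := fun h => absurd rfl h

lemma smul_mem_cone {X : Set (Pr k N)} {v : Fin (N + 1) → k} (hv : v ∈ cone X) (t : k) :
    t • v ∈ cone X := by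
  intro h
  have h1 : v ≠ 0 := fun h0 => h (by rw [h0, smul_zero])
  have h2 : Projectivization.mk k (t • v) h = Projectivization.mk k v h1 :=
    (Projectivization.mk_eq_mk_iff' ..).2 ⟨t, rfl⟩
  rw [h2]
  exact hv h1

lemma cone_mono {X Y : Set (Pr k N)} (h : X ⊆ Y) : cone X ⊆ cone Y := fun _ hv h0 => h (hv h0)

/-- The homogeneous ideal of a set of points of projective space. -/
noncomputable def coneIdeal (X : Set (Pr k N)) : Ideal (MvPolynomial (Fin (N + 1)) k) :=
  MvPolynomial.vanishingIdeal k (cone X)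

lemma mem_coneIdeal {X : Set (Pr k N)} {f : MvPolynomial (Fin (N + 1)) k} :
    f ∈ coneIdeal X ↔ ∀ v ∈ cone X, eval v f = 0 := by
  rw [coneIdeal, mem_vanishingIdeal_iff]
  simp only [aeval_eq_eval]

lemma eval_smul_of_isHomogeneous {σ : Type*} {f : MvPolynomial σ k} {d : ℕ}
    (hf : f.IsHomogeneous d) (t : k) (v : σ → k) : eval (t • v) f = t ^ d * eval v f := by
  have := aeval_mul_of_isHomogeneous t v hf
  simpa [aeval_eq_eval, Pi.smul_def] using this

lemma vanishes_mk_iff {f : MvPolynomial (Fin (N + 1)) k} {d : ℕ} (hf : f.IsHomogeneous d)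
    {v : Fin (N + 1) → k} (hv : v ≠ 0) :
    Vanishes f (Projectivization.mk k v hv) ↔ eval v f = 0 := by
  refine ⟨fun h => h v hv rfl, fun h w hw hwv => ?_⟩
  obtain ⟨t, rfl⟩ := (Projectivization.mk_eq_mk_iff' ..).1 hwv
  rw [eval_smul_of_isHomogeneous hf, h, mul_zero]

lemma homogeneousComponent_eval_eq_zero [Infinite k] {σ : Type*} {f : MvPolynomial σ k}
    {v : σ → k} (h : ∀ t : k, eval (t • v) f = 0) (d : ℕ) :
    eval v (homogeneousComponent d f) = 0 := by
  set P : Polynomial k := ∑ i ∈ Finset.range (f.totalDegree + 1),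
    Polynomial.C (eval v (homogeneousComponent i f)) * Polynomial.X ^ i with hP
  have hP0 : P = 0 := by
    refine Polynomial.funext fun t => ?_
    rw [Polynomial.eval_zero, ← h t, hP, Polynomial.eval_finsetSum]
    conv_rhs => rw [← sum_homogeneousComponent f, map_sum]
    refine Finset.sum_congr rfl fun i _ => ?_
    rw [eval_smul_of_isHomogeneous (homogeneousComponent_isHomogeneous i f)]
    rw [Polynomial.eval_mul, Polynomial.eval_C, Polynomial.eval_pow, Polynomial.eval_X, mul_comm]
  by_cases hd : d ≤ f.totalDegree
  · have : P.coeff d = 0 := by rw [hP0, Polynomial.coeff_zero]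
    rw [hP, Polynomial.finsetSum_coeff] at this
    simp only [Polynomial.coeff_C_mul_X_pow] at this
    rw [Finset.sum_eq_single d (fun i _ hi => if_neg (Ne.symm hi))
      (fun h => absurd (Finset.mem_range.2 (by omega)) h), if_pos rfl] at this
    exact this
  · rw [homogeneousComponent_eq_zero _ _ (by omega), map_zero]

lemma homogeneousComponent_mem_coneIdeal [Infinite k] {X : Set (Pr k N)}
    {f : MvPolynomial (Fin (N + 1)) k} (hf : f ∈ coneIdeal X) (d : ℕ) :
    homogeneousComponent d f ∈ coneIdeal X :=
  mem_coneIdeal.2 fun _ hv => homogeneousComponent_eval_eq_zero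
    (fun t => mem_coneIdeal.1 hf _ (smul_mem_cone hv t)) d

lemma mem_coneIdeal_iff_of_isHomogeneous {X : Set (Pr k N)} (hX : X.Nonempty)
    {f : MvPolynomial (Fin (N + 1)) k} {d : ℕ} (hf : f.IsHomogeneous d) :
    f ∈ coneIdeal X ↔ ∀ q ∈ X, Vanishes f q := by
  rw [mem_coneIdeal]
  constructor
  · intro h q hq v _ hvq
    exact h v fun _ => hvq ▸ hq
  · intro h v hv
    by_cases h0 : v = 0
    · subst h0
      obtain ⟨q, hq⟩ := hX
      have h1 := h q hq q.rep q.rep_nonzero (Projectivization.mk_rep q)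
      have h2 := eval_smul_of_isHomogeneous hf (0 : k) q.rep
      rw [zero_smul, h1, mul_zero] at h2
      exact h2
    · exact h _ (hv h0) v h0 rfl

lemma mem_cone_iff {X : Set (Pr k N)} (hX : IsAlgSet X) (hne : X.Nonempty)
    {v : Fin (N + 1) → k} : v ∈ cone X ↔ ∀ f ∈ coneIdeal X, eval v f = 0 := by
  refine ⟨fun hv f hf => mem_coneIdeal.1 hf v hv, fun h hv => ?_⟩
  obtain ⟨S, hS, rfl⟩ := hX
  intro f hf
  obtain ⟨d, hd⟩ := hS f hf
  rw [vanishes_mk_iff hd]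
  exact h f ((mem_coneIdeal_iff_of_isHomogeneous hne hd).2 fun q hq => hq f hf)

lemma cone_subset_cone_iff {X Y : Set (Pr k N)} : cone X ⊆ cone Y ↔ X ⊆ Y := by
  refine ⟨fun h q hq => ?_, cone_mono⟩
  have := h (rep_mem_cone hq) q.rep_nonzero
  rwa [Projectivization.mk_rep] at this

lemma isPrime_coneIdeal [Infinite k] {X : Set (Pr k N)} (hX : IsVariety X) :
    (coneIdeal X).IsPrime := by
  obtain ⟨-, hne, hirr⟩ := hX
  let _ : GradedRing (homogeneousSubmodule (Fin (N + 1)) k) := MvPolynomial.gradedAlgebra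
  have hh : (coneIdeal X).IsHomogeneous (homogeneousSubmodule (Fin (N + 1)) k) := by
    intro d f hf
    have := homogeneousComponent_mem_coneIdeal hf d
    rwa [← decomposition.decompose'_apply] at this
  refine Ideal.IsHomogeneous.isPrime_of_homogeneous_mem_or_mem hh ?_ ?_
  · intro h
    have h1 : (1 : MvPolynomial (Fin (N + 1)) k) ∈ coneIdeal X := by rw [h]; trivial
    have := mem_coneIdeal.1 h1 0 (zero_mem_cone X)
    simp at this
  · rintro f g ⟨d, hd⟩ ⟨e, he⟩ hfg
    rw [mem_homogeneousSubmodule] at hd he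
    rw [mem_coneIdeal_iff_of_isHomogeneous hne hd, mem_coneIdeal_iff_of_isHomogeneous hne he]
    refine hirr {p | Vanishes f p} {p | Vanishes g p} ⟨{f}, ?_, ?_⟩ ⟨{g}, ?_, ?_⟩ ?_
    · rintro _ rfl; exact ⟨d, hd⟩
    · simp
    · rintro _ rfl; exact ⟨e, he⟩
    · simp
    · intro q hq
      have h1 := mem_coneIdeal.1 hfg _ (rep_mem_cone hq)
      rw [map_mul, mul_eq_zero] at h1
      rw [← Projectivization.mk_rep q]
      exact h1.imp (vanishes_mk_iff hd q.rep_nonzero).2 (vanishes_mk_iff he q.rep_nonzero).2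

lemma diffAt_apply (f : MvPolynomial (Fin (N + 1)) k) (v w : Fin (N + 1) → k) :
    diffAt f v w = ∑ j, eval v (pderiv j f) * w j := by
  simp [diffAt, LinearMap.sum_apply]

lemma mem_embTangent_iff {X : Set (Pr k N)} (hX : X.Nonempty) {p : Pr k N}
    {w : Fin (N + 1) → k} : w ∈ embTangent X p ↔ ∀ g ∈ coneIdeal X, ∀ e, g.IsHomogeneous e →
      ∑ j, eval p.rep (pderiv j g) * w j = 0 := by
  simp only [embTangent, Submodule.mem_iInf, LinearMap.mem_ker, diffAt_apply, Set.mem_ofPred_eq,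
    and_imp, forall_exists_index]
  exact ⟨fun h g hg e he => h g e he ((mem_coneIdeal_iff_of_isHomogeneous hX he).1 hg),
    fun h g e he hg => h g ((mem_coneIdeal_iff_of_isHomogeneous hX he).2 hg) e he⟩

end Cone

section Heights

variable {k : Type*} [Field k]

/-- The product of two subsets of affine spaces. -/
def prodSet {k σ τ : Type*} (V : Set (σ → k)) (W : Set (τ → k)) : Set (σ ⊕ τ → k) :=
  {u | u ∘ Sum.inl ∈ V ∧ u ∘ Sum.inr ∈ W}

lemma elim_mem_prodSet {k : Type*} {σ τ : Type*} {V : Set (σ → k)} {W : Set (τ → k)}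
    {x : σ → k} {y : τ → k}
    (hx : x ∈ V) (hy : y ∈ W) : Sum.elim x y ∈ prodSet V W := ⟨by simpa, by simpa⟩

lemma mem_vanishingIdeal_eval {σ : Type*} {V : Set (σ → k)} {f : MvPolynomial σ k} :
    f ∈ MvPolynomial.vanishingIdeal k V ↔ ∀ v ∈ V, eval v f = 0 := by
  rw [mem_vanishingIdeal_iff]
  simp only [aeval_eq_eval]

lemma eval_elim_eq_left {σ τ : Type*} (f : MvPolynomial (σ ⊕ τ) k) (x : σ → k) (y : τ → k) :
    eval (Sum.elim x y) f = eval x (aeval (Sum.elim X (fun j => C (y j))) f) := by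
  rw [← aeval_eq_eval, ← aeval_eq_eval, ← AlgHom.comp_apply]
  congr 1
  ext i
  cases i <;> simp

lemma eval_elim_eq_right {σ τ : Type*} (f : MvPolynomial (σ ⊕ τ) k) (x : σ → k) (y : τ → k) :
    eval (Sum.elim x y) f = eval y (aeval (Sum.elim (fun j => C (x j)) X) f) := by
  rw [← aeval_eq_eval, ← aeval_eq_eval, ← AlgHom.comp_apply]
  congr 1
  ext i
  cases i <;> simp

lemma isPrime_vanishingIdeal_prodSet {σ τ : Type*} {V : Set (σ → k)} {W : Set (τ → k)}
    (hV : (MvPolynomial.vanishingIdeal k V).IsPrime)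
    (hW : (MvPolynomial.vanishingIdeal k W).IsPrime) :
    (MvPolynomial.vanishingIdeal k (prodSet V W)).IsPrime := by
  have hne : ∀ {ρ : Type _} {U : Set (ρ → k)}, (MvPolynomial.vanishingIdeal k U).IsPrime →
      ∃ x, x ∈ U := by
    intro ρ U hU
    by_contra! h
    exact hU.ne_top ((Ideal.eq_top_iff_one _).2
      (mem_vanishingIdeal_eval.2 fun v hv => absurd hv (h v)))
  refine ⟨fun h => ?_, fun {f g} hfg => ?_⟩
  · have h1 : (1 : MvPolynomial (σ ⊕ τ) k) ∈ MvPolynomial.vanishingIdeal k (prodSet V W) := by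
      rw [h]; trivial
    obtain ⟨⟨x, hx⟩, y, hy⟩ := hne hV, (by
      by_contra! h
      exact hW.ne_top ((Ideal.eq_top_iff_one _).2
        (mem_vanishingIdeal_eval.2 fun v hv => absurd hv (h v))) : ∃ y, y ∈ W)
    have := mem_vanishingIdeal_eval.1 h1 _ (elim_mem_prodSet hx hy)
    simp at this
  · by_contra! hcon
    simp only [mem_vanishingIdeal_eval] at hcon hfg
    push Not at hcon
    obtain ⟨⟨u, ⟨hu1, hu2⟩, hfu⟩, ⟨u', ⟨hu1', hu2'⟩, hgu⟩⟩ := hcon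
    rw [← Sum.elim_comp_inl_inr u, eval_elim_eq_left] at hfu
    rw [← Sum.elim_comp_inl_inr u', eval_elim_eq_left] at hgu
    have h1 := mt hV.mem_or_mem (not_or.2 ⟨fun h => hfu (mem_vanishingIdeal_eval.1 h _ hu1),
      fun h => hgu (mem_vanishingIdeal_eval.1 h _ hu1')⟩)
    rw [mem_vanishingIdeal_eval] at h1
    push Not at h1
    obtain ⟨x, hx, hfg'⟩ := h1
    rw [map_mul, ← eval_elim_eq_left, ← eval_elim_eq_left, eval_elim_eq_right,
      eval_elim_eq_right] at hfg'
    have h2 := mt hW.mem_or_mem (not_or.2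
      ⟨fun h => left_ne_zero_of_mul hfg' (mem_vanishingIdeal_eval.1 h _ hu2),
      fun h => right_ne_zero_of_mul hfg' (mem_vanishingIdeal_eval.1 h _ hu2')⟩)
    rw [mem_vanishingIdeal_eval] at h2
    push Not at h2
    obtain ⟨y, hy, hfg''⟩ := h2
    rw [map_mul, ← eval_elim_eq_right, ← eval_elim_eq_right, ← map_mul] at hfg''
    exact hfg'' (hfg _ (elim_mem_prodSet hx hy))

lemma le_ringKrullDim_quotient_of_antitone {R : Type*} [CommRing R] {I : Ideal R} {m : ℕ}
    (P : ℕ → Ideal R) (hP : ∀ i ≤ m, (P i).IsPrime) (hlt : ∀ i < m, P (i + 1) < P i)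
    (hI : ∀ i ≤ m, I ≤ P i) : (m : WithBot ℕ∞) ≤ ringKrullDim (R ⧸ I) := by
  let e := (Ideal.primeSpectrumQuotientOrderIsoZeroLocus I).symm
  let s : LTSeries (PrimeSpectrum (R ⧸ I)) := LTSeries.mk m
    (fun i => e ⟨⟨P (m - i), hP _ (Nat.sub_le _ _)⟩, hI _ (Nat.sub_le _ _)⟩) (by
      rw [Fin.strictMono_iff_lt_succ]
      intro i
      refine e.strictMono ?_
      change P (m - (i.castSucc : ℕ)) < P (m - (i.succ : ℕ))
      have h := hlt (m - (i + 1)) (by omega)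
      rw [show m - (i + 1 : ℕ) + 1 = m - i by omega] at h
      simpa using h)
  exact Order.LTSeries.length_le_krullDim s

/-- The dimension of a product is at least the sum of the dimensions. -/
lemma le_ringKrullDim_prod {σ : Type*} {C : Set (σ → k)} {L : ℕ} (V : ℕ → Set (σ → k))
    (hP : ∀ i ≤ L, (MvPolynomial.vanishingIdeal k (V i)).IsPrime)
    (hlt : ∀ i < L, V i ⊆ V (i + 1))
    (hne : ∀ i < L, ∃ f v, (∀ x ∈ V i, eval x f = 0) ∧ v ∈ V (i + 1) ∧ eval v f ≠ 0)
    (hC : ∀ i ≤ L, V i ⊆ C) :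
    ((2 * L : ℕ) : WithBot ℕ∞) ≤ ringKrullDim (MvPolynomial (σ ⊕ σ) k ⧸
      MvPolynomial.vanishingIdeal k (prodSet C C)) := by
  refine le_ringKrullDim_quotient_of_antitone
    (fun i => MvPolynomial.vanishingIdeal k (prodSet (V (min i L)) (V (i - L)))) ?_ ?_ ?_
  · exact fun i hi => isPrime_vanishingIdeal_prodSet (hP _ (min_le_right _ _)) (hP _ (by omega))
  · intro i hi
    have hn : ∀ i ≤ L, ∃ x, x ∈ V i := by
      intro i hi
      by_contra! h
      exact (hP i hi).ne_top ((Ideal.eq_top_iff_one _).2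
        (mem_vanishingIdeal_eval.2 fun v hv => absurd hv (h v)))
    rcases lt_or_ge i L with h | h
    · rw [min_eq_left (by omega), min_eq_left (by omega), Nat.sub_eq_zero_of_le h.le,
        Nat.sub_eq_zero_of_le (by omega)]
      refine lt_of_le_not_ge (vanishingIdeal_anti_mono fun u hu => ⟨hlt i h hu.1, hu.2⟩) ?_
      obtain ⟨f, v, hf, hv, hfv⟩ := hne i h
      obtain ⟨y, hy⟩ := hn 0 (Nat.zero_le _)
      intro hle
      have h1 : rename Sum.inl f ∈ MvPolynomial.vanishingIdeal k (prodSet (V i) (V 0)) := by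
        rw [mem_vanishingIdeal_eval]
        intro u hu
        rw [eval_rename]
        exact hf _ hu.1
      have h2 := mem_vanishingIdeal_eval.1 (hle h1) _ (elim_mem_prodSet hv hy)
      rw [eval_rename, Sum.elim_comp_inl] at h2
      exact hfv h2
    · rw [min_eq_right (by omega), min_eq_right (by omega), show i + 1 - L = i - L + 1 by omega]
      have h' : i - L < L := by omega
      refine lt_of_le_not_ge (vanishingIdeal_anti_mono fun u hu => ⟨hu.1, hlt _ h' hu.2⟩) ?_
      obtain ⟨f, v, hf, hv, hfv⟩ := hne _ h'
      obtain ⟨y, hy⟩ := hn L le_rfl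
      intro hle
      have h1 : rename Sum.inr f ∈ MvPolynomial.vanishingIdeal k (prodSet (V L) (V (i - L))) := by
        rw [mem_vanishingIdeal_eval]
        intro u hu
        rw [eval_rename]
        exact hf _ hu.2
      have h2 := mem_vanishingIdeal_eval.1 (hle h1) _ (elim_mem_prodSet hy hv)
      rw [eval_rename, Sum.elim_comp_inr] at h2
      exact hfv h2
  · intro i hi
    exact vanishingIdeal_anti_mono fun u hu => ⟨hC _ (min_le_right _ _) hu.1, hC _ (by omega) hu.2⟩

lemma ringKrullDim_le_of_isIntegral {R S : Type*} [CommRing R] [CommRing S] [Algebra R S]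
    [Algebra.IsIntegral R S] : ringKrullDim S ≤ ringKrullDim R := by
  refine Order.krullDim_le_of_strictMono (PrimeSpectrum.comap (algebraMap R S)) ?_
  intro P Q h
  exact Ideal.IsIntegral.comap_lt_comap h

lemma height_ker_algHom_mvPolynomial [IsAlgClosed k] {s : ℕ} (φ : MvPolynomial (Fin s) k →ₐ[k] k) :
    (s : ℕ∞) ≤ (RingHom.ker φ).height := by
  have hmax : ∀ ψ : MvPolynomial (Fin s) k →ₐ[k] k,
      (RingHom.ker φ).height = (RingHom.ker ψ).height := by
    intro ψ
    let e : MvPolynomial (Fin s) k ≃ₐ[k] MvPolynomial (Fin s) k := AlgEquiv.ofAlgHom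
      (aeval fun i => X i + C (φ (X i) - ψ (X i))) (aeval fun i => X i - C (φ (X i) - ψ (X i)))
      (by ext i; simp [algHom_C]) (by ext i; simp [algHom_C])
    have h1 : φ = ψ.comp (e : MvPolynomial (Fin s) k →ₐ[k] MvPolynomial (Fin s) k) := by
      ext i
      simp [e, algHom_C]
    rw [← RingEquiv.height_comap e.toRingEquiv (RingHom.ker ψ)]
    congr 1
    ext f
    simp only [h1, RingHom.mem_ker, Ideal.mem_comap]
    rfl
  by_contra! hlt
  have h1 : ringKrullDim (MvPolynomial (Fin s) k) ≤ ((RingHom.ker φ).height : WithBot ℕ∞) := by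
    rw [ringKrullDim_le_iff_isMaximal_height_le]
    intro m hm
    obtain ⟨x, rfl⟩ := isMaximal_iff_eq_vanishingIdeal_singleton.1 hm
    rw [hmax (aeval x), show RingHom.ker (aeval x : MvPolynomial (Fin s) k →ₐ[k] k) =
      MvPolynomial.vanishingIdeal k {x} by ext f; simp [RingHom.mem_ker, aeval_eq_eval]]
  rw [MvPolynomial.ringKrullDim_of_isNoetherianRing, ringKrullDim_eq_zero_of_field] at h1
  simp only [zero_add, Nat.card_eq_fintype_card, Fintype.card_fin] at h1
  exact absurd hlt (not_lt.2 (by exact_mod_cast h1))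

lemma le_height_ker_of_le_ringKrullDim [IsAlgClosed k] {D : Type*} [CommRing D] [IsDomain D]
    [Algebra k D] [Algebra.FiniteType k D] {m : ℕ} (hm : (m : WithBot ℕ∞) ≤ ringKrullDim D)
    (φ : D →ₐ[k] k) : (m : ℕ∞) ≤ (RingHom.ker φ).height := by
  obtain ⟨s, g, hg, hint⟩ := exists_integral_inj_algHom_of_fg k D
  algebraize [g.toRingHom]
  have : Algebra.IsIntegral (MvPolynomial (Fin s) k) D := ⟨hint⟩
  have : FaithfulSMul (MvPolynomial (Fin s) k) D := (faithfulSMul_iff_algebraMap_injective _ _).2 hg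
  have hs : m ≤ s := by
    have h1 := hm.trans (ringKrullDim_le_of_isIntegral (R := MvPolynomial (Fin s) k))
    rw [MvPolynomial.ringKrullDim_of_isNoetherianRing, ringKrullDim_eq_zero_of_field] at h1
    simp only [zero_add, Nat.card_eq_fintype_card, Fintype.card_fin] at h1
    exact_mod_cast h1
  have : IsNoetherianRing D := Algebra.FiniteType.isNoetherianRing k D
  have : (RingHom.ker (φ.comp g)).IsPrime := RingHom.ker_isPrime _
  have : (RingHom.ker φ).IsPrime := RingHom.ker_isPrime _
  have : (RingHom.ker φ).LiesOver (RingHom.ker (φ.comp g)) := ⟨rfl⟩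
  rw [Ideal.height_eq_height_add_of_liesOver_of_hasGoingDown (RingHom.ker (φ.comp g))]
  exact le_add_right ((Nat.cast_le.2 hs).trans (height_ker_algHom_mvPolynomial _))

lemma le_height_of_comap_C_eq_ker [IsAlgClosed k] {D G : Type*} [Finite G] [CommRing D] [IsDomain D]
    [Algebra k D] [Algebra.FiniteType k D] {m : ℕ} (hm : (m : WithBot ℕ∞) ≤ ringKrullDim D)
    (φ : D →ₐ[k] k) (P : Ideal (MvPolynomial G D)) [P.IsPrime]
    (hP : RingHom.ker φ = P.comap (C : D →+* MvPolynomial G D)) : (m : ℕ∞) ≤ P.height := by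
  have : IsNoetherianRing D := Algebra.FiniteType.isNoetherianRing k D
  have : (RingHom.ker φ).IsPrime := RingHom.ker_isPrime _
  have : P.LiesOver (RingHom.ker φ) := ⟨hP⟩
  rw [Ideal.height_eq_height_add_of_liesOver_of_hasGoingDown (RingHom.ker φ)]
  exact le_add_right (le_height_ker_of_le_ringKrullDim hm φ)

end Heights

section Dimension

variable {k : Type} [Field k] {N : ℕ}

lemma le_ringKrullDim_prod_cone [IsAlgClosed k] {X : Set (Pr k N)} {n : ℕ} (hX : HasDim X n) :
    ((2 * (n + 1) : ℕ) : WithBot ℕ∞) ≤ ringKrullDim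
      (MvPolynomial (Fin (N + 1) ⊕ Fin (N + 1)) k ⧸
        MvPolynomial.vanishingIdeal k (prodSet (cone X) (cone X))) := by
  obtain ⟨l, hl⟩ := Order.le_krullDim_iff.1 (le_of_eq hX.symm : ((n : ℕ) : WithBot ℕ∞) ≤ _)
  let W : ℕ → Set (Pr k N) := fun i => (l ⟨min i n, by omega⟩).1
  have hW : ∀ i, IsVariety (W i) := fun i => (l ⟨min i n, by omega⟩).2.1
  have hWX : ∀ i, W i ⊆ X := fun i => (l ⟨min i n, by omega⟩).2.2
  have hlt : ∀ i < n, W i ⊂ W (i + 1) := by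
    intro i hi
    have : (⟨min i n, by omega⟩ : Fin (l.length + 1)) < ⟨min (i + 1) n, by omega⟩ := by
      rw [Fin.mk_lt_mk]; omega
    exact l.strictMono this
  refine le_ringKrullDim_prod (L := n + 1) (fun i => Nat.casesOn i {0} fun i => cone (W i))
    ?_ ?_ ?_ ?_
  · rintro (_ | i) -
    · exact (isMaximal_iff_eq_vanishingIdeal_singleton.2 ⟨0, rfl⟩ |>.isPrime)
    · exact isPrime_coneIdeal (hW i)
  · rintro (_ | i) hi
    · rintro _ rfl
      exact zero_mem_cone _
    · exact cone_mono (hlt i (by omega)).1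
  · rintro (_ | i) hi
    · obtain ⟨q, hq⟩ := (hW 0).2.1
      obtain ⟨j, hj⟩ := Function.ne_iff.1 q.rep_nonzero
      refine ⟨MvPolynomial.X j, q.rep, ?_, rep_mem_cone hq, by simpa using hj⟩
      rintro _ rfl
      simp
    · obtain ⟨v, hv, hv'⟩ := Set.not_subset.1
        (mt cone_subset_cone_iff.1 (hlt i (by omega)).2)
      rw [mem_cone_iff (hW i).1 (hW i).2.1] at hv'
      push Not at hv'
      obtain ⟨f, hf, hfv⟩ := hv'
      exact ⟨f, v, fun x hx => mem_coneIdeal.1 hf x hx, hv, hfv⟩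
  · rintro (_ | i) -
    · rintro _ rfl
      exact zero_mem_cone _
    · exact cone_mono (hWX i)

end Dimension

section Incidence

variable {D ι κ : Type*} [CommRing D] [Fintype κ]

/-- The equations of the universal incidence variety. -/
noncomputable def incidence (a b : ι → D) (s t : D) (u : κ → D) (i : ι) :
    MvPolynomial (Option (ι × κ)) D :=
  C t * (C (a i) + X none * ∑ j, X (some (i, j)) * C (u j)) - C s * C (b i)

/-- The universal incidence variety has a component dominating the base, which is the only one
meeting the locus where one can solve the incidence equations. -/
lemma exists_prime_incidence [IsDomain D] (a b : ι → D) (s t : D) (u : κ → D) (ht : t ≠ 0)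
    (hu : ∃ j, u j ≠ 0) : ∃ W : Ideal (MvPolynomial (Option (ι × κ)) D), W.IsPrime ∧
      (∀ i, incidence a b s t u i ∈ W) ∧ (∀ d, C d ∈ W → d = 0) ∧ X none ∉ W ∧
      ∀ Q : Ideal (MvPolynomial (Option (ι × κ)) D), Q.IsPrime →
        (∀ i, incidence a b s t u i ∈ Q) → X none ∉ Q → C t ∉ Q → (∃ j, C (u j) ∉ Q) → W ≤ Q := by
  classical
  set R := MvPolynomial (Option (ι × κ)) D with hR
  let w : κ → R := fun j => X none * C t * C (u j)
  let ν : κ → ι → R := fun j i => C s * C (b i) - C t * C (a i) -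
    C t * X none * ∑ l ∈ Finset.univ.erase j, X (some (i, l)) * C (u l)
  have hE : ∀ i j, incidence a b s t u i = w j * X (some (i, j)) - ν j i := by
    intro i j
    simp only [incidence, w, ν]
    rw [← Finset.add_sum_erase _ _ (Finset.mem_univ j)]
    ring
  let θ : ∀ j, R →+* Localization.Away (w j) := fun j =>
    eval₂Hom ((algebraMap R (Localization.Away (w j))).comp C) fun g =>
      g.casesOn (algebraMap R _ (X none)) fun p => if p.2 = j then
        IsLocalization.Away.invSelf (w j) * algebraMap R _ (ν j p.1) else
        algebraMap R _ (X (some p))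
  have hθC : ∀ j d, θ j (C d) = algebraMap R _ (C d) := fun j d => eval₂Hom_C _ _ d
  have hθτ : ∀ j, θ j (X none) = algebraMap R _ (X none) := fun j => eval₂Hom_X' _ _ _
  have hθe : ∀ j i, θ j (X (some (i, j))) =
      IsLocalization.Away.invSelf (w j) * algebraMap R _ (ν j i) := fun j i =>
    (eval₂Hom_X' _ _ _).trans (if_pos rfl)
  have hθn : ∀ j i l, l ≠ j → θ j (X (some (i, l))) = algebraMap R _ (X (some (i, l))) :=
    fun j i l h => (eval₂Hom_X' _ _ _).trans (if_neg h)
  have hθw : ∀ j l, θ j (w l) = algebraMap R _ (w l) := fun j l => by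
    simp only [w, map_mul, hθC, hθτ]
  have hθν : ∀ j i, θ j (ν j i) = algebraMap R _ (ν j i) := fun j i => by
    simp only [ν, map_mul, map_sub, map_sum, hθC, hθτ]
    congr 2
    exact Finset.sum_congr rfl fun l hl => by rw [hθn _ _ _ (Finset.ne_of_mem_erase hl)]
  have hθE : ∀ j i, θ j (incidence a b s t u i) = 0 := by
    intro j i
    rw [hE i j, map_sub, map_mul, hθw, hθν, hθe, ← mul_assoc, IsLocalization.Away.mul_invSelf,
      one_mul, sub_self]
  have key : ∀ j, ∀ Q : Ideal R, Q.IsPrime → (∀ i, incidence a b s t u i ∈ Q) → w j ∉ Q →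
      RingHom.ker (θ j) ≤ Q := by
    intro j Q hQ hEQ hwQ
    let π : R →+* FractionRing (R ⧸ Q) := (algebraMap (R ⧸ Q) _).comp (Ideal.Quotient.mk Q)
    have hπ : ∀ x, π x = 0 ↔ x ∈ Q := by
      intro x
      rw [RingHom.comp_apply, FaithfulSMul.algebraMap_eq_zero_iff,
        Ideal.Quotient.eq_zero_iff_mem]
    have hw0 : π (w j) ≠ 0 := fun h => hwQ ((hπ _).1 h)
    let L : Localization.Away (w j) →+* FractionRing (R ⧸ Q) :=
      IsLocalization.Away.lift (w j) (g := π) (IsUnit.mk0 _ hw0)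
    have hL : ∀ x, L (algebraMap R _ x) = π x := fun x => IsLocalization.Away.lift_eq _ _ x
    have hcomp : L.comp (θ j) = π := by
      refine MvPolynomial.ringHom_ext (fun d => ?_) ?_
      · rw [RingHom.comp_apply, hθC, hL]
      · rintro (_ | ⟨i, l⟩)
        · rw [RingHom.comp_apply, hθτ, hL]
        · by_cases hl : l = j
          · subst hl
            refine mul_left_cancel₀ hw0 ?_
            rw [RingHom.comp_apply L (θ l), hθe, ← hL (w l), ← map_mul L, ← mul_assoc,
              IsLocalization.Away.mul_invSelf, one_mul, hL, hL, ← map_mul π]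
            have := (hπ _).2 (hEQ i)
            rw [hE i l, map_sub, sub_eq_zero] at this
            exact this.symm
          · rw [RingHom.comp_apply, hθn _ _ _ hl, hL]
    intro x hx
    rw [RingHom.mem_ker] at hx
    rw [← hπ, ← hcomp, RingHom.comp_apply, hx, map_zero]
  have hC0 : ∀ {d : D}, d ≠ 0 → (C d : R) ≠ 0 := (map_ne_zero_iff C (C_injective _ _)).2
  have hinj : ∀ j, u j ≠ 0 → Function.Injective (algebraMap R (Localization.Away (w j))) := by
    intro j hj
    refine IsLocalization.injective _ (M := Submonoid.powers (w j)) ?_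
    refine powers_le_nonZeroDivisors_of_noZeroDivisors ?_
    refine mul_ne_zero (mul_ne_zero (X_ne_zero _) (hC0 ht)) (hC0 hj)
  have hdom : ∀ j, u j ≠ 0 → IsDomain (Localization.Away (w j)) := by
    intro j hj
    refine IsLocalization.isDomain_localization (powers_le_nonZeroDivisors_of_noZeroDivisors ?_)
    refine mul_ne_zero (mul_ne_zero (X_ne_zero _) (hC0 ht)) (hC0 hj)
  have hC : ∀ j, u j ≠ 0 → ∀ d, C d ∈ RingHom.ker (θ j) → d = 0 := by
    intro j hj d hd
    rw [RingHom.mem_ker, hθC] at hd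
    exact not_not.1 fun h => hC0 h ((map_eq_zero_iff _ (hinj j hj)).1 hd)
  have hτ : ∀ j, u j ≠ 0 → X none ∉ RingHom.ker (θ j) := by
    intro j hj hd
    rw [RingHom.mem_ker, hθτ] at hd
    exact X_ne_zero _ ((map_eq_zero_iff _ (hinj j hj)).1 hd)
  obtain ⟨j, hj⟩ := hu
  have := hdom j hj
  refine ⟨RingHom.ker (θ j), RingHom.ker_isPrime _, fun i => hθE j i, hC j hj, hτ j hj, ?_⟩
  rintro Q hQ hEQ hτQ htQ ⟨l, hl⟩
  have hul : u l ≠ 0 := by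
    rintro h
    exact hl (by rw [h, map_zero]; exact Q.zero_mem)
  have := hdom l hul
  have hp := RingHom.ker_isPrime (θ l)
  refine (key j _ hp (fun i => hθE l i) ?_).trans (key l Q hQ hEQ ?_)
  · refine hp.mul_notMem (hp.mul_notMem (hτ l hul) fun h => ht (hC l hul _ h))
      fun h => hj (hC l hul _ h)
  · exact hQ.mul_notMem (hQ.mul_notMem hτQ htQ) hl

end Incidence

section Specialization

variable {k : Type*} [Field k] {σ : Type*} [Fintype σ]

/-- `F` is immersive at `v`, on the cone defined by `I`. -/
def Immersive {ι : Type*} (I : Ideal (MvPolynomial σ k)) (F : ι → MvPolynomial σ k)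
    (v : σ → k) : Prop :=
  ∀ w : σ → k, (∀ g ∈ I, ∀ e, g.IsHomogeneous e → ∑ j, eval v (pderiv j g) * w j = 0) →
    (∀ i l, eval v (F i) * ∑ j, eval v (pderiv j (F l)) * w j =
      eval v (F l) * ∑ j, eval v (pderiv j (F i)) * w j) → ∃ c : k, w = c • v

lemma sub_mem_of_fibre {ι R : Type*} [CommRing R] [Algebra k R]
    {I : Ideal (MvPolynomial σ k)} {F : ι → MvPolynomial σ k} {d : ℕ}
    (hF : ∀ i, (F i).IsHomogeneous d) {v : σ → k} (hvI : ∀ g ∈ I, eval v g = 0)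
    (hun : Immersive I F v) {Q P : Ideal R} (hQ : Q.IsPrime) (hP : P ≠ ⊤) (hQP : Q ≤ P)
    {z : σ → R} (hzP : ∀ j, z j - algebraMap k R (v j) ∈ P) (hzI : ∀ g ∈ I, aeval z g ∈ Q)
    (hzF : ∀ i l, algebraMap k R (eval v (F i)) * aeval z (F l) -
      algebraMap k R (eval v (F l)) * aeval z (F i) ∈ Q)
    {a : σ → k} (hav : ∑ i, a i * v i = 1) (haz : ∑ i, algebraMap k R (a i) * z i - 1 ∈ Q)
    (j : σ) : z j - algebraMap k R (v j) ∈ Q := by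
  have hv : v ≠ 0 := by
    rintro rfl
    simp at hav
  obtain ⟨c, hc, hcm⟩ := exists_mul_minor_mem_fibreIdeal I F hF hv hun
  let Φ : MvPolynomial (σ ⊕ σ) k →ₐ[k] R := aeval (Sum.elim (fun i => algebraMap k R (v i)) z)
  have hΦl : ∀ g : MvPolynomial σ k, Φ (rename Sum.inl g) = algebraMap k R (eval v g) := by
    intro g
    rw [aeval_rename, Sum.elim_comp_inl, ← aeval_eq_eval]
    exact aeval_algebraMap_apply R v g
  have hΦr : ∀ g : MvPolynomial σ k, Φ (rename Sum.inr g) = aeval z g := by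
    intro g
    rw [aeval_rename, Sum.elim_comp_inr]
  have hΦ : fibreIdeal I F ≤ Q.comap Φ := by
    refine sup_le (sup_le ?_ ?_) ?_
    · rw [Ideal.map_le_iff_le_comap]
      intro g hg
      change Φ (rename Sum.inl g) ∈ Q
      rw [hΦl, hvI g hg, map_zero]
      exact Q.zero_mem
    · rw [Ideal.map_le_iff_le_comap]
      intro g hg
      change Φ (rename Sum.inr g) ∈ Q
      rw [hΦr]
      exact hzI g hg
    · rw [Ideal.span_le]
      rintro _ ⟨p, rfl⟩
      change Φ _ ∈ Q
      rw [map_sub, map_mul, map_mul, hΦl, hΦl, hΦr, hΦr]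
      exact hzF p.1 p.2
  have hcQ : Φ c ∉ Q := by
    intro h
    have h1 : Φ c - algebraMap k R (eval (Sum.elim v v) c) ∈ P := by
      refine aeval_sub_algebraMap_eval_mem ?_ c
      rintro (i | i)
      · simp
      · exact hzP i
    have h2 : algebraMap k R (eval (Sum.elim v v) c) ∈ P := by
      have := P.sub_mem (hQP h) h1
      rwa [sub_sub_cancel] at this
    exact hP (P.eq_top_of_isUnit_mem h2 ((IsUnit.mk0 _ hc).map _))
  have hm : ∀ i, algebraMap k R (v i) * z j - algebraMap k R (v j) * z i ∈ Q := by
    intro i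
    have h1 := hΦ (hcm i j)
    change Φ _ ∈ Q at h1
    rw [map_mul] at h1
    have := (hQ.mem_or_mem h1).resolve_left hcQ
    simpa [minor, Φ] using this
  have h1 : ∑ i, algebraMap k R (a i) *
      (algebraMap k R (v i) * z j - algebraMap k R (v j) * z i) ∈ Q :=
    sum_mem fun i _ => Q.mul_mem_left _ (hm i)
  have h2 : ∑ i, algebraMap k R (a i) *
      (algebraMap k R (v i) * z j - algebraMap k R (v j) * z i) =
      z j - algebraMap k R (v j) * ∑ i, algebraMap k R (a i) * z i := by
    have : z j = algebraMap k R (∑ i, a i * v i) * z j := by rw [hav, map_one, one_mul]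
    conv_rhs => rw [this]
    rw [map_sum, Finset.sum_mul, Finset.mul_sum, ← Finset.sum_sub_distrib]
    refine Finset.sum_congr rfl fun i _ => ?_
    rw [map_mul]
    ring
  rw [h2] at h1
  have h3 := Q.add_mem h1 (Q.mul_mem_left (algebraMap k R (v j)) haz)
  have h4 : z j - algebraMap k R (v j) * ∑ i, algebraMap k R (a i) * z i +
      algebraMap k R (v j) * (∑ i, algebraMap k R (a i) * z i - 1) =
      z j - algebraMap k R (v j) := by ring
  rwa [h4] at h3

variable {D : Type*} [CommRing D] [Algebra k D]

/-- The incidence equations attached to a rational map and a base point. -/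
noncomputable def mapIncidence {r : ℕ} (F : Fin (r + 1) → MvPolynomial σ k) (i₀ : Fin (r + 1))
    (v : σ → k) (ξ η : σ → D) (i : {i // i ≠ i₀}) :
    MvPolynomial (Option ({i // i ≠ i₀} × Fin (r + 1))) D :=
  incidence (fun i : {i // i ≠ i₀} => aeval ξ (F i)) (fun i => aeval η (F i)) (aeval ξ (F i₀))
    (aeval η (F i₀)) (fun l => algebraMap k D (eval v (F i₀)) * aeval ξ (F l) -
      algebraMap k D (eval v (F l)) * aeval ξ (F i₀)) i

lemma le_ker_of_mapIncidence [IsAlgClosed k] [IsDomain D] [Algebra.FiniteType k D]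
    {ξ η : σ → D} (hgen : Algebra.adjoin k (range ξ ∪ range η) = ⊤)
    {r m : ℕ} (hm : (m : WithBot ℕ∞) ≤ ringKrullDim D) (hrm : r + 2 < m)
    {I : Ideal (MvPolynomial σ k)} (hξI : ∀ g ∈ I, aeval ξ g = 0) (hηI : ∀ g ∈ I, aeval η g = 0)
    {F : Fin (r + 1) → MvPolynomial σ k} {d : ℕ} (hF : ∀ i, (F i).IsHomogeneous d)
    {v v' : σ → k} (hvI : ∀ g ∈ I, eval v g = 0) (hvI' : ∀ g ∈ I, eval v' g = 0)
    (hun : Immersive I F v) (hun' : Immersive I F v') {a : σ → k} (hav : ∑ i, a i * v i = 1)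
    (hav' : ∑ i, a i * v' i = 1) {i₀ : Fin (r + 1)} (hi₀ : eval v (F i₀) ≠ 0)
    (hi₀' : eval v' (F i₀) ≠ 0)
    (hvv' : ∀ i, eval v (F i₀) * eval v' (F i) = eval v (F i) * eval v' (F i₀))
    (φ : D →ₐ[k] k) (hφξ : ∀ j, φ (ξ j) = v j) (hφη : ∀ j, φ (η j) = v' j)
    {W : Ideal (MvPolynomial (Option ({i // i ≠ i₀} × Fin (r + 1))) D)}
    (hW : ∀ Q : Ideal (MvPolynomial (Option ({i // i ≠ i₀} × Fin (r + 1))) D), Q.IsPrime →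
        (∀ i, mapIncidence F i₀ v ξ η i ∈ Q) → X none ∉ Q → C (aeval η (F i₀)) ∉ Q →
        (∃ l, C (algebraMap k D (eval v (F i₀)) * aeval ξ (F l) -
          algebraMap k D (eval v (F l)) * aeval ξ (F i₀)) ∉ Q) → W ≤ Q) :
    W ≤ RingHom.ker (mapAlgHom (σ := Option ({i // i ≠ i₀} × Fin (r + 1))) φ) := by
  classical
  set G := Option ({i // i ≠ i₀} × Fin (r + 1)) with hG
  set p : MvPolynomial G D →ₐ[k] MvPolynomial G k := mapAlgHom φ with hp
  have hpC : ∀ x, p (C x) = C (φ x) := fun x => map_C _ x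
  have hpX : ∀ g, p (X g) = X g := fun g => map_X _ g
  have hφξF : ∀ g : MvPolynomial σ k, φ (aeval ξ g) = eval v g := fun g => by
    rw [← AlgHom.comp_apply, comp_aeval, ← aeval_eq_eval]
    simp only [hφξ]
  have hφηF : ∀ g : MvPolynomial σ k, φ (aeval η g) = eval v' g := fun g => by
    rw [← AlgHom.comp_apply, comp_aeval, ← aeval_eq_eval]
    simp only [hφη]
  have hPp : (RingHom.ker p).IsPrime := RingHom.ker_isPrime _
  have haC : ∀ (x : σ → D) (g : MvPolynomial σ k),
      aeval (fun j => (C (x j) : MvPolynomial G D)) g = C (aeval x g) :=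
    fun x g => aeval_algebraMap_apply (MvPolynomial G D) x g
  have hak : ∀ c : k, algebraMap k (MvPolynomial G D) c = C (algebraMap k D c) := fun c => rfl
  have hEp : ∀ i, mapIncidence F i₀ v ξ η i ∈ RingHom.ker p := by
    intro i
    rw [RingHom.mem_ker, mapIncidence, incidence]
    simp only [map_sub, map_mul, map_add, map_sum, hpC, hpX, hφξF, hφηF, AlgHom.commutes,
      Algebra.algebraMap_self, RingHom.id_apply]
    have h0 : ∀ l, eval v (F i₀) * eval v (F l) - eval v (F l) * eval v (F i₀) = 0 :=
      fun l => by ring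
    simp only [← C_mul, ← C_sub, h0, map_zero, mul_zero, Finset.sum_const_zero, add_zero]
    rw [C_eq_zero, hvv' i]
    ring
  let hx : (σ → D) → MvPolynomial G D := fun x => ∑ j, algebraMap k _ (a j) * C (x j) - 1
  have hxp : ∀ (x : σ → D) (w : σ → k), (∀ j, φ (x j) = w j) → ∑ j, a j * w j = 1 →
      hx x ∈ RingHom.ker p := by
    intro x w hxw hw
    rw [RingHom.mem_ker]
    have h1 : p (hx x) = C (∑ j, a j * w j) - 1 := by
      simp only [hx, map_sub, map_sum, map_mul, AlgHom.commutes, map_one, hpC, hxw, algebraMap_eq]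
    rw [h1, hw, map_one, sub_self]
  let T : Finset (MvPolynomial G D) :=
    insert (hx ξ) (insert (hx η) (Finset.univ.image (mapIncidence F i₀ v ξ η)))
  have hTcard : T.card ≤ r + 2 := by
    refine (Finset.card_insert_le _ _).trans (Nat.succ_le_succ ?_)
    refine (Finset.card_insert_le _ _).trans (Nat.succ_le_succ ?_)
    refine Finset.card_image_le.trans ?_
    simp [Fintype.card_subtype_compl]
  have hTp : Ideal.span (T : Set (MvPolynomial G D)) ≤ RingHom.ker p := by
    rw [Ideal.span_le]
    intro x hx
    simp only [T, Finset.coe_insert, Finset.coe_image, Finset.coe_univ, image_univ,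
      Set.mem_insert_iff, Set.mem_range] at hx
    rcases hx with rfl | rfl | ⟨i, rfl⟩
    · exact hxp ξ v hφξ hav
    · exact hxp η v' hφη hav'
    · exact hEp i
  obtain ⟨Q, hQmin, hQP⟩ := Ideal.exists_minimalPrimes_le hTp
  have hQ : Q.IsPrime := hQmin.1.1
  have hTQ : ∀ x ∈ T, x ∈ Q := fun x hx => hQmin.1.2 (Ideal.subset_span hx)
  have : IsNoetherianRing D := Algebra.FiniteType.isNoetherianRing k D
  have hQh : Q.height ≤ (r + 2 : ℕ) :=
    (Ideal.height_le_card_of_mem_minimalPrimes_span_finset hQmin).trans (Nat.cast_le.2 hTcard)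
  have hPh : (m : ℕ∞) ≤ (RingHom.ker p).height := by
    refine le_height_of_comap_C_eq_ker hm φ _ ?_
    ext x
    rw [Ideal.mem_comap, RingHom.mem_ker, RingHom.mem_ker, hpC, C_eq_zero]
  have hQP' : ¬ RingHom.ker p ≤ Q := by
    intro h
    have h1 := (hPh.trans (Ideal.height_mono h)).trans hQh
    exact absurd (Nat.cast_le.1 h1) (by omega)
  refine (hW Q hQ (fun i => hTQ _ ?_) ?_ ?_ ?_).trans hQP
  · exact Finset.mem_insert_of_mem (Finset.mem_insert_of_mem
      (Finset.mem_image_of_mem _ (Finset.mem_univ i)))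
  · intro h
    have := hQP h
    rw [RingHom.mem_ker, hpX] at this
    exact X_ne_zero _ this
  · intro h
    have := hQP h
    rw [RingHom.mem_ker, hpC, C_eq_zero, hφηF] at this
    exact hi₀' this
  · by_contra! hu
    have hu0 : IsUnit (algebraMap k (MvPolynomial G D) (eval v (F i₀))) :=
      (IsUnit.mk0 _ hi₀).map _
    have hξ1 : ∀ j, C (ξ j) - algebraMap k _ (v j) ∈ Q := by
      refine sub_mem_of_fibre hF hvI hun hQ hPp.ne_top hQP ?_ ?_ ?_ hav (hTQ (hx ξ) ?_)
      · intro j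
        rw [RingHom.mem_ker, map_sub, hpC, AlgHom.commutes, hφξ, algebraMap_eq, sub_self]
      · intro g hg
        rw [haC, hξI g hg, map_zero]
        exact Q.zero_mem
      · intro i l
        rw [← Ideal.unit_mul_mem_iff_mem _ hu0, haC, haC]
        convert Q.sub_mem (Q.mul_mem_left (algebraMap k _ (eval v (F i))) (hu l))
          (Q.mul_mem_left (algebraMap k _ (eval v (F l))) (hu i)) using 1
        simp only [hak, map_sub, map_mul]
        ring
      · exact Finset.mem_insert_self _ _
    have hη0 : ∀ i, C (aeval η (F i)) * algebraMap k _ (eval v (F i₀)) -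
        C (aeval η (F i₀)) * algebraMap k _ (eval v (F i)) ∈ Q := by
      intro i
      by_cases hi : i = i₀
      · subst hi
        rw [sub_self]
        exact Q.zero_mem
      have h1 : mapIncidence F i₀ v ξ η ⟨i, hi⟩ ∈ Q := hTQ _
        (Finset.mem_insert_of_mem (Finset.mem_insert_of_mem
          (Finset.mem_image_of_mem _ (Finset.mem_univ _))))
      have h2 : C (aeval ξ (F i₀)) * (C (aeval η (F i)) * algebraMap k _ (eval v (F i₀)) -
        C (aeval η (F i₀)) * algebraMap k _ (eval v (F i))) ∈ Q := by
        have h3 : ∑ l, X (some (⟨i, hi⟩, l)) * C (algebraMap k D (eval v (F i₀)) * aeval ξ (F l) -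
          algebraMap k D (eval v (F l)) * aeval ξ (F i₀)) ∈ Q :=
          sum_mem fun l _ => Q.mul_mem_left _ (hu l)
        have h4 := Q.sub_mem (Q.mul_mem_left (C (algebraMap k D (eval v (F i₀)))
          * C (aeval η (F i₀)) * X none) h3)
          (Q.mul_mem_left (C (algebraMap k D (eval v (F i₀)))) h1)
        have h5 := Q.add_mem h4 (Q.mul_mem_left (C (aeval η (F i₀))) (hu i))
        convert h5 using 1
        simp only [mapIncidence, incidence, hak, map_sub, map_mul]
        ring
      refine (hQ.mem_or_mem h2).resolve_left fun h => ?_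
      have := hQP h
      rw [RingHom.mem_ker, hpC, C_eq_zero, hφξF] at this
      exact hi₀ this
    have hη1 : ∀ j, C (η j) - algebraMap k _ (v' j) ∈ Q := by
      refine sub_mem_of_fibre hF hvI' hun' hQ hPp.ne_top hQP ?_ ?_ ?_ hav' (hTQ (hx η) ?_)
      · intro j
        rw [RingHom.mem_ker, map_sub, hpC, AlgHom.commutes, hφη, algebraMap_eq, sub_self]
      · intro g hg
        rw [haC, hηI g hg, map_zero]
        exact Q.zero_mem
      · intro i l
        rw [← Ideal.unit_mul_mem_iff_mem _ hu0, ← Ideal.unit_mul_mem_iff_mem _ hu0, haC, haC]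
        have h := fun i => congrArg (algebraMap k (MvPolynomial G D)) (hvv' i)
        simp only [map_mul] at h
        convert Q.sub_mem (Q.mul_mem_left (algebraMap k _ (eval v (F i) * eval v' (F i₀))) (hη0 l))
          (Q.mul_mem_left (algebraMap k _ (eval v (F l) * eval v' (F i₀))) (hη0 i)) using 1
        simp only [map_mul]
        linear_combination algebraMap k (MvPolynomial G D) (eval v (F i₀)) *
          (C (aeval η (F l)) * h i - C (aeval η (F i)) * h l)
      · exact Finset.mem_insert_of_mem (Finset.mem_insert_self _ _)
    refine hQP' fun f hf => ?_
    let ψ : MvPolynomial G k →ₐ[k] MvPolynomial G D := aeval X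
    have hcomp : ((Ideal.Quotient.mkₐ k Q).comp ψ).comp p = Ideal.Quotient.mkₐ k Q := by
      have h1 : (((Ideal.Quotient.mkₐ k Q).comp ψ).comp p).comp (IsScalarTower.toAlgHom k D _) =
          (Ideal.Quotient.mkₐ k Q).comp (IsScalarTower.toAlgHom k D _) := by
        refine AlgHom.ext_of_adjoin_eq_top hgen ?_
        rintro _ (⟨j, rfl⟩ | ⟨j, rfl⟩)
        · change Ideal.Quotient.mk Q (ψ (p (C (ξ j)))) = Ideal.Quotient.mk Q (C (ξ j))
          rw [hpC, hφξ, algHom_C, eq_comm, Ideal.Quotient.eq]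
          exact hξ1 j
        · change Ideal.Quotient.mk Q (ψ (p (C (η j)))) = Ideal.Quotient.mk Q (C (η j))
          rw [hpC, hφη, algHom_C, eq_comm, Ideal.Quotient.eq]
          exact hη1 j
      refine AlgHom.coe_ringHom_injective (MvPolynomial.ringHom_ext
        (fun x => DFunLike.congr_fun h1 x) fun g => ?_)
      change Ideal.Quotient.mk Q (ψ (p (X g))) = Ideal.Quotient.mk Q (X g)
      rw [hpX, aeval_X]
    rw [RingHom.mem_ker] at hf
    have h1 : Ideal.Quotient.mk Q (ψ (p f)) = Ideal.Quotient.mk Q f := DFunLike.congr_fun hcomp f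
    rw [hf, map_zero, map_zero, eq_comm, Ideal.Quotient.eq_zero_iff_mem] at h1
    exact h1

end Specialization

section Bigraded

/-- The weights defining the bigrading in two groups of variables. -/
def biweight (σ : Type*) : σ ⊕ σ → ℕ × ℕ := Sum.elim (fun _ => (1, 0)) (fun _ => (0, 1))

variable {k : Type*} [Field k] {σ : Type*} [Fintype σ]

lemma weight_biweight (m : σ ⊕ σ →₀ ℕ) :
    Finsupp.weight (biweight σ) m = (∑ i, m (Sum.inl i), ∑ i, m (Sum.inr i)) := by
  rw [Finsupp.weight_apply, Finsupp.sum_fintype _ _ (by simp), Fintype.sum_sum_type]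
  ext <;> simp [biweight, Prod.fst_sum, Prod.snd_sum]

lemma sum_eq_of_isHomogeneous {P : MvPolynomial σ k} {d : ℕ} (hP : P.IsHomogeneous d)
    {m : σ →₀ ℕ} (hm : m ∈ P.support) : ∑ i, m i = d := by
  rw [← hP (mem_support_iff.1 hm), Finsupp.weight_apply, Finsupp.sum_fintype _ _ (by simp)]
  simp

lemma rename_inl_isWeightedHomogeneous {P : MvPolynomial σ k} {d : ℕ} (hP : P.IsHomogeneous d) :
    (rename Sum.inl P).IsWeightedHomogeneous (biweight σ) (d, 0) := by
  rw [← mem_weightedHomogeneousSubmodule, ← P.support_sum_monomial_coeff, map_sum]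
  refine sum_mem fun m hm => ?_
  rw [rename_monomial, mem_weightedHomogeneousSubmodule]
  refine isWeightedHomogeneous_monomial _ _ _ ?_
  rw [weight_biweight]
  simp only [Finsupp.mapDomain_apply Sum.inl_injective]
  rw [sum_eq_of_isHomogeneous hP hm, Finset.sum_eq_zero]
  exact fun i _ => Finsupp.mapDomain_of_notMem_range _ _ (by simp)

lemma rename_inr_isWeightedHomogeneous {P : MvPolynomial σ k} {d : ℕ} (hP : P.IsHomogeneous d) :
    (rename Sum.inr P).IsWeightedHomogeneous (biweight σ) (0, d) := by
  rw [← mem_weightedHomogeneousSubmodule, ← P.support_sum_monomial_coeff, map_sum]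
  refine sum_mem fun m hm => ?_
  rw [rename_monomial, mem_weightedHomogeneousSubmodule]
  refine isWeightedHomogeneous_monomial _ _ _ ?_
  rw [weight_biweight]
  simp only [Finsupp.mapDomain_apply Sum.inr_injective]
  rw [sum_eq_of_isHomogeneous hP hm, Finset.sum_eq_zero]
  exact fun i _ => Finsupp.mapDomain_of_notMem_range _ _ (by simp)

lemma minor_isWeightedHomogeneous {τ : Type*} (i j : τ) :
    (minor k i j).IsWeightedHomogeneous (biweight τ) (1, 1) := by
  have h : ∀ i j : τ, (X (Sum.inl i) * X (Sum.inr j) : MvPolynomial (τ ⊕ τ) k).IsWeightedHomogeneous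
      (biweight τ) (1, 1) := fun i j =>
    (isWeightedHomogeneous_X k (biweight τ) (Sum.inl i)).mul
      (isWeightedHomogeneous_X k (biweight τ) (Sum.inr j))
  exact Submodule.sub_mem (weightedHomogeneousSubmodule k (biweight τ) (1, 1)) (h i j) (h j i)

lemma eval_elim_smul {P : MvPolynomial (σ ⊕ σ) k} {d e : ℕ}
    (hP : P.IsWeightedHomogeneous (biweight σ) (d, e)) (x y : σ → k) (t : k) :
    eval (Sum.elim x (t • y)) P = t ^ e * eval (Sum.elim x y) P := by
  rw [eval_eq', eval_eq', Finset.mul_sum]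
  refine Finset.sum_congr rfl fun m hm => ?_
  have h := hP (mem_support_iff.1 hm)
  rw [weight_biweight, Prod.mk.injEq] at h
  simp only [Fintype.prod_sum_type, Sum.elim_inl, Sum.elim_inr, Pi.smul_apply, smul_eq_mul, mul_pow,
    Finset.prod_mul_distrib, Finset.prod_pow_eq_pow_sum, h.2]
  ring

variable {R S : Type*} [CommRing R] [CommRing S] [Algebra R S] [Algebra k R] [Algebra k S]
  [IsScalarTower k R S]

lemma prod_pow_mem_span_pow {τ : Type*} (ξ : τ → S) (s : Finset τ) (m : τ → ℕ) :
    ∏ i ∈ s, ξ i ^ m i ∈ Submodule.span R (range ξ) ^ ∑ i ∈ s, m i := by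
  classical
  induction s using Finset.induction_on with
  | empty =>
    rw [Finset.prod_empty, Finset.sum_empty, pow_zero]
    exact Submodule.one_le.1 (le_refl (1 : Submodule R S))
  | insert i s hi ih =>
    rw [Finset.prod_insert hi, Finset.sum_insert hi, pow_add]
    exact Submodule.mul_mem_mul (Submodule.pow_mem_pow _
      (show ξ i ∈ Submodule.span R (range ξ) from Submodule.subset_span (Set.mem_range_self i)) _)
        ih

lemma aeval_elim_mem {P : MvPolynomial (σ ⊕ σ) k} {d e : ℕ}
    (hP : P.IsWeightedHomogeneous (biweight σ) (d, e)) (ξ η : σ → S) :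
    aeval (Sum.elim ξ η) P ∈
      Submodule.span R (range ξ) ^ d * Submodule.span R (range η) ^ e := by
  rw [aeval_def, eval₂_eq']
  refine sum_mem fun m hm => ?_
  have h := hP (mem_support_iff.1 hm)
  rw [weight_biweight, Prod.mk.injEq] at h
  rw [IsScalarTower.algebraMap_apply k R S, ← Algebra.smul_def]
  refine Submodule.smul_mem _ _ ?_
  rw [Fintype.prod_sum_type]
  simp only [Sum.elim_inl, Sum.elim_inr]
  exact Submodule.mul_mem_mul (h.1 ▸ prod_pow_mem_span_pow ξ _ _)
    (h.2 ▸ prod_pow_mem_span_pow η _ _)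

lemma map_mem_of_mem_span {A B : Type*} [CommRing A] [AddCommGroup B] (L : A →+ B)
    (K : AddSubgroup B) {s : Set A} (h : ∀ P, ∀ g ∈ s, L (P * g) ∈ K) {x : A}
    (hx : x ∈ Ideal.span s) : L x ∈ K := by
  obtain ⟨n, f, g, rfl⟩ := Submodule.mem_span_set'.1 hx
  rw [map_sum]
  exact sum_mem fun i _ => h _ _ (g i).2

lemma exists_ne_eval_weightedHomogeneousComponent {τ M : Type*} [AddCommMonoid M] (w : τ → M)
    {P : MvPolynomial τ k} {x : τ → k} (hP : eval x P ≠ 0) :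
    ∃ m, eval x (weightedHomogeneousComponent w m P) ≠ 0 := by
  by_contra! h
  refine hP ?_
  rw [← sum_weightedHomogeneousComponent w P,
    finsum_eq_sum _ (weightedHomogeneousComponent_finsupp P), map_sum]
  exact Finset.sum_eq_zero fun m _ => h m

/-- Evaluation of bigraded components of multiples of a bihomogeneous polynomial. -/
lemma aeval_component_mul_mem {P : MvPolynomial (σ ⊕ σ) k} {e : ℕ × ℕ}
    (hP : P.IsWeightedHomogeneous (biweight σ) e) (ξ η : σ → S) {T : Submodule R S}
    (hT : aeval (Sum.elim ξ η) P ∈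
      T * (Submodule.span R (range ξ) ^ e.1 * Submodule.span R (range η) ^ e.2))
    (c : MvPolynomial (σ ⊕ σ) k) (m : ℕ × ℕ) :
    aeval (Sum.elim ξ η) (weightedHomogeneousComponent (biweight σ) m (c * P)) ∈
      T * (Submodule.span R (range ξ) ^ m.1 * Submodule.span R (range η) ^ m.2) := by
  by_cases h : ∃ f, f + e = m
  · obtain ⟨f, rfl⟩ := h
    rw [weightedHomogeneousComponent_mul_of_isWeightedHomogeneous hP, map_mul]
    have h1 := Submodule.mul_mem_mul (aeval_elim_mem (R := R)
      (weightedHomogeneousComponent_isWeightedHomogeneous (w := biweight σ) f c) ξ η) hT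
    convert h1 using 1
    simp only [Prod.fst_add, Prod.snd_add, pow_add]
    ring
  · push Not at h
    rw [weightedHomogeneousComponent_mul_eq_zero hP h, map_zero]
    exact Submodule.zero_mem _

lemma aeval_component_mem_of_mem_fibreIdeal {ι : Type*} {I : Ideal (MvPolynomial σ k)}
    (hI : ∀ g ∈ I, ∀ d, homogeneousComponent d g ∈ I)
    {F : ι → MvPolynomial σ k} {d : ℕ} (hF : ∀ i, (F i).IsHomogeneous d) {ξ η : σ → S}
    (hξI : ∀ g ∈ I, aeval ξ g = 0) (hηI : ∀ g ∈ I, aeval η g = 0) {T : Submodule R S}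
    (hFT : ∀ i l, aeval ξ (F i) * aeval η (F l) - aeval ξ (F l) * aeval η (F i) ∈
      T * (Submodule.span R (range ξ) ^ d * Submodule.span R (range η) ^ d))
    {g : MvPolynomial (σ ⊕ σ) k} (hg : g ∈ fibreIdeal I F) (m : ℕ × ℕ) :
    aeval (Sum.elim ξ η) (weightedHomogeneousComponent (biweight σ) m g) ∈
      T * (Submodule.span R (range ξ) ^ m.1 * Submodule.span R (range η) ^ m.2) := by
  rw [fibreIdeal, Ideal.map, Ideal.map, ← Ideal.span_union, ← Ideal.span_union] at hg
  refine map_mem_of_mem_span (((aeval (Sum.elim ξ η)).toLinearMap.comp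
    (weightedHomogeneousComponent (biweight σ) m)).toAddMonoidHom)
    (T * (Submodule.span R (range ξ) ^ m.1 * Submodule.span R (range η) ^ m.2)).toAddSubgroup
    ?_ hg
  rintro P _ ((⟨g, hg, rfl⟩ | ⟨g, hg, rfl⟩) | ⟨⟨i, l⟩, rfl⟩)
  · change aeval (Sum.elim ξ η) (weightedHomogeneousComponent (biweight σ) m
      (P * rename Sum.inl g)) ∈ _
    rw [show P * rename Sum.inl g = ∑ d ∈ Finset.range (g.totalDegree + 1),
      P * rename Sum.inl (homogeneousComponent d g) by
        rw [← Finset.mul_sum, ← map_sum, sum_homogeneousComponent], map_sum, map_sum]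
    refine sum_mem fun d _ => ?_
    refine aeval_component_mul_mem (rename_inl_isWeightedHomogeneous
      (homogeneousComponent_isHomogeneous d g)) ξ η ?_ P m
    rw [aeval_rename, Sum.elim_comp_inl, hξI _ (hI g hg d)]
    exact Submodule.zero_mem _
  · change aeval (Sum.elim ξ η) (weightedHomogeneousComponent (biweight σ) m
      (P * rename Sum.inr g)) ∈ _
    rw [show P * rename Sum.inr g = ∑ d ∈ Finset.range (g.totalDegree + 1),
      P * rename Sum.inr (homogeneousComponent d g) by
        rw [← Finset.mul_sum, ← map_sum, sum_homogeneousComponent], map_sum, map_sum]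
    refine sum_mem fun d _ => ?_
    refine aeval_component_mul_mem (rename_inr_isWeightedHomogeneous
      (homogeneousComponent_isHomogeneous d g)) ξ η ?_ P m
    rw [aeval_rename, Sum.elim_comp_inr, hηI _ (hI g hg d)]
    exact Submodule.zero_mem _
  · have h : ∀ i l, (rename Sum.inl (F i) * rename Sum.inr (F l)).IsWeightedHomogeneous
        (biweight σ) (d, d) := fun i l => by
      have := (rename_inl_isWeightedHomogeneous (hF i)).mul
        (rename_inr_isWeightedHomogeneous (hF l))
      simpa using this
    refine aeval_component_mul_mem (e := (d, d))
      (Submodule.sub_mem (weightedHomogeneousSubmodule k (biweight σ) (d, d)) (h i l) (h l i))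
      ξ η ?_ P m
    simpa [aeval_rename] using hFT i l

/-- Bihomogeneous polynomials, nonvanishing at a diagonal point, multiplying the equations of the
diagonal into the fibre product. -/
lemma exists_bihomogeneous_mul_minor_mem {ι : Type*} {I : Ideal (MvPolynomial σ k)}
    (hI : ∀ g ∈ I, ∀ d, homogeneousComponent d g ∈ I)
    {F : ι → MvPolynomial σ k} {d : ℕ} (hF : ∀ i, (F i).IsHomogeneous d) {ξ η : σ → S}
    (hξI : ∀ g ∈ I, aeval ξ g = 0) (hηI : ∀ g ∈ I, aeval η g = 0) {T : Submodule R S}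
    (hFT : ∀ i l, aeval ξ (F i) * aeval η (F l) - aeval ξ (F l) * aeval η (F i) ∈
      T * (Submodule.span R (range ξ) ^ d * Submodule.span R (range η) ^ d))
    {v : σ → k} (hv : v ≠ 0) (hun : Immersive I F v) :
    ∃ (e : ℕ) (c : MvPolynomial (σ ⊕ σ) k), c.IsWeightedHomogeneous (biweight σ) (e, e) ∧
      eval (Sum.elim v v) c ≠ 0 ∧ ∀ i j, aeval (Sum.elim ξ η) (c * minor k i j) ∈
        T * (Submodule.span R (range ξ) * Submodule.span R (range η)) ^ (e + 1) := by
  obtain ⟨c, hc, hcm⟩ := exists_mul_minor_mem_fibreIdeal I F hF hv hun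
  obtain ⟨⟨e, e'⟩, he⟩ := exists_ne_eval_weightedHomogeneousComponent (biweight σ) hc
  obtain ⟨a, ha⟩ := Function.ne_iff.1 hv
  rw [Pi.zero_apply] at ha
  have hx : (X (Sum.inl a) ^ e' * X (Sum.inr a) ^ e : MvPolynomial (σ ⊕ σ) k).IsWeightedHomogeneous
      (biweight σ) (e', e) := by
    have := ((isWeightedHomogeneous_X k (biweight σ) (Sum.inl a)).pow e').mul
      ((isWeightedHomogeneous_X k (biweight σ) (Sum.inr a)).pow e)
    simpa [biweight] using this
  set c' := weightedHomogeneousComponent (biweight σ) (e, e') c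
  have hc' : c'.IsWeightedHomogeneous (biweight σ) (e, e') :=
    weightedHomogeneousComponent_isWeightedHomogeneous _ _
  refine ⟨e' + e, X (Sum.inl a) ^ e' * X (Sum.inr a) ^ e * c', ?_, ?_, fun i j => ?_⟩
  · have := hx.mul hc'
    rwa [Prod.mk_add_mk, add_comm e e'] at this
  · simp [he, ha]
  · have h1 := aeval_component_mem_of_mem_fibreIdeal hI hF hξI hηI hFT (hcm i j)
      ((e, e') + (1, 1))
    rw [weightedHomogeneousComponent_mul_of_isWeightedHomogeneous
      (minor_isWeightedHomogeneous i j)] at h1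
    have h2 := Submodule.mul_mem_mul (aeval_elim_mem (R := R) hx ξ η) h1
    rw [mul_assoc, map_mul]
    convert h2 using 1
    rw [mul_pow]
    simp only [Prod.fst_add, Prod.snd_add, pow_add]
    ring

end Bigraded

section Contradiction

open scoped Pointwise

variable {k : Type*} [Field k] {σ : Type*} [Fintype σ] {R S : Type*} [CommRing R] [CommRing S]
  [Algebra R S] [Algebra k R] [Algebra k S] [IsScalarTower k R S]

lemma aeval_diagonal_component_mul_mem {P : MvPolynomial (σ ⊕ σ) k} {e : ℕ}
    (hP : P.IsWeightedHomogeneous (biweight σ) (e, e)) (ξ η : σ → S) {K : Submodule R S} {N : ℕ}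
    (hK : e ≤ N → ∀ s ∈ (Submodule.span R (range ξ) * Submodule.span R (range η)) ^ (N - e),
      s * aeval (Sum.elim ξ η) P ∈ K)
    (Q : MvPolynomial (σ ⊕ σ) k) :
    aeval (Sum.elim ξ η) (weightedHomogeneousComponent (biweight σ) (N, N) (Q * P)) ∈ K := by
  by_cases h : e ≤ N
  · have h1 : ((N, N) : ℕ × ℕ) = (N - e, N - e) + (e, e) := by
      simp [Nat.sub_add_cancel h]
    rw [h1, weightedHomogeneousComponent_mul_of_isWeightedHomogeneous hP, map_mul]
    refine hK h _ ?_
    rw [mul_pow]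
    exact aeval_elim_mem (weightedHomogeneousComponent_isWeightedHomogeneous _ _) ξ η
  · rw [weightedHomogeneousComponent_mul_eq_zero hP (fun f hf => h ?_), map_zero]
    · exact zero_mem _
    · have := congrArg Prod.fst hf
      simp only [Prod.fst_add] at this
      omega

lemma mem_pow_products {τ : Type*} {s : Set (MvPolynomial (τ ⊕ τ) k)}
    (hs : s = range fun i : τ × τ => X (Sum.inl i.1) * X (Sum.inr i.2)) (N : ℕ) :
    ∀ P ∈ s ^ N, P.IsWeightedHomogeneous (biweight τ) (N, N) ∧ P ∈ Ideal.span s ^ N := by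
  induction N with
  | zero =>
    intro P hP
    rw [pow_zero, Set.mem_one] at hP
    subst hP
    exact ⟨isWeightedHomogeneous_one k _, by simp⟩
  | succ N ih =>
    intro P hP
    rw [pow_succ] at hP
    obtain ⟨P, hP, Q, hQ, rfl⟩ := hP
    refine ⟨?_, ?_⟩
    · have hQ' := hQ
      rw [hs] at hQ'
      obtain ⟨⟨i, j⟩, rfl⟩ := hQ'
      have := (ih P hP).1.mul ((isWeightedHomogeneous_X k (biweight τ) (Sum.inl i)).mul
        (isWeightedHomogeneous_X k (biweight τ) (Sum.inr j)))
      exact this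
    · rw [pow_succ]
      exact Ideal.mul_mem_mul (ih P hP).2 (Ideal.subset_span hQ)

/-- Two retractions of a family of pairs of points of a variety, one on the diagonal and one off it,
cannot coexist when all pairs have the same image under an immersion. -/
theorem false_of_retractions [IsAlgClosed k] [IsNoetherianRing R] [IsDomain S]
    {I : Ideal (MvPolynomial σ k)} (hI : ∀ g ∈ I, ∀ d, homogeneousComponent d g ∈ I)
    {ξ η : σ → S} (hξI : ∀ g ∈ I, aeval ξ g = 0) (hηI : ∀ g ∈ I, aeval η g = 0)
    {τ : R} (hτ : τ ≠ 0) (hτu : ¬IsUnit τ)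
    (hloc : ∀ x : σ → k, x ≠ 0 → (∀ g ∈ I, eval x g = 0) → ∃ (r d : ℕ)
      (F : Fin r → MvPolynomial σ k), (∀ i, (F i).IsHomogeneous d) ∧ Immersive I F x ∧
      ∀ i l, aeval ξ (F i) * aeval η (F l) - aeval ξ (F l) * aeval η (F i) ∈
        Submodule.span R {algebraMap R S τ} *
          (Submodule.span R (range ξ) ^ d * Submodule.span R (range η) ^ d))
    (p q : S →ₐ[R] R) {v v' : σ → k}
    (hpξ : ∀ i, p (ξ i) = algebraMap k R (v i)) (hpη : ∀ i, p (η i) = algebraMap k R (v i))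
    (hqξ : ∀ i, q (ξ i) = algebraMap k R (v i)) (hqη : ∀ i, q (η i) = algebraMap k R (v' i))
    (hvI : ∀ g ∈ I, eval v g = 0) {a : σ → k} (hav : ∑ i, a i * v i = 1)
    (hav' : ∑ i, a i * v' i = 1) {i₁ j₁ : σ} (hvv' : v i₁ * v' j₁ - v j₁ * v' i₁ ≠ 0) : False := by
  classical
  set ev : MvPolynomial (σ ⊕ σ) k →ₐ[k] S := aeval (Sum.elim ξ η) with hev
  set T : Submodule R S := Submodule.span R {algebraMap R S τ} with hT
  set F : Submodule R S := Submodule.span R (range ξ) * Submodule.span R (range η) with hF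
  have hp : ∀ P, p (ev P) = algebraMap k R (eval (Sum.elim v v) P) := by
    intro P
    have h : (p.restrictScalars k).comp ev = (Algebra.ofId k R).comp (aeval (Sum.elim v v)) := by
      refine MvPolynomial.algHom_ext fun i => ?_
      cases i <;> simp [hev, hpξ, hpη, Algebra.ofId_apply]
    simpa [Algebra.ofId_apply, aeval_eq_eval] using DFunLike.congr_fun h P
  have hq : ∀ P, q (ev P) = algebraMap k R (eval (Sum.elim v v') P) := by
    intro P
    have h : (q.restrictScalars k).comp ev = (Algebra.ofId k R).comp (aeval (Sum.elim v v')) := by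
      refine MvPolynomial.algHom_ext fun i => ?_
      cases i <;> simp [hev, hqξ, hqη, Algebra.ofId_apply]
    simpa [Algebra.ofId_apply, aeval_eq_eval] using DFunLike.congr_fun h P
  have hv : v ≠ 0 := by
    rintro rfl
    simp at hav
  have hcx : ∀ x : σ → k, x ≠ 0 → (∀ g ∈ I, eval x g = 0) →
      ∃ (e : ℕ) (c : MvPolynomial (σ ⊕ σ) k), c.IsWeightedHomogeneous (biweight σ) (e, e) ∧
        eval (Sum.elim x x) c ≠ 0 ∧ ∀ i j, ev (c * minor k i j) ∈ T * F ^ (e + 1) := by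
    intro x hx hxI
    obtain ⟨r, d, G, hG, hun, hGT⟩ := hloc x hx hxI
    exact exists_bihomogeneous_mul_minor_mem hI hG hξI hηI hGT hx hun
  set 𝒞 : Set (MvPolynomial (σ ⊕ σ) k) := {c | ∃ e, c.IsWeightedHomogeneous (biweight σ) (e, e) ∧
    ∀ i j, ev (c * minor k i j) ∈ T * F ^ (e + 1)} with h𝒞
  set J : Ideal (MvPolynomial (σ ⊕ σ) k) := Ideal.span ((range fun i : σ × σ => minor k i.1 i.2) ∪
    𝒞 ∪ rename Sum.inl '' (I : Set (MvPolynomial σ k)) ∪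
      rename Sum.inr '' (I : Set (MvPolynomial σ k))) with hJ
  set s : Set (MvPolynomial (σ ⊕ σ) k) :=
    range fun i : σ × σ => X (Sum.inl i.1) * X (Sum.inr i.2) with hs
  have hsJ : Ideal.span s ≤ J.radical := by
    rw [Ideal.span_le]
    rintro _ ⟨⟨i, j⟩, rfl⟩
    rw [SetLike.mem_coe, ← vanishingIdeal_zeroLocus_eq_radical (K := k), mem_vanishingIdeal_iff]
    intro z hz
    obtain ⟨x, y, rfl⟩ : ∃ x y : σ → k, z = Sum.elim x y :=
      ⟨z ∘ Sum.inl, z ∘ Sum.inr, (Sum.elim_comp_inl_inr z).symm⟩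
    rw [mem_zeroLocus_iff] at hz
    simp only [map_mul, aeval_X, Sum.elim_inl, Sum.elim_inr]
    by_contra hxy
    have hx : x ≠ 0 := fun h => hxy (by simp [h])
    have hy : y ≠ 0 := fun h => hxy (by simp [h])
    have hxI : ∀ g ∈ I, eval x g = 0 := fun g hg => by
      have := hz _ (Ideal.subset_span (Or.inl (Or.inr ⟨g, hg, rfl⟩)))
      rwa [aeval_rename, Sum.elim_comp_inl, aeval_eq_eval] at this
    obtain ⟨e, c, hc, hcx, hcm⟩ := hcx x hx hxI
    have hmin : ∀ i j, x i * y j = x j * y i := fun i j => by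
      have := hz _ (Ideal.subset_span (Or.inl (Or.inl (Or.inl ⟨(i, j), rfl⟩))))
      simpa [minor, sub_eq_zero] using this
    have hxi : x i ≠ 0 := fun h => hxy (by simp [h])
    have hyx : y = (y i / x i) • x := by
      ext l
      rw [Pi.smul_apply, smul_eq_mul, div_mul_eq_mul_div, eq_div_iff hxi, mul_comm, hmin i l,
        mul_comm]
    have ht : y i / x i ≠ 0 := fun h => hy (by rw [hyx, h, zero_smul])
    have := hz c (Ideal.subset_span (Or.inl (Or.inl (Or.inr ⟨e, hc, hcm⟩))))
    rw [aeval_eq_eval, hyx, eval_elim_smul hc] at this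
    exact mul_ne_zero (pow_ne_zero _ ht) hcx this
  obtain ⟨N₀, hN₀⟩ := Ideal.exists_pow_le_of_le_radical_of_fg hsJ
    (hs ▸ Submodule.fg_span (Set.finite_range _))
  obtain ⟨e, c, hc, hcv, hcm⟩ := hcx v hv hvI
  set N := N₀ + e + 1 with hN
  set β : σ × σ → S := fun i => ev (minor k i.1 i.2) with hβ
  have hβF : ∀ i, β i ∈ F := fun i => by
    have := aeval_elim_mem (R := R) (minor_isWeightedHomogeneous (k := k) i.1 i.2) ξ η
    simpa using this
  set b : Submodule R S := Submodule.span R (range β) * F ^ (N - 1) with hb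
  set cc : Submodule R S := F ^ N ⊓
    ⨅ i, (T * F ^ (N + 1)).comap (LinearMap.mulRight R (β i)) with hcc
  have hmem_cc : ∀ t, t ∈ cc ↔ t ∈ F ^ N ∧ ∀ i, t * β i ∈ T * F ^ (N + 1) := fun t => by
    simp [hcc, Submodule.mem_iInf]
  have hccmul : ∀ (e : ℕ) (c : MvPolynomial (σ ⊕ σ) k),
      c.IsWeightedHomogeneous (biweight σ) (e, e) →
      (∀ i j, ev (c * minor k i j) ∈ T * F ^ (e + 1)) → e ≤ N → ∀ t ∈ F ^ (N - e),
        t * ev c ∈ cc := by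
    intro e c hc hcm heN t ht
    rw [hmem_cc]
    refine ⟨?_, fun i => ?_⟩
    · rw [← Nat.sub_add_cancel heN, pow_add]
      refine Submodule.mul_mem_mul ht ?_
      have := aeval_elim_mem (R := R) hc ξ η
      rwa [← mul_pow] at this
    · have h := Submodule.mul_mem_mul ht (hcm i.1 i.2)
      rw [mul_left_comm, ← pow_add, map_mul, ← mul_assoc] at h
      rwa [show N - e + (e + 1) = N + 1 by omega] at h
  have hFle : F ^ N ≤ b ⊔ cc := by
    have hFs : F = Submodule.span R (ev '' s) := by
      rw [hF, Submodule.span_mul_span]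
      congr 1
      ext t
      simp only [Set.mem_mul, Set.mem_range, Set.mem_image, hs, Prod.exists, exists_exists_eq_and,
        exists_exists_exists_and_eq]
      simp [hev]
    rw [hFs, Submodule.span_pow, Submodule.span_le, ← Set.image_pow]
    rintro _ ⟨P, hP, rfl⟩
    obtain ⟨hPh, hPJ⟩ := mem_pow_products hs N P hP
    replace hPJ : P ∈ J := hN₀ (Ideal.pow_le_pow_right (by omega) hPJ)
    rw [← hPh.weightedHomogeneousComponent_same]
    refine map_mem_of_mem_span ((ev.toLinearMap.comp
      (weightedHomogeneousComponent (biweight σ) (N, N))).toAddMonoidHom)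
      (b ⊔ cc).toAddSubgroup ?_ hPJ
    have hIz : ∀ (Q : MvPolynomial (σ ⊕ σ) k) (u : σ → σ ⊕ σ) (g : MvPolynomial σ k),
        (∀ d, ∃ e, (rename u (homogeneousComponent d g)).IsWeightedHomogeneous (biweight σ) e) →
        (∀ d, ev (rename u (homogeneousComponent d g)) = 0) →
        ev (weightedHomogeneousComponent (biweight σ) (N, N) (Q * rename u g)) ∈ b ⊔ cc := by
      intro Q u g h1 h2
      rw [show Q * rename u g = ∑ d ∈ Finset.range (g.totalDegree + 1),
        Q * rename u (homogeneousComponent d g) by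
          rw [← Finset.mul_sum, ← map_sum, sum_homogeneousComponent], map_sum, map_sum]
      refine sum_mem fun d _ => ?_
      obtain ⟨e, he⟩ := h1 d
      have := aeval_component_mul_mem he ξ η (T := (⊥ : Submodule R S))
        (by rw [← hev, h2]; exact zero_mem _) Q (N, N)
      rw [Submodule.bot_mul, Submodule.mem_bot] at this
      rw [hev, this]
      exact zero_mem _
    rintro Q g (((⟨⟨i, j⟩, rfl⟩ | ⟨e', hg, hgm⟩) | ⟨g, hg, rfl⟩) | ⟨g, hg, rfl⟩)
    · refine aeval_diagonal_component_mul_mem (K := b ⊔ cc)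
        (minor_isWeightedHomogeneous i j) ξ η (fun _ t ht => ?_) Q
      refine Submodule.mem_sup_left ?_
      rw [mul_comm]
      exact Submodule.mul_mem_mul (Submodule.subset_span ⟨(i, j), rfl⟩) ht
    · exact aeval_diagonal_component_mul_mem (K := b ⊔ cc) hg ξ η
        (fun heN t ht => Submodule.mem_sup_right (hccmul e' g hg hgm heN t ht)) Q
    · refine hIz Q Sum.inl g (fun d => ⟨_, rename_inl_isWeightedHomogeneous
        (homogeneousComponent_isHomogeneous d g)⟩) fun d => ?_
      rw [hev, aeval_rename, Sum.elim_comp_inl, hξI _ (hI g hg d)]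
    · refine hIz Q Sum.inr g (fun d => ⟨_, rename_inr_isWeightedHomogeneous
        (homogeneousComponent_isHomogeneous d g)⟩) fun d => ?_
      rw [hev, aeval_rename, Sum.elim_comp_inr, hηI _ (hI g hg d)]
  have hble : b ≤ F ^ N := by
    rw [hb, show F ^ N = F * F ^ (N - 1) by rw [← pow_succ']; rfl]
    refine mul_le_mul' ?_ le_rfl
    rw [Submodule.span_le]
    rintro _ ⟨i, rfl⟩
    exact hβF i
  have hFeq : F ^ N = b ⊔ cc := le_antisymm hFle (sup_le hble inf_le_left)
  have hbc : b * cc ≤ T * (F ^ N) ^ 2 := by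
    have h1 : Submodule.span R (range β) * cc ≤ T * F ^ (N + 1) := by
      rw [Submodule.mul_le]
      intro x hx y hy
      induction hx using Submodule.span_induction with
      | mem x hx =>
        obtain ⟨i, rfl⟩ := hx
        have := ((hmem_cc y).1 hy).2 i
        rwa [mul_comm y] at this
      | zero => rw [zero_mul]; exact zero_mem _
      | add x z _ _ hx hz => rw [add_mul]; exact add_mem hx hz
      | smul r x _ hx => rw [smul_mul_assoc]; exact Submodule.smul_mem _ _ hx
    calc b * cc = F ^ (N - 1) * (Submodule.span R (range β) * cc) := by rw [hb]; ring
      _ ≤ F ^ (N - 1) * (T * F ^ (N + 1)) := mul_le_mul' le_rfl h1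
      _ = T * (F ^ N) ^ 2 := by
        rw [mul_left_comm, ← pow_add, ← pow_mul]
        congr 2
        omega
  have hFfg : (F ^ N).FG := by
    refine Submodule.FG.pow (Submodule.FG.mul ?_ ?_) _
    · exact Submodule.fg_span (Set.finite_range _)
    · exact Submodule.fg_span (Set.finite_range _)
  obtain ⟨m, w, hw⟩ := Submodule.fg_iff_exists_fin_generating_family.1 hFfg
  set H : MvPolynomial (σ ⊕ σ) k := (∑ i, C (a i) * X (Sum.inl i)) * ∑ i, C (a i) * X (Sum.inr i)
    with hH
  have hHh : H.IsWeightedHomogeneous (biweight σ) (1, 1) := by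
    refine IsWeightedHomogeneous.mul (m := ((1, 0) : ℕ × ℕ)) (n := ((0, 1) : ℕ × ℕ)) ?_ ?_
    · exact sum_mem (S := weightedHomogeneousSubmodule k (biweight σ) (1, 0)) fun i _ => by
        have := (isWeightedHomogeneous_C (biweight σ) (a i)).mul
          (isWeightedHomogeneous_X k (biweight σ) (Sum.inl i))
        simpa [biweight] using this
    · exact sum_mem (S := weightedHomogeneousSubmodule k (biweight σ) (0, 1)) fun i _ => by
        have := (isWeightedHomogeneous_C (biweight σ) (a i)).mul
          (isWeightedHomogeneous_X k (biweight σ) (Sum.inr i))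
        simpa [biweight] using this
  have hHF : ev H ∈ F := by
    have := aeval_elim_mem (R := R) hHh ξ η
    simpa using this
  have hHv : eval (Sum.elim v v) H = 1 := by simp [hH, hav]
  have hHv' : eval (Sum.elim v v') H = 1 := by simp [hH, hav, hav']
  have hminv : eval (Sum.elim v v') (minor k i₁ j₁) ≠ 0 := by simpa [minor] using hvv'
  refine false_of_separated_retractions k w (b := b) (c := cc) (hw.trans hFeq) hτ hτu
    (by rw [hw]; exact hbc) p q (x₀ := ev (H ^ N))
    (c₀ := ev (H ^ (N - e) * (C (eval (Sum.elim v v) c)⁻¹ * c)))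
    (b₀ := ev (C (eval (Sum.elim v v') (minor k i₁ j₁))⁻¹ * minor k i₁ j₁ * H ^ (N - 1)))
    ?_ ?_ ?_ ?_ ?_ ?_ ?_
  · rw [hw, map_pow]
    exact Submodule.pow_mem_pow _ hHF _
  · rw [hp, map_pow, hHv, one_pow, map_one]
  · rw [hq, map_pow, hHv', one_pow, map_one]
  · rw [map_mul, map_mul, mul_left_comm, hev, algHom_C, ← hev,
      IsScalarTower.algebraMap_apply k R S, ← Algebra.smul_def, map_pow]
    exact Submodule.smul_mem _ _ (hccmul e c hc hcm (by omega) _ (Submodule.pow_mem_pow _ hHF _))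
  · rw [hp, map_mul, map_pow, hHv, map_mul (eval _), eval_C, inv_mul_cancel₀ hcv]
    simp
  · rw [map_mul, map_mul, hev, algHom_C, ← hev,
      IsScalarTower.algebraMap_apply k R S, ← Algebra.smul_def, map_pow, smul_mul_assoc]
    exact Submodule.smul_mem _ _ (Submodule.mul_mem_mul
      (Submodule.subset_span ⟨(i₁, j₁), rfl⟩) (Submodule.pow_mem_pow _ hHF _))
  · rw [hq, map_mul, map_pow, hHv', map_mul (eval _), eval_C,
      inv_mul_cancel₀ hminv]
    simp

end Contradiction

section IncidenceContradiction

variable {k : Type*} [Field k] {σ : Type*} [Fintype σ]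

lemma aeval_mem_span_pow {R S : Type*} [CommRing R] [CommRing S] [Algebra R S] [Algebra k R]
    [Algebra k S] [IsScalarTower k R S] {P : MvPolynomial σ k} {d : ℕ} (hP : P.IsHomogeneous d)
    (ξ : σ → S) : aeval ξ P ∈ Submodule.span R (range ξ) ^ d := by
  have := aeval_elim_mem (R := R) (rename_inl_isWeightedHomogeneous hP) ξ ξ
  rwa [aeval_rename, Sum.elim_comp_inl, pow_zero, mul_one] at this

/-- If all pairs satisfy the incidence relation for `F`, then they satisfy it for any other
representative `G`. -/
lemma incidence_mem {R S ι : Type*} [CommRing R] [CommRing S] [IsDomain S] [Algebra R S]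
    [Fintype ι] {τ : R} {X Y : Submodule R S} {z : ι → ι → R} {m : ι → R}
    {Fξ Fη Gξ Gη : ι → S} {i₀ : ι} (hs : Fξ i₀ ≠ 0) (ht : Fη i₀ ≠ 0)
    (hinc : ∀ i, Fη i₀ * (Fξ i + algebraMap R S τ * ∑ j, algebraMap R S (z i j) *
      (algebraMap R S (m i₀) * Fξ j - algebraMap R S (m j) * Fξ i₀)) = Fξ i₀ * Fη i)
    (hξ : ∀ i l, Gξ i * Fξ l = Gξ l * Fξ i) (hη : ∀ i l, Gη i * Fη l = Gη l * Fη i)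
    (hX : ∀ i, Gξ i ∈ X) (hY : ∀ i, Gη i ∈ Y) (i l : ι) :
    Gξ i * Gη l - Gξ l * Gη i ∈ Submodule.span R {algebraMap R S τ} * (X * Y) := by
  set U : ι → S := fun i => ∑ j, algebraMap R S (z i j) *
      (algebraMap R S (m i₀) * Fξ j - algebraMap R S (m j) * Fξ i₀) with hU
  set V : ι → S := fun i => ∑ j, algebraMap R S (z i j) *
      (algebraMap R S (m i₀) * Gξ j - algebraMap R S (m j) * Gξ i₀) with hV
  have hUV : ∀ i, Fξ i₀ * V i = Gξ i₀ * U i := fun i => by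
    simp only [hU, hV, Finset.mul_sum]
    refine Finset.sum_congr rfl fun j _ => ?_
    linear_combination algebraMap R S (z i j) * algebraMap R S (m i₀) * hξ j i₀
  have hVX : ∀ i, V i ∈ X := fun i => by
    refine sum_mem fun j _ => ?_
    rw [← Algebra.smul_def]
    refine Submodule.smul_mem _ _ (sub_mem ?_ ?_) <;>
    · rw [← Algebra.smul_def]
      exact Submodule.smul_mem _ _ (hX _)
  have key : Gξ i * Gη l - Gξ l * Gη i =
      algebraMap R S τ * (V l * Gη i - V i * Gη l) := by
    have h1 : Fξ i₀ * Fη i₀ ≠ 0 := mul_ne_zero hs ht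
    refine mul_left_cancel₀ h1 ?_
    linear_combination Fη i₀ * Gη l * hξ i i₀ - Fη i₀ * Gη i * hξ l i₀ + Gξ i₀ * Gη l * hinc i
      - Gξ i₀ * Gη i * hinc l + Fη i₀ * algebraMap R S τ * Gη l * hUV i
      - Fη i₀ * algebraMap R S τ * Gη i * hUV l + Gξ i₀ * Fξ i₀ * hη l i
  rw [key]
  exact Submodule.mul_mem_mul (Submodule.mem_span_singleton_self _)
    (sub_mem (Submodule.mul_mem_mul (hVX l) (hY i)) (Submodule.mul_mem_mul (hVX i) (hY l)))

end IncidenceContradiction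

section IncidenceContradiction

variable {k : Type*} [Field k] {D : Type*} [CommRing D] [Algebra k D] {Z : Type*}

/-- A quotient of a polynomial ring over `D`, as an algebra over the polynomials over `k`. -/
@[reducible] noncomputable def quotientAlgebra (W : Ideal (MvPolynomial Z D)) :
    Algebra (MvPolynomial Z k) (MvPolynomial Z D ⧸ W) :=
  ((Ideal.Quotient.mk W).comp (MvPolynomial.map (algebraMap k D))).toAlgebra

attribute [local instance] quotientAlgebra

/-- A point of `D`, seen as a retraction of a quotient of a polynomial ring over `D`. -/
noncomputable def pointRetraction (W : Ideal (MvPolynomial Z D)) (φ : D →ₐ[k] k)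
    (h : W ≤ RingHom.ker (mapAlgHom (σ := Z) φ)) :
    (MvPolynomial Z D ⧸ W) →ₐ[MvPolynomial Z k] MvPolynomial Z k :=
  { Ideal.Quotient.lift W (mapAlgHom (σ := Z) φ).toRingHom h with
    commutes' := fun P => by
      have h : ((mapAlgHom φ : MvPolynomial Z D →ₐ[k] MvPolynomial Z k).comp
          (mapAlgHom (Algebra.ofId k D) : MvPolynomial Z k →ₐ[k] MvPolynomial Z D)) =
          AlgHom.id k (MvPolynomial Z k) := by
        refine MvPolynomial.algHom_ext fun i => ?_
        simp
      exact DFunLike.congr_fun h P }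

lemma pointRetraction_mk_C (W : Ideal (MvPolynomial Z D)) (φ : D →ₐ[k] k)
    (h : W ≤ RingHom.ker (mapAlgHom (σ := Z) φ)) (x : D) :
    pointRetraction W φ h (Ideal.Quotient.mk W (C x)) = (C (φ x) : MvPolynomial Z k) :=
  map_C _ x

theorem false_of_incidence_prime [IsAlgClosed k] [Finite Z] {σ : Type*} [Fintype σ]
    (W : Ideal (MvPolynomial Z D)) (hWp : W.IsPrime) (hWC : ∀ d : D, C d ∈ W → d = 0) (o : Z)
    {ι : Type*} [Fintype ι] {ξ η : σ → D}
    {I : Ideal (MvPolynomial σ k)} (hI : ∀ g ∈ I, ∀ d, homogeneousComponent d g ∈ I)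
    (hξI : ∀ g ∈ I, aeval ξ g = 0) (hηI : ∀ g ∈ I, aeval η g = 0)
    {F : ι → MvPolynomial σ k}
    {v v' : σ → k} (hvI : ∀ g ∈ I, eval v g = 0) {a : σ → k} (hav : ∑ i, a i * v i = 1)
    (hav' : ∑ i, a i * v' i = 1) {i₀ : ι} (hs : aeval ξ (F i₀) ≠ 0) (ht : aeval η (F i₀) ≠ 0)
    {i₁ j₁ : σ} (hij : v i₁ * v' j₁ - v j₁ * v' i₁ ≠ 0)
    (φ φ' : D →ₐ[k] k) (hφξ : ∀ j, φ (ξ j) = v j) (hφη : ∀ j, φ (η j) = v j)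
    (hφξ' : ∀ j, φ' (ξ j) = v j) (hφη' : ∀ j, φ' (η j) = v' j)
    (hWφ : W ≤ RingHom.ker (mapAlgHom (σ := Z) φ)) (hWφ' : W ≤ RingHom.ker (mapAlgHom (σ := Z) φ'))
    (z : ι → ι → MvPolynomial Z k)
    (hinc : ∀ i, C (aeval η (F i₀)) * (C (aeval ξ (F i)) + X o *
      ∑ j, MvPolynomial.map (algebraMap k D) (z i j) *
        C (algebraMap k D (eval v (F i₀)) * aeval ξ (F j) -
          algebraMap k D (eval v (F j)) * aeval ξ (F i₀))) -
      C (aeval ξ (F i₀)) * C (aeval η (F i)) ∈ W)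
    (hloc : ∀ x : σ → k, x ≠ 0 → (∀ g ∈ I, eval x g = 0) → ∃ (e : ℕ)
      (G : ι → MvPolynomial σ k), (∀ i, (G i).IsHomogeneous e) ∧ Immersive I G x ∧
      (∀ i l, aeval ξ (G i) * aeval ξ (F l) = aeval ξ (G l) * aeval ξ (F i)) ∧
      ∀ i l, aeval η (G i) * aeval η (F l) = aeval η (G l) * aeval η (F i)) : False := by
  have hS : IsDomain (MvPolynomial Z D ⧸ W) := Ideal.Quotient.isDomain W
  let ε : D →ₐ[k] MvPolynomial Z D ⧸ W := (Ideal.Quotient.mkₐ k W).comp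
    ((Algebra.ofId D (MvPolynomial Z D)).restrictScalars k)
  have hε : ∀ x, ε x = Ideal.Quotient.mk W (C x) := fun x => rfl
  have hεinj : ∀ x, ε x = 0 → x = 0 := fun x hx => hWC x (Ideal.Quotient.eq_zero_iff_mem.1 hx)
  have hεa : ∀ (ζ : σ → D) (g : MvPolynomial σ k), aeval (fun j => ε (ζ j)) g = ε (aeval ζ g) := by
    intro ζ g
    rw [← AlgHom.comp_apply, comp_aeval]
  have hRS : ∀ P : MvPolynomial Z k, algebraMap (MvPolynomial Z k) (MvPolynomial Z D ⧸ W) P =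
    Ideal.Quotient.mk W (MvPolynomial.map (algebraMap k D) P) := fun P => rfl
  have hτu : ¬IsUnit (X o : MvPolynomial Z k) := by
    intro h
    have := h.map (eval (0 : Z → k))
    simp at this
  have hp : ∀ ψ hψ x, pointRetraction W ψ hψ (ε x) = (C (ψ x) : MvPolynomial Z k) :=
    fun ψ hψ x => pointRetraction_mk_C W ψ hψ x
  have : IsScalarTower k (MvPolynomial Z k) (MvPolynomial Z D ⧸ W) := by
    refine IsScalarTower.of_algebraMap_eq fun x => ?_
    rw [hRS, algebraMap_eq, map_C]
    rfl
  refine false_of_retractions (R := MvPolynomial Z k) (S := MvPolynomial Z D ⧸ W) (τ := X o)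
    (ξ := fun j => ε (ξ j)) (η := fun j => ε (η j)) hI
    (fun g hg => by rw [hεa, hξI g hg, map_zero])
    (fun g hg => by rw [hεa, hηI g hg, map_zero]) (X_ne_zero _) hτu ?_
    (pointRetraction W φ hWφ) (pointRetraction W φ' hWφ')
    (fun i => by rw [hp, hφξ]; rfl) (fun i => by rw [hp, hφη]; rfl)
    (fun i => by rw [hp, hφξ']; rfl) (fun i => by rw [hp, hφη']; rfl) hvI hav hav' hij
  intro x hx hxI
  obtain ⟨e, G, hG, hGun, hGξ, hGη⟩ := hloc x hx hxI
  have hr : ∃ (r : ℕ), Nonempty (Fin r ≃ ι) := ⟨_, ⟨(Fintype.equivFin ι).symm⟩⟩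
  obtain ⟨r, ⟨E⟩⟩ := hr
  refine ⟨r, e, G ∘ E, fun i => hG _, ?_, fun i l => ?_⟩
  · exact fun w h1 h2 => hGun w h1 fun i l => by simpa using h2 (E.symm i) (E.symm l)
  refine incidence_mem (R := MvPolynomial Z k) (z := z)
    (m := fun j => C (eval v (F j))) (Fξ := fun i => aeval (fun j => ε (ξ j)) (F i))
    (Fη := fun i => aeval (fun j => ε (η j)) (F i)) (i₀ := i₀)
    (Gξ := fun i => aeval (fun j => ε (ξ j)) (G i))
    (Gη := fun i => aeval (fun j => ε (η j)) (G i)) ?_ ?_ ?_ ?_ ?_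
    (fun i => aeval_mem_span_pow (hG i) _) (fun i => aeval_mem_span_pow (hG i) _) (E i) (E l)
  · exact fun h => hs (hεinj _ (by rwa [hεa] at h))
  · exact fun h => ht (hεinj _ (by rwa [hεa] at h))
  · intro i
    have := Ideal.Quotient.eq_zero_iff_mem.2 (hinc i)
    rw [map_sub, sub_eq_zero] at this
    simp only [hεa]
    simp only [hε, hRS]
    simpa only [map_mul, map_add, map_sub, map_sum, map_X, map_C] using this
  · intro i l
    simp only [hεa, ← map_mul, hGξ i l]
  · intro i l
    simp only [hεa, ← map_mul, hGη i l]

theorem false_of_dominant_incidence {k : Type*} [Field k] [IsAlgClosed k] {σ : Type*} [Fintype σ]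
    {D : Type*} [CommRing D] [Algebra k D] [IsDomain D] [Algebra.FiniteType k D]
    {ξ η : σ → D} (hgen : Algebra.adjoin k (range ξ ∪ range η) = ⊤)
    {r m : ℕ} (hm : (m : WithBot ℕ∞) ≤ ringKrullDim D) (hrm : r + 2 < m)
    {I : Ideal (MvPolynomial σ k)} (hI : ∀ g ∈ I, ∀ d, homogeneousComponent d g ∈ I)
    (hξI : ∀ g ∈ I, aeval ξ g = 0) (hηI : ∀ g ∈ I, aeval η g = 0)
    {F : Fin (r + 1) → MvPolynomial σ k} {d : ℕ} (hF : ∀ i, (F i).IsHomogeneous d)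
    {v v' : σ → k} (hvI : ∀ g ∈ I, eval v g = 0) (hvI' : ∀ g ∈ I, eval v' g = 0)
    (hun : Immersive I F v) (hun' : Immersive I F v') {a : σ → k} (hav : ∑ i, a i * v i = 1)
    (hav' : ∑ i, a i * v' i = 1) {i₀ : Fin (r + 1)} (hi₀ : eval v (F i₀) ≠ 0)
    (hi₀' : eval v' (F i₀) ≠ 0)
    (hvv' : ∀ i, eval v (F i₀) * eval v' (F i) = eval v (F i) * eval v' (F i₀))
    {i₁ j₁ : σ} (hij : v i₁ * v' j₁ - v j₁ * v' i₁ ≠ 0)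
    (φ φ' : D →ₐ[k] k) (hφξ : ∀ j, φ (ξ j) = v j) (hφη : ∀ j, φ (η j) = v j)
    (hφξ' : ∀ j, φ' (ξ j) = v j) (hφη' : ∀ j, φ' (η j) = v' j)
    (hu : ∃ l, algebraMap k D (eval v (F i₀)) * aeval ξ (F l) -
      algebraMap k D (eval v (F l)) * aeval ξ (F i₀) ≠ 0)
    (hloc : ∀ x : σ → k, x ≠ 0 → (∀ g ∈ I, eval x g = 0) → ∃ (e : ℕ)
      (G : Fin (r + 1) → MvPolynomial σ k), (∀ i, (G i).IsHomogeneous e) ∧ Immersive I G x ∧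
      (∀ i l, aeval ξ (G i) * aeval ξ (F l) = aeval ξ (G l) * aeval ξ (F i)) ∧
      ∀ i l, aeval η (G i) * aeval η (F l) = aeval η (G l) * aeval η (F i)) : False := by
  classical
  have hev : ∀ (ψ : D →ₐ[k] k) (ζ : σ → D) (x : σ → k), (∀ j, ψ (ζ j) = x j) →
      ∀ g : MvPolynomial σ k, ψ (aeval ζ g) = eval x g := by
    intro ψ ζ x h g
    rw [← AlgHom.comp_apply, comp_aeval, ← aeval_eq_eval]
    simp only [h]
  have ht : aeval η (F i₀) ≠ 0 := fun h => hi₀ (by rw [← hev φ η v hφη, h, map_zero])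
  have hs : aeval ξ (F i₀) ≠ 0 := fun h => hi₀ (by rw [← hev φ ξ v hφξ, h, map_zero])
  obtain ⟨W, hWp, hWE, hWC, -, hW⟩ := exists_prime_incidence
    (fun i : {i // i ≠ i₀} => aeval ξ (F i)) (fun i => aeval η (F i)) (aeval ξ (F i₀))
    (aeval η (F i₀)) (fun l => algebraMap k D (eval v (F i₀)) * aeval ξ (F l) -
      algebraMap k D (eval v (F l)) * aeval ξ (F i₀)) ht hu
  have hWφ := le_ker_of_mapIncidence hgen hm hrm hξI hηI hF hvI hvI hun hun hav hav hi₀ hi₀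
    (fun i => mul_comm _ _) φ hφξ hφη hW
  have hWφ' := le_ker_of_mapIncidence hgen hm hrm hξI hηI hF hvI hvI' hun hun' hav hav' hi₀ hi₀'
    hvv' φ' hφξ' hφη' hW
  refine false_of_incidence_prime W hWp hWC none hI hξI hηI (F := F) hvI hav hav' hs ht hij φ φ' hφξ
    hφη hφξ' hφη' hWφ hWφ' (fun i j => if h : i ≠ i₀ then X (some (⟨i, h⟩, j)) else 0) ?_ hloc
  intro i
  by_cases hi : i = i₀
  · subst hi
    simp only [ne_eq, not_true_eq_false, dite_false, map_zero, zero_mul, Finset.sum_const_zero,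
      mul_zero, add_zero]
    rw [mul_comm, sub_self]
    exact zero_mem _
  · have := hWE ⟨i, hi⟩
    rw [incidence] at this
    simpa only [ne_eq, hi, not_false_eq_true, dite_true, map_X] using this

end IncidenceContradiction

section Representatives

variable {k : Type} [Field k] {M r : ℕ}

/-- `F` represents the map `f` on `X`, away from the common zeros of `F`. -/
def Represents (X : Set (Pr k M)) (f : Pr k M → Pr k r) (d : ℕ)
    (F : Fin (r + 1) → MvPolynomial (Fin (M + 1)) k) : Prop :=
  (∀ i, (F i).IsHomogeneous d) ∧ ∀ (v : Fin (M + 1) → k) (hv : v ≠ 0),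
    Projectivization.mk k v hv ∈ X → ∀ i l, eval v (F i) * (f (Projectivization.mk k v hv)).rep l =
      eval v (F l) * (f (Projectivization.mk k v hv)).rep i

variable {X : Set (Pr k M)} {f : Pr k M → Pr k r}

lemma mk_eq_iff_cross_mul {K ι : Type*} [Field K] {v w : ι → K} (hv : v ≠ 0) (hw : w ≠ 0) :
    Projectivization.mk K v hv = Projectivization.mk K w hw ↔ ∀ i l, v i * w l = v l * w i := by
  rw [Projectivization.mk_eq_mk_iff']
  constructor
  · rintro ⟨a, rfl⟩ i l
    simp only [Pi.smul_apply, smul_eq_mul]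
    ring
  · intro h
    obtain ⟨j, hj⟩ := Function.ne_iff.1 hw
    rw [Pi.zero_apply] at hj
    refine ⟨v j / w j, funext fun i => ?_⟩
    rw [Pi.smul_apply, smul_eq_mul, div_mul_eq_mul_div, div_eq_iff hj, h j i]

lemma LocalRep.represents {p : Pr k M} {F : Fin (r + 1) → MvPolynomial (Fin (M + 1)) k}
    (hF : LocalRep X f p F) : ∃ d, Represents X f d F := by
  obtain ⟨⟨d, hd⟩, -, h⟩ := hF
  refine ⟨d, hd, fun v hv hvX i l => ?_⟩
  by_cases hFv : (fun i => eval v (F i)) = 0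
  · rw [show eval v (F i) = 0 from congrFun hFv i, show eval v (F l) = 0 from congrFun hFv l,
      zero_mul, zero_mul]
  · have h1 := h _ hvX v hv rfl hFv
    conv_lhs at h1 => rw [← Projectivization.mk_rep (f (Projectivization.mk k v hv))]
    rw [mk_eq_iff_cross_mul] at h1
    linear_combination -h1 i l

lemma Represents.eq_mk {d : ℕ} {F : Fin (r + 1) → MvPolynomial (Fin (M + 1)) k}
    (hF : Represents X f d F) {v : Fin (M + 1) → k} (hv : v ≠ 0)
    (hvX : Projectivization.mk k v hv ∈ X) (hFv : (fun i => eval v (F i)) ≠ 0) :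
    f (Projectivization.mk k v hv) = Projectivization.mk k _ hFv := by
  conv_lhs => rw [← Projectivization.mk_rep (f (Projectivization.mk k v hv))]
  rw [mk_eq_iff_cross_mul]
  intro i l
  linear_combination -hF.2 v hv hvX i l

lemma Represents.localRep {d : ℕ} {F : Fin (r + 1) → MvPolynomial (Fin (M + 1)) k}
    (hF : Represents X f d F) {p : Pr k M} (hp : (fun i => eval p.rep (F i)) ≠ 0) :
    LocalRep X f p F := by
  refine ⟨⟨d, hF.1⟩, hp, ?_⟩
  rintro _ hq v hv rfl hFv
  exact hF.eq_mk hv hq hFv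

lemma Represents.cross_mul {d e : ℕ} {F G : Fin (r + 1) → MvPolynomial (Fin (M + 1)) k}
    (hF : Represents X f d F) (hG : Represents X f e G) {v w : Fin (M + 1) → k} (hv : v ≠ 0)
    (hw : w ≠ 0) (hvX : Projectivization.mk k v hv ∈ X) (hwX : Projectivization.mk k w hw ∈ X)
    (h : f (Projectivization.mk k v hv) = f (Projectivization.mk k w hw)) (i l : Fin (r + 1)) :
    eval v (F i) * eval w (G l) = eval v (F l) * eval w (G i) := by
  have h1 := hF.2 v hv hvX
  have h2 := hG.2 w hw hwX
  rw [← h] at h2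
  obtain ⟨j, hj⟩ := Function.ne_iff.1 (f (Projectivization.mk k v hv)).rep_nonzero
  rw [Pi.zero_apply] at hj
  generalize (f (Projectivization.mk k v hv)).rep = y at *
  refine mul_left_cancel₀ (mul_ne_zero hj hj) ?_
  linear_combination (y j * eval w (G l)) * h1 i j - (y j * eval w (G i)) * h1 l j +
    (y i * eval v (F j)) * h2 l j - (y l * eval v (F j)) * h2 i j

lemma eval_smul_eq_zero_iff {F : Fin (r + 1) → MvPolynomial (Fin (M + 1)) k} {d : ℕ}
    (hF : ∀ i, (F i).IsHomogeneous d) {t : k} (ht : t ≠ 0) (v : Fin (M + 1) → k) :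
    (fun i => eval (t • v) (F i)) = 0 ↔ (fun i => eval v (F i)) = 0 := by
  simp only [funext_iff, Pi.zero_apply, eval_smul_of_isHomogeneous (hF _), mul_eq_zero,
    pow_eq_zero_iff', ht, ne_eq, false_and, false_or]

lemma immersive_of_unramifiedAt (hX : X.Nonempty) {v : Fin (M + 1) → k} (hv : v ≠ 0)
    (hun : UnramifiedAt X f (Projectivization.mk k v hv)) {d : ℕ}
    {F : Fin (r + 1) → MvPolynomial (Fin (M + 1)) k} (hF : Represents X f d F)
    (hFv : (fun i => eval v (F i)) ≠ 0) : Immersive (coneIdeal X) F v := by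
  obtain ⟨t, ht⟩ := Projectivization.exists_smul_eq_mk_rep k v hv
  have ht' : (Projectivization.mk k v hv).rep = (t : k) • v := ht.symm
  have hd : ∀ (g : MvPolynomial (Fin (M + 1)) k) (e : ℕ), g.IsHomogeneous e → ∀ (w : _ → k),
      ∑ j, eval ((t : k) • v) (pderiv j g) * w j =
        (t : k) ^ (e - 1) * ∑ j, eval v (pderiv j g) * w j := by
    intro g e hg w
    rw [Finset.mul_sum]
    refine Finset.sum_congr rfl fun j _ => ?_
    rw [eval_smul_of_isHomogeneous hg.pderiv, mul_assoc]
  intro w h1 h2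
  have hloc : LocalRep X f (Projectivization.mk k v hv) F := hF.localRep (by
    rw [ht']
    exact (eval_smul_eq_zero_iff hF.1 t.ne_zero v).not.2 hFv)
  have hw : w ∈ embTangent X (Projectivization.mk k v hv) := by
    rw [mem_embTangent_iff hX]
    intro g hg e he
    rw [ht', hd g e he, h1 g hg e he, mul_zero]
  obtain ⟨i₀, hi₀⟩ := Function.ne_iff.1 hFv
  have hi₀ : eval v (F i₀) ≠ 0 := hi₀
  have := hun F hloc w hw ?_
  · obtain ⟨c, hc⟩ := Submodule.mem_span_singleton.1 this
    exact ⟨c * t, by rw [← hc, ht', smul_smul]⟩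
  · rw [Submodule.mem_span_singleton]
    refine ⟨(t : k) ^ (d - 1) * (∑ j, eval v (pderiv j (F i₀)) * w j) /
      ((t : k) ^ d * eval v (F i₀)), ?_⟩
    ext l
    simp only [jacobian, Matrix.mulVecLin_apply, Matrix.mulVec, dotProduct, Matrix.of_apply,
      Pi.smul_apply, smul_eq_mul]
    rw [ht', hd _ d (hF.1 l), eval_smul_of_isHomogeneous (hF.1 l)]
    have := h2 i₀ l
    have htd : (t : k) ^ d ≠ 0 := pow_ne_zero _ t.ne_zero
    field_simp
    linear_combination -this

end Representatives

section Injectivity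

variable {k : Type} [Field k] {M r : ℕ} {X : Set (Pr k M)} {f : Pr k M → Pr k r}

lemma Represents.mul_add_mul {d₁ d₂ e₁ e₂ d : ℕ}
    {F G : Fin (r + 1) → MvPolynomial (Fin (M + 1)) k} {A B : MvPolynomial (Fin (M + 1)) k}
    (hF : Represents X f d₁ F) (hG : Represents X f d₂ G) (hA : A.IsHomogeneous e₁)
    (hB : B.IsHomogeneous e₂) (h₁ : e₁ + d₁ = d) (h₂ : e₂ + d₂ = d) :
    Represents X f d fun i => A * F i + B * G i := by
  refine ⟨fun i => (h₁ ▸ hA.mul (hF.1 i)).add (h₂ ▸ hB.mul (hG.1 i)), fun v hv hvX i l => ?_⟩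
  rw [map_add, map_add, map_mul, map_mul, map_mul, map_mul]
  linear_combination eval v A * hF.2 v hv hvX i l + eval v B * hG.2 v hv hvX i l

lemma Represents.mul_sub_mul_mem_coneIdeal (hX : X.Nonempty) {d e : ℕ}
    {F G : Fin (r + 1) → MvPolynomial (Fin (M + 1)) k}
    (hF : Represents X f d F) (hG : Represents X f e G) (i l : Fin (r + 1)) :
    G i * F l - G l * F i ∈ coneIdeal X := by
  rw [mem_coneIdeal_iff_of_isHomogeneous hX
    (((hG.1 i).mul (hF.1 l)).sub ((hG.1 l).mul (hF.1 i)))]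
  rintro q hq v hv rfl
  rw [map_sub, map_mul, map_mul, sub_eq_zero]
  exact hG.cross_mul hF hv hv hq hq rfl i l

lemma exists_represents (hmor : IsMorphismOn X f) {v : Fin (M + 1) → k} (hv : v ≠ 0)
    (hvX : Projectivization.mk k v hv ∈ X) :
    ∃ (d : ℕ) (F : Fin (r + 1) → MvPolynomial (Fin (M + 1)) k), Represents X f d F ∧
      (fun i => eval v (F i)) ≠ 0 := by
  obtain ⟨F, hF⟩ := hmor _ hvX
  obtain ⟨d, hd⟩ := hF.represents
  obtain ⟨t, ht⟩ := Projectivization.exists_smul_eq_mk_rep k v hv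
  refine ⟨d, F, hd, fun h => hF.2.1 ?_⟩
  rw [← ht]
  exact (eval_smul_eq_zero_iff hd.1 t.ne_zero v).2 h

/-- Two points of `X` have a common representative of `f`. -/
lemma exists_represents_pair (hmor : IsMorphismOn X f) {v w : Fin (M + 1) → k} (hv : v ≠ 0)
    (hw : w ≠ 0) (hvX : Projectivization.mk k v hv ∈ X) (hwX : Projectivization.mk k w hw ∈ X)
    {i j : Fin (M + 1)} (hij : v i * w j - v j * w i ≠ 0) :
    ∃ (d : ℕ) (F : Fin (r + 1) → MvPolynomial (Fin (M + 1)) k), Represents X f d F ∧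
      (fun i => eval v (F i)) ≠ 0 ∧ (fun i => eval w (F i)) ≠ 0 := by
  obtain ⟨d₁, F, hF, hFv⟩ := exists_represents hmor hv hvX
  obtain ⟨d₂, G, hG, hGw⟩ := exists_represents hmor hw hwX
  have hl : ∀ u : Fin (M + 1) → k,
      (C (u j) * MvPolynomial.X i - C (u i) * MvPolynomial.X j :
        MvPolynomial (Fin (M + 1)) k).IsHomogeneous 1 := fun u =>
    .sub ((isHomogeneous_X k i).C_mul (u j)) ((isHomogeneous_X k j).C_mul (u i))
  refine ⟨d₁ + d₂ + 1, _, hF.mul_add_mul hG ((hl w).pow (d₂ + 1)) ((hl v).pow (d₁ + 1))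
    (by omega) (by omega), fun h => hFv ?_, fun h => hGw ?_⟩
  · funext l
    have := congrFun h l
    simp only [map_add, map_mul, map_pow, map_sub, eval_C, eval_X, Pi.zero_apply] at this ⊢
    rw [mul_comm (v j), sub_self, zero_pow (by omega), zero_mul, add_zero, mul_eq_zero] at this
    refine this.resolve_left (pow_ne_zero _ fun h => hij ?_)
    linear_combination h
  · funext l
    have := congrFun h l
    simp only [map_add, map_mul, map_pow, map_sub, eval_C, eval_X, Pi.zero_apply] at this ⊢
    rw [mul_comm (w j), sub_self, zero_pow (by omega), zero_mul, zero_add, mul_eq_zero] at this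
    refine this.resolve_left (pow_ne_zero _ fun h => hij ?_)
    linear_combination -h

/-- A map which is unramified at a point of a variety is not constant near that point. -/
lemma exists_eval_mul_sub_ne_zero (hX : (coneIdeal X).IsPrime)
    {F : Fin (r + 1) → MvPolynomial (Fin (M + 1)) k} {d : ℕ} (hF : ∀ i, (F i).IsHomogeneous d)
    {v w : Fin (M + 1) → k} (hv : v ∈ cone X) (hw : w ∈ cone X)
    (hun : Immersive (coneIdeal X) F v) {i₁ j₁ : Fin (M + 1)}
    (hij : v i₁ * w j₁ - v j₁ * w i₁ ≠ 0) (i₀ : Fin (r + 1)) (hi₀ : eval v (F i₀) ≠ 0) :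
    ∃ x ∈ cone X, ∃ l, eval v (F i₀) * eval x (F l) - eval v (F l) * eval x (F i₀) ≠ 0 := by
  by_contra! hcon
  obtain ⟨c, hc, hcm⟩ := exists_mul_minor_mem_fibreIdeal (coneIdeal X) F hF
    (fun h => hij (by simp [h])) hun
  have hprod : ∀ x ∈ cone X, ∀ i l, eval v (F i) * eval x (F l) = eval v (F l) * eval x (F i) := by
    intro x hx i l
    refine mul_left_cancel₀ hi₀ ?_
    linear_combination eval v (F i) * hcon x hx l - eval v (F l) * hcon x hx i
  have hvan : ∀ x ∈ cone X, ∀ g ∈ fibreIdeal (coneIdeal X) F, eval (Sum.elim v x) g = 0 := by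
    intro x hx g hg
    refine (show fibreIdeal (coneIdeal X) F ≤ RingHom.ker (eval (Sum.elim v x)) from ?_) hg
    refine sup_le (sup_le ?_ ?_) ?_
    · rw [Ideal.map_le_iff_le_comap]
      intro g hg
      simpa [eval_rename] using mem_coneIdeal.1 hg v hv
    · rw [Ideal.map_le_iff_le_comap]
      intro g hg
      simpa [eval_rename] using mem_coneIdeal.1 hg x hx
    · rw [Ideal.span_le]
      rintro _ ⟨⟨i, l⟩, rfl⟩
      simpa [eval_rename, sub_eq_zero] using hprod x hx i l
  have hmem : aeval (Sum.elim (fun j => C (v j)) MvPolynomial.X) c *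
      (C (v i₁) * MvPolynomial.X j₁ - C (v j₁) * MvPolynomial.X i₁) ∈
      coneIdeal X := by
    rw [mem_coneIdeal]
    intro x hx
    have := hvan x hx _ (hcm i₁ j₁)
    rw [map_mul, eval_elim_eq_right, minor] at this
    simpa using this
  rcases hX.mem_or_mem hmem with h | h
  · exact hc (by rw [eval_elim_eq_right]; exact mem_coneIdeal.1 h v hv)
  · exact hij (by simpa using mem_coneIdeal.1 h w hw)

end Injectivity

section Injectivity

variable {k : Type} [Field k] {M r : ℕ} {X : Set (Pr k M)} {f : Pr k M → Pr k r}

theorem injOn_of_unramified [IsAlgClosed k] {n : ℕ} (hX : IsVariety X) (hdim : HasDim X n)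
    (hmor : IsMorphismOn X f) (hunr : ∀ p ∈ X, UnramifiedAt X f p) (h2n : r < 2 * n) :
    InjOn f X := by
  intro p hp q hq hpq
  by_contra hne
  obtain ⟨v, hv, rfl⟩ : ∃ v hv, p = Projectivization.mk k v hv := ⟨_, p.rep_nonzero, p.mk_rep.symm⟩
  obtain ⟨w, hw, rfl⟩ : ∃ w hw, q = Projectivization.mk k w hw := ⟨_, q.rep_nonzero, q.mk_rep.symm⟩
  have hvc : v ∈ cone X := fun _ => hp
  have hwc : w ∈ cone X := fun _ => hq
  rw [mk_eq_iff_cross_mul] at hne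
  push Not at hne
  obtain ⟨i₁, j₁, hij⟩ := hne
  rw [← sub_ne_zero] at hij
  obtain ⟨d, F, hF, hFv, hFw⟩ := exists_represents_pair hmor hv hw hp hq hij
  have himm : ∀ (x : Fin (M + 1) → k) (hx : x ≠ 0), x ∈ cone X → ∀ (e : ℕ)
      (G : Fin (r + 1) → MvPolynomial (Fin (M + 1)) k), Represents X f e G →
      (fun i => eval x (G i)) ≠ 0 → Immersive (coneIdeal X) G x := fun x hx hxc e G hG hGx =>
    immersive_of_unramifiedAt hX.2.1 hx (hunr _ (hxc hx)) hG hGx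
  have hcross := hF.cross_mul hF hv hw hp hq hpq
  obtain ⟨i₀, hi₀⟩ := Function.ne_iff.1 hFv
  have hi₀ : eval v (F i₀) ≠ 0 := hi₀
  have hi₀' : eval w (F i₀) ≠ 0 := by
    intro h
    refine hFw (funext fun l => ?_)
    have := hcross i₀ l
    rw [h, mul_zero] at this
    exact (mul_eq_zero.1 this).resolve_left hi₀
  have hprime := isPrime_coneIdeal hX
  let J := MvPolynomial.vanishingIdeal k (prodSet (cone X) (cone X))
  have hJ : J.IsPrime := isPrime_vanishingIdeal_prodSet hprime hprime
  have hJmem : ∀ g, g ∈ J ↔ ∀ x ∈ cone X, ∀ y ∈ cone X, eval (Sum.elim x y) g = 0 := by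
    intro g
    rw [mem_vanishingIdeal_eval]
    refine ⟨fun h x hx y hy => h _ (elim_mem_prodSet hx hy), fun h u hu => ?_⟩
    rw [← Sum.elim_comp_inl_inr u]
    exact h _ hu.1 _ hu.2
  let π := Ideal.Quotient.mkₐ k J
  have hπ : ∀ g, π g = 0 ↔ g ∈ J := fun g => Ideal.Quotient.eq_zero_iff_mem
  have hξ : ∀ g : MvPolynomial (Fin (M + 1)) k,
      aeval (fun j => π (MvPolynomial.X (Sum.inl j))) g = π (rename Sum.inl g) := by
    intro g
    rw [rename_eq_aeval, ← AlgHom.comp_apply, comp_aeval]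
  have hη : ∀ g : MvPolynomial (Fin (M + 1)) k,
      aeval (fun j => π (MvPolynomial.X (Sum.inr j))) g = π (rename Sum.inr g) := by
    intro g
    rw [rename_eq_aeval, ← AlgHom.comp_apply, comp_aeval]
  have hξ0 : ∀ g ∈ coneIdeal X, aeval (fun j => π (MvPolynomial.X (Sum.inl j))) g = 0 := by
    intro g hg
    rw [hξ, hπ, hJmem]
    intro x hx y _
    simpa [eval_rename] using mem_coneIdeal.1 hg x hx
  have hη0 : ∀ g ∈ coneIdeal X, aeval (fun j => π (MvPolynomial.X (Sum.inr j))) g = 0 := by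
    intro g hg
    rw [hη, hπ, hJmem]
    intro x _ y hy
    simpa [eval_rename] using mem_coneIdeal.1 hg y hy
  have hlift : ∀ x ∈ cone X, ∀ y ∈ cone X, ∃ φ : (_ ⧸ J) →ₐ[k] k,
      ∀ g, φ (π g) = eval (Sum.elim x y) g := fun x hx y hy =>
    ⟨Ideal.Quotient.liftₐ J (aeval (Sum.elim x y)) fun g hg => by
      rw [aeval_eq_eval]; exact (hJmem g).1 hg x hx y hy, fun g =>
      congrFun (aeval_eq_eval (Sum.elim x y)) g⟩
  obtain ⟨φ, hφ⟩ := hlift v hvc v hvc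
  obtain ⟨φ', hφ'⟩ := hlift v hvc w hwc
  have hgen : Algebra.adjoin k (range (fun j => π (MvPolynomial.X (Sum.inl j))) ∪
      range fun j => π (MvPolynomial.X (Sum.inr j))) = ⊤ := by
    have h1 : (range (fun j => π (MvPolynomial.X (Sum.inl j)))
        ∪ range fun j => π (MvPolynomial.X (Sum.inr j))) =
        π '' range (MvPolynomial.X : Fin (M + 1) ⊕ Fin (M + 1) → _) := by
      rw [← range_comp, ← Set.Sum.elim_range]
      congr 1
      ext (j | j) <;> rfl
    rw [h1, ← AlgHom.map_adjoin, adjoin_range_X, Algebra.map_top, AlgHom.range_eq_top]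
    exact Ideal.Quotient.mkₐ_surjective k J
  have hlin : ∃ a : Fin (M + 1) → k, ∑ i, a i * v i = 1 ∧ ∑ i, a i * w i = 1 := by
    refine ⟨fun i => ((if i = i₁ then w j₁ - v j₁ else 0) + (if i = j₁ then v i₁ - w i₁ else 0)) /
      (v i₁ * w j₁ - v j₁ * w i₁), ?_, ?_⟩ <;>
    · simp only [div_mul_eq_mul_div, ← Finset.sum_div, add_mul, ite_mul, zero_mul,
        Finset.sum_add_distrib, Finset.sum_ite_eq', Finset.mem_univ, if_true]
      rw [div_eq_one_iff_eq hij]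
      ring
  obtain ⟨a, hav, haw⟩ := hlin
  refine false_of_dominant_incidence hgen (le_ringKrullDim_prod_cone hdim) (r := r) (by omega)
    (fun g hg e => homogeneousComponent_mem_coneIdeal hg e) hξ0 hη0 hF.1
    (fun g hg => mem_coneIdeal.1 hg v hvc) (fun g hg => mem_coneIdeal.1 hg w hwc)
    (himm v hv hvc d F hF hFv) (himm w hw hwc d F hF hFw) hav haw hi₀ hi₀'
    (fun i => hcross i₀ i) hij φ φ' ?_ ?_ ?_ ?_ ?_ ?_
  · simp [hφ]
  · simp [hφ]
  · simp [hφ']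
  · simp [hφ']
  · obtain ⟨x, hx, l, hl⟩ := exists_eval_mul_sub_ne_zero hprime hF.1 hvc hwc
      (himm v hv hvc d F hF hFv) hij i₀ hi₀
    refine ⟨l, fun h => hl ?_⟩
    obtain ⟨ψ, hψ⟩ := hlift x hx x hx
    have := congrArg ψ h
    simp only [hξ, map_sub, map_mul, AlgHom.commutes, hψ, map_zero] at this
    simpa [eval_rename] using this
  · intro x hx hxI
    have hxc : x ∈ cone X := (mem_cone_iff hX.1 hX.2.1).2 hxI
    obtain ⟨e, G, hG, hGx⟩ := exists_represents hmor hx (hxc hx)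
    refine ⟨e, G, hG.1, himm x hx hxc e G hG hGx, fun i l => ?_, fun i l => ?_⟩
    · have := hξ0 _ (hF.mul_sub_mul_mem_coneIdeal hX.2.1 hG i l)
      rwa [map_sub, map_mul, map_mul, sub_eq_zero] at this
    · have := hη0 _ (hF.mul_sub_mul_mem_coneIdeal hX.2.1 hG i l)
      rwa [map_sub, map_mul, map_mul, sub_eq_zero] at this

end Injectivity

section Tangent

lemma pderiv_aeval {k σ τ : Type*} [Field k] [Fintype σ] (F : σ → MvPolynomial τ k) (j : τ)
    (g : MvPolynomial σ k) :
    pderiv j (aeval F g) = ∑ i, aeval F (pderiv i g) * pderiv j (F i) := by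
  classical
  induction g using MvPolynomial.induction_on with
  | C c => simp [algHom_C]
  | add g h hg hh => simp only [map_add, hg, hh, add_mul, Finset.sum_add_distrib]
  | mul_X g i hg =>
    have h1 : ∀ l, aeval F (pderiv l (g * X i)) * pderiv j (F l) =
        F i * (aeval F (pderiv l g) * pderiv j (F l)) +
          if l = i then aeval F g * pderiv j (F i) else 0 := by
      intro l
      rw [Derivation.leibniz, pderiv_X, Pi.single_apply, map_add, smul_eq_mul, smul_eq_mul,
        map_mul, map_mul, aeval_X]
      rcases eq_or_ne i l with rfl | h
      · rw [if_pos rfl, if_pos rfl, map_one]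
        ring
      · rw [if_neg h, if_neg h.symm, map_zero]
        ring
    rw [Finset.sum_congr rfl fun l _ => h1 l, Finset.sum_add_distrib, Finset.sum_ite_eq',
      if_pos (Finset.mem_univ i), ← Finset.mul_sum, ← hg, map_mul, aeval_X, Derivation.leibniz,
      smul_eq_mul, smul_eq_mul]
    ring

lemma eval_aeval {k σ τ : Type*} [Field k] (F : σ → MvPolynomial τ k) (x : τ → k)
    (g : MvPolynomial σ k) : eval x (aeval F g) = eval (fun i => eval x (F i)) g := by
  rw [← aeval_eq_eval, ← aeval_eq_eval, ← AlgHom.comp_apply, comp_aeval]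

variable {k : Type} [Field k] {M r : ℕ} {X : Set (Pr k M)} {Y : Set (Pr k r)}
  {f : Pr k M → Pr k r} {g : Pr k r → Pr k M}

lemma mem_embTangent_mk_iff (hX : X.Nonempty) {v : Fin (M + 1) → k} (hv : v ≠ 0)
    {w : Fin (M + 1) → k} : w ∈ embTangent X (Projectivization.mk k v hv) ↔
      ∀ g ∈ coneIdeal X, ∀ e, g.IsHomogeneous e → ∑ j, eval v (pderiv j g) * w j = 0 := by
  obtain ⟨t, ht⟩ := Projectivization.exists_smul_eq_mk_rep k v hv
  rw [mem_embTangent_iff hX]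
  refine forall₄_congr fun g hg e he => ?_
  have : ∑ j, eval (Projectivization.mk k v hv).rep (pderiv j g) * w j =
      (t : k) ^ (e - 1) * ∑ j, eval v (pderiv j g) * w j := by
    rw [Finset.mul_sum, ← ht]
    refine Finset.sum_congr rfl fun j _ => ?_
    rw [← mul_assoc, ← eval_smul_of_isHomogeneous he.pderiv]
    rfl
  rw [this, mul_eq_zero, or_iff_right (pow_ne_zero _ t.ne_zero)]

lemma exists_represents_succ {d : ℕ} {F : Fin (r + 1) → MvPolynomial (Fin (M + 1)) k}
    (hF : Represents X f d F) {v : Fin (M + 1) → k} (hv : v ≠ 0)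
    (hFv : (fun i => eval v (F i)) ≠ 0) :
    ∃ G, Represents X f (d + 1) G ∧ (fun i => eval v (G i)) ≠ 0 := by
  obtain ⟨j, hj⟩ := Function.ne_iff.1 hv
  refine ⟨_, hF.mul_add_mul hF (isHomogeneous_X k j) (isHomogeneous_zero _ k 1) (add_comm _ _)
    (add_comm _ _), fun h => hFv (funext fun i => ?_)⟩
  have := congrFun h i
  rw [Pi.zero_apply] at hj
  simpa [hj] using this

/-- If a morphism has a local inverse, then it is injective on tangent spaces. -/
theorem finrank_embTangent_le [CharZero k] (hfY : MapsTo f X Y) (hgf : ∀ q ∈ X, g (f q) = q)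
    {v : Fin (M + 1) → k} (hv : v ≠ 0) (hvX : Projectivization.mk k v hv ∈ X) {d e : ℕ}
    {F : Fin (r + 1) → MvPolynomial (Fin (M + 1)) k} (hF : Represents X f d F)
    (hFv : (fun i => eval v (F i)) ≠ 0)
    {B : Fin (M + 1) → MvPolynomial (Fin (r + 1)) k} (hB : Represents Y g e B)
    (hBv : (fun i => eval (fun i => eval v (F i)) (B i)) ≠ 0) :
    finrank k (embTangent X (Projectivization.mk k v hv)) ≤
      finrank k (embTangent Y (f (Projectivization.mk k v hv))) := by
  wlog hd : 0 < d generalizing d F e B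
  · obtain ⟨G, hG, hGv⟩ := exists_represents_succ hF hv hFv
    obtain ⟨t, ht⟩ := (Projectivization.mk_eq_mk_iff' ..).1 ((hG.eq_mk hv hvX hGv).symm.trans
      (hF.eq_mk hv hvX hFv))
    have ht0 : t ≠ 0 := by
      rintro rfl
      exact hGv (by rw [← ht, zero_smul])
    refine this hG hGv hB ?_ d.succ_pos
    rw [← ht]
    exact (eval_smul_eq_zero_iff hB.1 ht0 _).not.2 hBv
  wlog he : 0 < e generalizing e B
  · obtain ⟨G, hG, hGv⟩ := exists_represents_succ hB hFv hBv
    exact this hG hGv e.succ_pos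
  have hXne : X.Nonempty := ⟨_, hvX⟩
  have hYne : Y.Nonempty := ⟨_, hfY hvX⟩
  have hfv := hF.eq_mk hv hvX hFv
  have hrel : ∀ i l, aeval F (B i) * MvPolynomial.X l - aeval F (B l) * MvPolynomial.X i ∈
      coneIdeal X := by
    intro i l
    rw [mem_coneIdeal_iff_of_isHomogeneous hXne ((((hB.1 i).aeval F hF.1).mul
      (isHomogeneous_X k l)).sub (((hB.1 l).aeval F hF.1).mul (isHomogeneous_X k i)))]
    rintro q hq x hx rfl
    simp only [map_sub, map_mul, eval_aeval, eval_X]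
    by_cases hFx : (fun i => eval x (F i)) = 0
    · have h0 : ∀ i, eval (fun i => eval x (F i)) (B i) = 0 := by
        intro i
        have := eval_smul_of_isHomogeneous (hB.1 i) (0 : k) 0
        rwa [zero_smul, zero_pow he.ne', zero_mul, ← hFx] at this
      rw [h0, h0, zero_mul, zero_mul, sub_zero]
    · by_cases hBx : (fun i => eval (fun i => eval x (F i)) (B i)) = 0
      · rw [show eval (fun i => eval x (F i)) (B i) = 0 from congrFun hBx i,
          show eval (fun i => eval x (F i)) (B l) = 0 from congrFun hBx l,
          zero_mul, zero_mul, sub_zero]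
      · have h1 := hF.eq_mk hx hq hFx
        have h2 := hB.eq_mk hFx (h1 ▸ hfY hq) hBx
        rw [← h1, hgf _ hq, mk_eq_iff_cross_mul] at h2
        linear_combination -h2 i l
  have hrel' : ∀ i l, (aeval F (B i) * MvPolynomial.X l - aeval F (B l) * MvPolynomial.X i :
      MvPolynomial (Fin (M + 1)) k).IsHomogeneous (d * e + 1) := fun i l =>
    (((hB.1 i).aeval F hF.1).mul (isHomogeneous_X k l)).sub
      (((hB.1 l).aeval F hF.1).mul (isHomogeneous_X k i))
  have hJ : ∀ w i, jacobian F v w i = ∑ j, eval v (pderiv j (F i)) * w j := fun w i => by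
    simp [jacobian, Matrix.mulVec, dotProduct]
  have hchain : ∀ (w : Fin (M + 1) → k) (h : MvPolynomial (Fin (r + 1)) k),
      ∑ j, eval v (pderiv j (aeval F h)) * w j =
        ∑ i, eval (fun i => eval v (F i)) (pderiv i h) * jacobian F v w i := by
    intro w h
    simp only [pderiv_aeval, map_sum, map_mul, eval_aeval, hJ, Finset.mul_sum, Finset.sum_mul]
    rw [Finset.sum_comm]
    simp only [mul_assoc]
  have hmaps : ∀ w ∈ embTangent X (Projectivization.mk k v hv),
      jacobian F v w ∈ embTangent Y (f (Projectivization.mk k v hv)) := by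
    intro w hw
    rw [mem_embTangent_mk_iff hXne] at hw
    rw [hfv, mem_embTangent_mk_iff hYne]
    intro h hh a ha
    rw [← hchain]
    refine hw _ (mem_coneIdeal.2 fun x hx => ?_) _ (ha.aeval F hF.1)
    rw [eval_aeval]
    refine mem_coneIdeal.1 hh _ fun hFx => ?_
    have hx0 : x ≠ 0 := by
      rintro rfl
      refine hFx (funext fun i => ?_)
      have := eval_smul_of_isHomogeneous (hF.1 i) (0 : k) 0
      rwa [zero_smul, zero_pow hd.ne', zero_mul] at this
    rw [← hF.eq_mk hx0 (hx hx0) hFx]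
    exact hfY (hx hx0)
  refine LinearMap.finrank_le_finrank_of_injective (f := (jacobian F v).restrict hmaps) ?_
  rw [← LinearMap.ker_eq_bot, LinearMap.ker_eq_bot']
  rintro ⟨w, hw⟩ hw0
  have hw0 : jacobian F v w = 0 := congrArg Subtype.val hw0
  rw [mem_embTangent_mk_iff hXne] at hw
  set b := fun i => eval (fun i => eval v (F i)) (B i) with hb
  have hbw : ∀ i l, b i * w l = b l * w i := by
    intro i l
    have := hw _ (hrel i l) _ (hrel' i l)
    have h1 := hchain w (B i)
    have h2 := hchain w (B l)
    simp only [hw0, Pi.zero_apply, mul_zero, Finset.sum_const_zero] at h1 h2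
    simp only [map_sub, Derivation.leibniz, smul_eq_mul, map_add, map_mul, eval_X, pderiv_X,
      sub_mul, add_mul, Finset.sum_sub_distrib, Finset.sum_add_distrib, mul_assoc,
      ← Finset.mul_sum, h1, h2, mul_zero, add_zero, eval_aeval] at this
    classical
    simp only [Pi.single_apply, apply_ite (eval v), map_one, map_zero, ite_mul, one_mul, zero_mul,
      Finset.sum_ite_eq, Finset.mem_univ, if_true] at this
    linear_combination this
  have hbv : ∀ i l, b i * v l = b l * v i := by
    intro i l
    have := mem_coneIdeal.1 (hrel i l) v fun _ => hvX
    simp only [map_sub, map_mul, eval_aeval, eval_X] at this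
    linear_combination this
  obtain ⟨j, hj⟩ := Function.ne_iff.1 hv
  obtain ⟨i, hi⟩ := Function.ne_iff.1 hBv
  obtain ⟨l, hl⟩ := Function.ne_iff.1 hFv
  rw [Pi.zero_apply] at hj hi hl
  have hwv : w = (w i / v i) • v := by
    have hvi : v i ≠ 0 := fun h =>
      mul_ne_zero hi hj ((hbv i j).trans (by rw [h, mul_zero]))
    funext l
    rw [Pi.smul_apply, smul_eq_mul, div_mul_eq_mul_div, eq_div_iff hvi]
    refine mul_left_cancel₀ hi ?_
    linear_combination v i * hbw i l - w i * hbv i l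
  have heuler : jacobian F v v l = d * eval v (F l) := by
    have := congrArg (eval v) (hF.1 l).sum_X_mul_pderiv
    simp only [map_sum, map_mul, eval_X, nsmul_eq_mul, map_natCast] at this
    rw [hJ, ← this]
    exact Finset.sum_congr rfl fun _ _ => mul_comm _ _
  have h0 := congrFun hw0 l
  rw [hwv, map_smul, Pi.smul_apply, heuler, smul_eq_mul, Pi.zero_apply, mul_eq_zero] at h0
  have := h0.resolve_right (mul_ne_zero (Nat.cast_ne_zero.2 hd.ne') hl)
  rw [this, zero_smul] at hwv
  exact Subtype.ext hwv

end Tangent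

section Elimination

open scoped Pointwise in
/-- A graded version of Nakayama's lemma, for a family of homogeneous ideals. -/
theorem exists_mul_sub_mul_mem_of_specialization {A K σ : Type*} [CommRing A] [CommRing K]
    [Finite σ] {ε : A →+* K} (hε : Function.Surjective ε) {J : Ideal (MvPolynomial σ A)}
    (hJ : ∀ g ∈ J, ∀ d, homogeneousComponent d g ∈ J) {N : ℕ} {H : MvPolynomial σ A}
    (hH : H.IsHomogeneous N)
    (h : ∀ α : σ →₀ ℕ, α.degree = N → ∃ c : A,
      monomial α 1 - C (ε c) * MvPolynomial.map ε H ∈ J.map (MvPolynomial.map ε)) :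
    ∃ s : A, ε s = 1 ∧ ∀ Q : MvPolynomial σ A, Q.IsHomogeneous N → ∃ c : A,
      C s * Q - C c * H ∈ J := by
  have hdecomp : ∀ Q : MvPolynomial σ A, ∀ (I : Ideal A) (P : Submodule A (MvPolynomial σ A)),
      (∀ α, coeff α Q ∈ I) → (∀ α : σ →₀ ℕ, α.degree = N → monomial α 1 ∈ P) →
      homogeneousComponent N Q ∈ I • P := by
    intro Q I P hQ hP
    rw [homogeneousComponent_apply]
    refine Submodule.sum_mem _ fun α hα => ?_
    rw [← mul_one (coeff α Q), ← smul_eq_mul, ← smul_monomial]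
    exact Submodule.smul_mem_smul (hQ α) (hP α (Finset.mem_filter.1 hα).2)
  have hle : homogeneousSubmodule σ A N ≤ (J.restrictScalars A ⊔ Submodule.span A {H}) ⊔
      RingHom.ker ε • homogeneousSubmodule σ A N := by
    intro Q hQ
    rw [← homogeneousComponent_eq_self hQ]
    refine Submodule.smul_le_right (hdecomp Q ⊤ _ (fun _ => trivial) fun α hα => ?_)
    obtain ⟨c, hc⟩ := h α hα
    obtain ⟨g, hg, hgc⟩ :=
      (Ideal.mem_map_iff_of_surjective _ (MvPolynomial.map_surjective ε hε)).1 hc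
    have hker : monomial α 1 - C c * H - g
        ∈ RingHom.ker (MvPolynomial.map ε : MvPolynomial σ A →+* _) := by
      rw [RingHom.mem_ker, map_sub, hgc, map_sub, map_mul, MvPolynomial.map_C, map_monomial,
        map_one,
        sub_self]
    have hα' : (monomial α 1 : MvPolynomial σ A).IsHomogeneous N := isHomogeneous_monomial 1 hα
    have hN := congrArg (homogeneousComponent N)
      (add_sub_cancel g (monomial α 1 - C c * H)).symm
    rw [map_sub, map_add, homogeneousComponent_eq_self hα', homogeneousComponent_C_mul,
      homogeneousComponent_eq_self hH, sub_eq_iff_eq_add] at hN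
    rw [hN, add_right_comm]
    refine Submodule.add_mem_sup (Submodule.add_mem_sup (hJ g hg N) ?_) (hdecomp _ _ _ ?_ ?_)
    · rw [← smul_eq_C_mul]
      exact Submodule.smul_mem _ _ (Submodule.mem_span_singleton_self H)
    · intro β
      rw [ker_map, mem_map_C_iff] at hker
      exact hker β
    · exact fun β hβ => isHomogeneous_monomial 1 hβ
  obtain ⟨s, hs, hsP⟩ := Submodule.exists_sub_one_mem_and_smul_le_of_fg_of_le_sup
    (homogeneousSubmodule_fg σ A N) le_rfl hle
  refine ⟨s, by rwa [RingHom.mem_ker, map_sub, map_one, sub_eq_zero] at hs, fun Q hQ => ?_⟩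
  obtain ⟨g, hg, u, hu, hgu⟩ := Submodule.mem_sup.1
    (hsP (Submodule.smul_mem_pointwise_smul Q s _ hQ))
  obtain ⟨c, rfl⟩ := Submodule.mem_span_singleton.1 hu
  refine ⟨c, ?_⟩
  rw [← smul_eq_C_mul, ← smul_eq_C_mul, ← hgu, add_sub_cancel_right]
  exact hg

/-- Replacing variables one at a time, modulo an ideal. -/
lemma sub_algHom_mem {k S : Type*} [CommRing k] [CommRing S] [Algebra k S] {K m L : Ideal S}
    {N : ℕ} (h : m ^ N * L ≤ K) (φ : S →ₐ[k] S) (hφ : ∀ x, x - φ x ∈ L)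
    (hφm : ∀ x ∈ m ^ N, φ x ∈ m ^ N) : ∀ x ∈ m ^ N * m ^ N, x - φ x ∈ K := by
  intro x hx
  induction hx using Submodule.mul_induction_on' with
  | mem_mul_mem a ha b hb =>
    rw [map_mul, show a * b - φ a * φ b = a * (b - φ b) + φ b * (a - φ a) by ring]
    exact add_mem (h (Ideal.mul_mem_mul ha (hφ b))) (h (Ideal.mul_mem_mul (hφm b hb) (hφ a)))
  | add a _ b _ ha hb =>
    rw [map_add, add_sub_add_comm]
    exact add_mem ha hb

/-- An ideal of a polynomial ring whose only possible zero is the origin contains a power of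
the ideal of the origin. -/
lemma exists_idealOfVars_pow_le {k σ : Type*} [Field k] [IsAlgClosed k] [Finite σ]
    {I : Ideal (MvPolynomial σ k)} (h : ∀ x : σ → k, (∀ g ∈ I, eval x g = 0) → x = 0) :
    ∃ N, idealOfVars σ k ^ N ≤ I := by
  refine Ideal.exists_pow_le_of_le_radical_of_fg ?_ (IsNoetherian.noetherian _)
  rw [idealOfVars, Ideal.span_le]
  rintro _ ⟨i, rfl⟩
  rw [SetLike.mem_coe, ← vanishingIdeal_zeroLocus_eq_radical (K := k), mem_vanishingIdeal_iff]
  intro x hx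
  rw [mem_zeroLocus_iff] at hx
  rw [h x fun g hg => by rw [← aeval_eq_eval]; exact hx g hg]
  simp

end Elimination

section Graph

variable {k : Type} [Field k] {M r : ℕ} {X : Set (Pr k M)} {f : Pr k M → Pr k r}

/-- Bihomogeneous equations of the graph of `f`, as polynomials in the coordinates of the source
with coefficients in the coordinate ring of the target. -/
noncomputable def graphIdeal (X : Set (Pr k M)) (f : Pr k M → Pr k r) :
    Ideal (MvPolynomial (Fin (M + 1)) (MvPolynomial (Fin (r + 1)) k)) :=
  Ideal.span ({g | ∃ e, ∃ h ∈ coneIdeal X, h.IsHomogeneous e ∧ MvPolynomial.map C h = g} ∪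
    {g | ∃ d F, Represents X f d F ∧ ∃ i j, MvPolynomial.map C (F i) * C (MvPolynomial.X j) -
      MvPolynomial.map C (F j) * C (MvPolynomial.X i) = g})

lemma homogeneousComponent_mem_graphIdeal
    {g : MvPolynomial (Fin (M + 1)) (MvPolynomial (Fin (r + 1)) k)} (hg : g ∈ graphIdeal X f)
    (d : ℕ) : homogeneousComponent d g ∈ graphIdeal X f := by
  let _ : GradedRing (homogeneousSubmodule (Fin (M + 1)) (MvPolynomial (Fin (r + 1)) k)) :=
    MvPolynomial.gradedAlgebra
  refine homogeneousComponent_mem_of_mem (Ideal.homogeneous_span _ _ ?_) hg d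
  rintro _ (⟨e, h, -, hh, rfl⟩ | ⟨d, F, hF, i, j, rfl⟩)
  · exact ⟨e, hh.map _⟩
  · have h1 : ∀ i j, (MvPolynomial.map C (F i) * C (MvPolynomial.X j) :
        MvPolynomial (Fin (M + 1)) (MvPolynomial (Fin (r + 1)) k)).IsHomogeneous d := fun i j =>
      ((hF.1 i).map C).mul (isHomogeneous_C _ _)
    exact ⟨d, (h1 i j).sub (h1 j i)⟩

lemma map_mem_map_graphIdeal [Infinite k] {h : MvPolynomial (Fin (M + 1)) k}
    (hh : h ∈ coneIdeal X) (y : Fin (r + 1) → k) :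
    h ∈ (graphIdeal X f).map (MvPolynomial.map (eval y)) := by
  have h1 : (eval y).comp (C : k →+* MvPolynomial (Fin (r + 1)) k) = RingHom.id k := by
    ext; simp
  rw [← sum_homogeneousComponent h]
  refine sum_mem fun d _ => ?_
  have h2 := Ideal.mem_map_of_mem (MvPolynomial.map (σ := Fin (M + 1)) (eval y))
    (Ideal.subset_span (Or.inl ⟨d, _, homogeneousComponent_mem_coneIdeal hh d,
      homogeneousComponent_isHomogeneous d h, rfl⟩) : _ ∈ graphIdeal X f)
  rwa [MvPolynomial.map_map, h1, MvPolynomial.map_id] at h2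

lemma Represents.mem_map_graphIdeal {d : ℕ} {F : Fin (r + 1) → MvPolynomial (Fin (M + 1)) k}
    (hF : Represents X f d F) (y : Fin (r + 1) → k) (i j : Fin (r + 1)) :
    F i * C (y j) - F j * C (y i) ∈ (graphIdeal X f).map (MvPolynomial.map (eval y)) := by
  have h1 : (eval y).comp (C : k →+* MvPolynomial (Fin (r + 1)) k) = RingHom.id k := by
    ext; simp
  have h2 := Ideal.mem_map_of_mem (MvPolynomial.map (σ := Fin (M + 1)) (eval y))
    (Ideal.subset_span (Or.inr ⟨d, F, hF, i, j, rfl⟩) : _ ∈ graphIdeal X f)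
  rw [← graphIdeal] at h2
  simpa only [map_sub, map_mul, MvPolynomial.map_map, h1, MvPolynomial.map_id, map_C, eval_X]
    using h2

lemma eval_graphIdeal {x : Fin (M + 1) → k} (hx : x ≠ 0) (hxX : Projectivization.mk k x hx ∈ X)
    {y : Fin (r + 1) → k} (hy : ∀ i l, y i * (f (Projectivization.mk k x hx)).rep l =
      y l * (f (Projectivization.mk k x hx)).rep i)
    {g : MvPolynomial (Fin (M + 1)) (MvPolynomial (Fin (r + 1)) k)} (hg : g ∈ graphIdeal X f) :
    eval x (MvPolynomial.map (eval y) g) = 0 := by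
  have h1 : (eval y).comp (C : k →+* MvPolynomial (Fin (r + 1)) k) = RingHom.id k := by
    ext; simp
  have h2 : graphIdeal X f ≤ RingHom.ker ((eval x).comp (MvPolynomial.map (eval y))) := by
    refine Ideal.span_le.2 ?_
    rintro _ (⟨e, h, hh, -, rfl⟩ | ⟨d, F, hF, i, j, rfl⟩)
    · rw [SetLike.mem_coe, RingHom.mem_ker, RingHom.comp_apply, MvPolynomial.map_map, h1,
        MvPolynomial.map_id]
      exact mem_coneIdeal.1 hh x fun _ => hxX
    · simp only [SetLike.mem_coe, RingHom.mem_ker, RingHom.comp_apply, map_sub, map_mul,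
        MvPolynomial.map_map, h1, MvPolynomial.map_id, map_C, eval_X, eval_C]
      have h3 := hF.2 x hx hxX
      obtain ⟨l, hl⟩ := Function.ne_iff.1 (f (Projectivization.mk k x hx)).rep_nonzero
      rw [Pi.zero_apply] at hl
      generalize (f (Projectivization.mk k x hx)).rep = z at *
      refine (mul_eq_zero.1 ?_).resolve_left (mul_ne_zero hl hl)
      linear_combination (y j * z l) * h3 i l - (y i * z l) * h3 j l +
        eval x (F l) * z i * hy j l - eval x (F l) * z j * hy i l
  exact h2 hg

lemma exists_of_mem_cone_image (hX : X.Nonempty) {y : Fin (r + 1) → k} (hy : y ∈ cone (f '' X)) :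
    ∃ (x : Fin (M + 1) → k) (hx : x ≠ 0), Projectivization.mk k x hx ∈ X ∧
      ∀ i l, y i * (f (Projectivization.mk k x hx)).rep l =
        y l * (f (Projectivization.mk k x hx)).rep i := by
  by_cases h0 : y = 0
  · obtain ⟨p, hp⟩ := hX
    refine ⟨p.rep, p.rep_nonzero, by rwa [Projectivization.mk_rep], fun i l => ?_⟩
    simp [h0]
  · obtain ⟨p, hp, hpy⟩ := hy h0
    refine ⟨p.rep, p.rep_nonzero, by rwa [Projectivization.mk_rep], ?_⟩
    rw [← mk_eq_iff_cross_mul h0 (Projectivization.rep_nonzero _), Projectivization.mk_rep,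
      Projectivization.mk_rep, hpy]

lemma of_eval_map_graphIdeal_eq_zero [Infinite k] (hX : IsAlgSet X) (hne : X.Nonempty)
    (hmor : IsMorphismOn X f) {y : Fin (r + 1) → k} (hy : y ≠ 0) {x : Fin (M + 1) → k} (hx : x ≠ 0)
    (h : ∀ g ∈ (graphIdeal X f).map (MvPolynomial.map (eval y)), eval x g = 0) :
    Projectivization.mk k x hx ∈ X ∧
      f (Projectivization.mk k x hx) = Projectivization.mk k y hy := by
  have hxX : Projectivization.mk k x hx ∈ X :=
    (mem_cone_iff hX hne).2 (fun g hg => h g (map_mem_map_graphIdeal hg y)) hx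
  obtain ⟨d, F, hF, hFx⟩ := exists_represents hmor hx hxX
  refine ⟨hxX, (hF.eq_mk hx hxX hFx).trans ((mk_eq_iff_cross_mul _ _).2 fun i l => ?_)⟩
  have h1 := h _ (hF.mem_map_graphIdeal y i l)
  rw [map_sub, map_mul, map_mul, eval_C, eval_C] at h1
  linear_combination h1

lemma isAlgSet_of_forall_notMem [Infinite k] {N : ℕ} {Y : Set (Pr k N)} (hne : Y.Nonempty)
    (h : ∀ (y : Fin (N + 1) → k) (hy : y ≠ 0), Projectivization.mk k y hy ∉ Y →
      ∃ g ∈ coneIdeal Y, eval y g ≠ 0) : IsAlgSet Y := by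
  refine ⟨{g | g ∈ coneIdeal Y ∧ ∃ d, g.IsHomogeneous d}, fun g hg => hg.2, ?_⟩
  ext q
  simp only [Set.mem_ofPred_eq, and_imp, forall_exists_index]
  refine ⟨fun hq g hg d hd => (mem_coneIdeal_iff_of_isHomogeneous hne hd).1 hg q hq, fun hq => ?_⟩
  by_contra hqY
  obtain ⟨g, hg, hgq⟩ := h q.rep q.rep_nonzero (by rwa [Projectivization.mk_rep])
  refine hgq ?_
  rw [← sum_homogeneousComponent g, map_sum]
  exact Finset.sum_eq_zero fun d _ => hq _ (homogeneousComponent_mem_coneIdeal hg d) d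
    (homogeneousComponent_isHomogeneous d g) q.rep q.rep_nonzero (Projectivization.mk_rep q)

lemma monomial_mem_of_idealOfVars_pow_le {K σ : Type*} [CommRing K] {I : Ideal (MvPolynomial σ K)}
    {N : ℕ} (h : idealOfVars σ K ^ N ≤ I) {α : σ →₀ ℕ} (hα : α.degree = N) :
    monomial α 1 ∈ I := by
  classical
  refine h ((mem_pow_idealOfVars_iff' _ _).2 fun β hβ => ?_)
  rw [coeff_monomial, if_neg]
  rintro rfl
  omega

theorem isAlgSet_image [IsAlgClosed k] (hX : IsAlgSet X) (hne : X.Nonempty)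
    (hmor : IsMorphismOn X f) : IsAlgSet (f '' X) := by
  have : Infinite k := IsAlgClosed.instInfinite
  refine isAlgSet_of_forall_notMem (hne.image f) fun y hy hyY => ?_
  obtain ⟨N, hN⟩ := exists_idealOfVars_pow_le
    (I := (graphIdeal X f).map (MvPolynomial.map (eval y))) fun x hx => by
      by_contra h0
      obtain ⟨h1, h2⟩ := of_eval_map_graphIdeal_eq_zero hX hne hmor hy h0 hx
      exact hyY ⟨_, h1, h2⟩
  obtain ⟨s, hs, hsQ⟩ := exists_mul_sub_mul_mem_of_specialization (ε := eval y)
    (fun c => ⟨C c, eval_C c⟩) (fun g hg d => homogeneousComponent_mem_graphIdeal hg d) (N := N)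
    (H := 0) (isHomogeneous_zero _ _ _) fun α hα => ⟨0, by
      simpa using monomial_mem_of_idealOfVars_pow_le hN hα⟩
  refine ⟨s, mem_coneIdeal.2 fun z hz => ?_, by rw [hs]; exact one_ne_zero⟩
  obtain ⟨x, hx, hxX, hzx⟩ := exists_of_mem_cone_image hne hz
  obtain ⟨j, hj⟩ := Function.ne_iff.1 hx
  obtain ⟨c, hc⟩ := hsQ (MvPolynomial.X j ^ N) (by simpa using (isHomogeneous_X _ j).pow N)
  have := eval_graphIdeal hx hxX hzx hc
  simp only [mul_zero, sub_zero, map_mul, map_pow, map_C, map_X, eval_C, eval_X] at this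
  exact (mul_eq_zero.1 this).resolve_right (pow_ne_zero _ hj)

end Graph

lemma homogeneousComponent_map {σ R S : Type*} [CommSemiring R] [CommSemiring S] (φ : R →+* S)
    (d : ℕ) (g : MvPolynomial σ R) :
    homogeneousComponent d (MvPolynomial.map φ g) =
      MvPolynomial.map φ (homogeneousComponent d g) := by
  classical
  ext m
  rw [coeff_homogeneousComponent, coeff_map, coeff_map, coeff_homogeneousComponent, apply_ite φ,
    map_zero]

open scoped Pointwise in
lemma exists_forall_monomial_sub_mem {k σ : Type*} [Field k] [Fintype σ]
    {J : Ideal (MvPolynomial σ k)} (hJ : ∀ g ∈ J, ∀ d, homogeneousComponent d g ∈ J)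
    {v : σ → k} {c : MvPolynomial σ k} (hcv : eval v c ≠ 0)
    (hc : ∀ i j, c * (C (v i) * X j - C (v j) * X i) ∈ J)
    (hpow : ∀ (e : ℕ) (b : MvPolynomial σ k), b.IsHomogeneous e → eval v b ≠ 0 →
      ∃ N, idealOfVars σ k ^ N ≤ J ⊔ Ideal.span {b})
    {a : σ → k} (ha : ∑ i, a i * v i = 1) :
    ∃ N, ∀ α : σ →₀ ℕ, α.degree = N + 1 → ∃ t : k,
      monomial α 1 - C t * (∑ i, C (a i) * X i) ^ (N + 1) ∈ J := by
  set h : MvPolynomial σ k := ∑ i, C (a i) * X i with hh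
  obtain ⟨e, he⟩ : ∃ e, eval v (homogeneousComponent e c) ≠ 0 := by
    by_contra! hcon
    refine hcv ?_
    rw [← sum_homogeneousComponent c, map_sum]
    exact Finset.sum_eq_zero fun d _ => hcon d
  set b := homogeneousComponent e c with hb
  have hb1 : ∀ i j, b * (C (v i) * X j - C (v j) * X i) ∈ J := by
    intro i j
    rw [hb, ← homogeneousComponent_mul_of_isHomogeneous (e := 1)]
    · exact hJ _ (hc i j) _
    · exact ((isHomogeneous_X k j).C_mul _).sub ((isHomogeneous_X k i).C_mul _)
  have hb2 : ∀ j, b * (X j - C (v j) * h) ∈ J := by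
    intro j
    have : b * (X j - C (v j) * h) = ∑ i, C (a i) * (b * (C (v i) * X j - C (v j) * X i)) := by
      have h1 : (X j : MvPolynomial σ k) = ∑ i, C (a i * v i) * X j := by
        rw [← Finset.sum_mul, ← map_sum, ha, C_1, one_mul]
      conv_lhs => rw [h1, hh, Finset.mul_sum, ← Finset.sum_sub_distrib, Finset.mul_sum]
      refine Finset.sum_congr rfl fun i _ => ?_
      rw [C_mul]
      ring
    rw [this]
    exact sum_mem fun i _ => J.mul_mem_left _ (hb1 i j)
  obtain ⟨N, hN⟩ := hpow e b (homogeneousComponent_isHomogeneous e c) he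
  set L : Ideal (MvPolynomial σ k) := Ideal.span (range fun j => X j - C (v j) * h) with hL
  have hNL : idealOfVars σ k ^ (N + 1) * L ≤ J := by
    refine (Ideal.mul_mono_left ((Ideal.pow_le_pow_right N.le_succ).trans hN)).trans ?_
    rw [Ideal.sup_mul]
    refine sup_le Ideal.mul_le_left ?_
    rw [hL, Ideal.span_mul_span', Ideal.span_le]
    rintro _ ⟨_, rfl, _, ⟨j, rfl⟩, rfl⟩
    exact hb2 j
  set φ : MvPolynomial σ k →ₐ[k] MvPolynomial σ k := aeval fun j => C (v j) * h with hφ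
  have hφL : ∀ x, x - φ x ∈ L := by
    intro x
    rw [← Ideal.Quotient.eq]
    have : Ideal.Quotient.mkₐ k L = (Ideal.Quotient.mkₐ k L).comp φ := by
      ext j
      rw [AlgHom.comp_apply, hφ, aeval_X, Ideal.Quotient.mkₐ_eq_mk, Ideal.Quotient.eq]
      exact Ideal.subset_span ⟨j, rfl⟩
    exact DFunLike.congr_fun this x
  have hmem : h ∈ idealOfVars σ k :=
    sum_mem fun i _ => Ideal.mul_mem_left _ _ (Ideal.subset_span ⟨i, rfl⟩)
  have hφm : ∀ x ∈ idealOfVars σ k ^ (N + 1), φ x ∈ idealOfVars σ k ^ (N + 1) := by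
    intro x hx
    have h1 : (idealOfVars σ k).map φ ≤ idealOfVars σ k := by
      rw [idealOfVars, Ideal.map_span, Ideal.span_le]
      rintro _ ⟨_, ⟨j, rfl⟩, rfl⟩
      rw [hφ, aeval_X]
      exact Ideal.mul_mem_left _ _ hmem
    refine Ideal.pow_right_mono h1 (N + 1) ?_
    rw [← Ideal.map_pow]
    exact Ideal.mem_map_of_mem _ hx
  refine ⟨N + (N + 1), fun α hα => ⟨α.prod fun i n => v i ^ n, ?_⟩⟩
  have h1 := sub_algHom_mem hNL φ hφL hφm (monomial α 1) (by
    rw [← pow_add]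
    exact monomial_mem_of_idealOfVars_pow_le le_rfl (by omega))
  convert h1 using 2
  rw [hφ, aeval_monomial, map_one, one_mul, Finsupp.prod, Finsupp.prod, map_prod]
  simp only [mul_pow, map_pow]
  rw [Finset.prod_mul_distrib, Finset.prod_pow_eq_pow_sum, ← Finsupp.degree_apply, hα]

section Graph

variable {k : Type} [Field k] {M r : ℕ} {X : Set (Pr k M)} {f : Pr k M → Pr k r}

lemma homogeneousComponent_mem_map_graphIdeal {y : Fin (r + 1) → k}
    {g : MvPolynomial (Fin (M + 1)) k} (hg : g ∈ (graphIdeal X f).map (MvPolynomial.map (eval y)))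
    (d : ℕ) : homogeneousComponent d g ∈ (graphIdeal X f).map (MvPolynomial.map (eval y)) := by
  obtain ⟨g, hg', rfl⟩ := (Ideal.mem_map_iff_of_surjective _
    (map_surjective _ fun c => ⟨C c, eval_C c⟩)).1 hg
  rw [homogeneousComponent_map]
  exact Ideal.mem_map_of_mem _ (homogeneousComponent_mem_graphIdeal hg' d)

lemma fibreIdeal_le_comap_map_graphIdeal [Infinite k] {d : ℕ}
    {F : Fin (r + 1) → MvPolynomial (Fin (M + 1)) k} (hF : Represents X f d F)
    {v : Fin (M + 1) → k} (hv : v ∈ cone X) :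
    fibreIdeal (coneIdeal X) F ≤ ((graphIdeal X f).map
      (MvPolynomial.map (eval fun i => eval v (F i)))).comap
        (aeval (Sum.elim (fun j => C (v j)) MvPolynomial.X) :
          MvPolynomial (Fin (M + 1) ⊕ Fin (M + 1)) k →ₐ[k] MvPolynomial (Fin (M + 1)) k) := by
  have hl : ∀ g : MvPolynomial (Fin (M + 1)) k,
      aeval (Sum.elim (fun j => C (v j)) MvPolynomial.X :
        Fin (M + 1) ⊕ Fin (M + 1) → MvPolynomial (Fin (M + 1)) k) (rename Sum.inl g) =
      C (eval v g) := by
    intro g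
    rw [aeval_rename, Sum.elim_comp_inl]
    induction g using MvPolynomial.induction_on with
    | C c => simp [algHom_C]
    | add p q hp hq => simp only [map_add, hp, hq]
    | mul_X p i hp => simp only [map_mul, hp, aeval_X, eval_X]
  have hr : ∀ g : MvPolynomial (Fin (M + 1)) k,
      aeval (Sum.elim (fun j => C (v j)) MvPolynomial.X :
        Fin (M + 1) ⊕ Fin (M + 1) → MvPolynomial (Fin (M + 1)) k) (rename Sum.inr g) = g := by
    intro g
    rw [aeval_rename, Sum.elim_comp_inr, aeval_X_left_apply]
  refine sup_le (sup_le ?_ ?_) (Ideal.span_le.2 ?_)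
  · refine Ideal.map_le_iff_le_comap.2 fun g hg => ?_
    rw [Ideal.mem_comap, Ideal.mem_comap, hl, mem_coneIdeal.1 hg v hv, C_0]
    exact zero_mem _
  · refine Ideal.map_le_iff_le_comap.2 fun g hg => ?_
    rw [Ideal.mem_comap, Ideal.mem_comap, hr]
    exact map_mem_map_graphIdeal hg _
  · rintro _ ⟨⟨i, l⟩, rfl⟩
    rw [SetLike.mem_coe, Ideal.mem_comap, map_sub, map_mul, map_mul, hl, hl, hr, hr,
      mul_comm, mul_comm (C (eval v (F l)))]
    exact hF.mem_map_graphIdeal _ l i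

lemma exists_inverse_of_immersive [IsAlgClosed k] (hX : IsAlgSet X) (hne : X.Nonempty)
    (hmor : IsMorphismOn X f) (hinj : InjOn f X) {v : Fin (M + 1) → k} (hv : v ≠ 0)
    (hvX : Projectivization.mk k v hv ∈ X) {d : ℕ}
    {F : Fin (r + 1) → MvPolynomial (Fin (M + 1)) k} (hF : Represents X f d F)
    (hFv : (fun i => eval v (F i)) ≠ 0) (hun : Immersive (coneIdeal X) F v) :
    ∃ B : Fin (M + 1) → MvPolynomial (Fin (r + 1)) k,
      (fun j => eval (fun i => eval v (F i)) (B j)) ≠ 0 ∧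
      ∀ (x : Fin (M + 1) → k) (hx : x ≠ 0), Projectivization.mk k x hx ∈ X →
        ∀ z : Fin (r + 1) → k, (∀ i l, z i * (f (Projectivization.mk k x hx)).rep l =
          z l * (f (Projectivization.mk k x hx)).rep i) →
          ∀ i l, eval z (B i) * x l = eval z (B l) * x i := by
  have : Infinite k := IsAlgClosed.instInfinite
  obtain ⟨j₀, hj₀⟩ := Function.ne_iff.1 hv
  rw [Pi.zero_apply] at hj₀
  obtain ⟨a, ha⟩ : ∃ a : Fin (M + 1) → k, ∑ i, a i * v i = 1 :=
    ⟨Pi.single j₀ (v j₀)⁻¹, by simp [Pi.single_apply, hj₀]⟩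
  obtain ⟨c, hc, hcm⟩ := exists_mul_minor_mem_fibreIdeal (coneIdeal X) F hF.1 hv hun
  rw [eval_elim_eq_right] at hc
  set y : Fin (r + 1) → k := fun i => eval v (F i) with hy
  obtain ⟨N, hN⟩ := exists_forall_monomial_sub_mem
    (J := (graphIdeal X f).map (MvPolynomial.map (eval y)))
    (fun g hg d => homogeneousComponent_mem_map_graphIdeal hg d) hc (fun i j => by
      have := fibreIdeal_le_comap_map_graphIdeal hF (fun _ => hvX) (hcm i j)
      rw [Ideal.mem_comap, map_mul, minor, map_sub, map_mul, map_mul] at this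
      simpa only [aeval_X, Sum.elim_inl, Sum.elim_inr] using this) (fun e b hb hbv => by
      refine exists_idealOfVars_pow_le fun x hx => ?_
      by_contra h0
      obtain ⟨h1, h2⟩ := of_eval_map_graphIdeal_eq_zero hX hne hmor hFv h0
        fun g hg => hx g (Ideal.mem_sup_left hg)
      rw [← hF.eq_mk hv hvX hFv] at h2
      obtain ⟨t, rfl⟩ := (Projectivization.mk_eq_mk_iff' ..).1 (hinj h1 hvX h2)
      have h3 := hx b (Ideal.mem_sup_right (Ideal.mem_span_singleton_self b))
      rw [eval_smul_of_isHomogeneous hb, mul_eq_zero] at h3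
      have ht : t ≠ 0 := by
        rintro rfl
        exact h0 (zero_smul _ _)
      exact h3.elim (pow_ne_zero _ ht) hbv) ha
  set ℓ : MvPolynomial (Fin (M + 1)) (MvPolynomial (Fin (r + 1)) k) :=
    ∑ i, C (C (a i)) * MvPolynomial.X i with hℓ
  have hℓh : ℓ.IsHomogeneous 1 :=
    IsHomogeneous.sum _ _ _ fun i _ => (isHomogeneous_X _ i).C_mul _
  have hℓmap : ∀ z : Fin (r + 1) → k, MvPolynomial.map (eval z) ℓ =
      ∑ i, C (a i) * MvPolynomial.X i := by
    intro z
    simp only [hℓ, map_sum, map_mul, map_C, map_X, eval_C]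
  obtain ⟨s, hs, hsQ⟩ := exists_mul_sub_mul_mem_of_specialization (ε := eval y)
    (fun c => ⟨C c, eval_C c⟩) (fun g hg d => homogeneousComponent_mem_graphIdeal hg d)
    (N := N + 1) (H := ℓ ^ (N + 1)) (by simpa using hℓh.pow (N + 1)) fun α hα => by
      obtain ⟨t, ht⟩ := hN α hα
      exact ⟨C t, by rwa [eval_C, map_pow, hℓmap]⟩
  choose b hb using fun j => hsQ (MvPolynomial.X j * ℓ ^ N) (by
    simpa [add_comm] using (isHomogeneous_X _ j).mul (hℓh.pow N))
  choose b' hb' using fun j => hsQ (MvPolynomial.X j ^ (N + 1)) (by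
    simpa using (isHomogeneous_X _ j).pow (N + 1))
  have key : ∀ (x : Fin (M + 1) → k) (hx : x ≠ 0), Projectivization.mk k x hx ∈ X →
      ∀ z : Fin (r + 1) → k, (∀ i l, z i * (f (Projectivization.mk k x hx)).rep l =
        z l * (f (Projectivization.mk k x hx)).rep i) →
        eval z s = 0 ∨ ∑ i, a i * x i ≠ 0 ∧
          ∀ j, eval z s * x j = eval z (b j) * ∑ i, a i * x i := by
    intro x hx hxX z hz
    have h1 := fun j => eval_graphIdeal hx hxX hz (hb j)
    have h2 := fun j => eval_graphIdeal hx hxX hz (hb' j)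
    simp only [map_sub, map_mul, map_pow, hℓmap, map_C, map_X, eval_C, eval_X, map_sum] at h1 h2
    generalize ∑ i, a i * x i = h at *
    obtain ⟨j, hj⟩ := Function.ne_iff.1 hx
    by_cases h0 : h = 0
    · left
      have := h2 j
      rw [h0, zero_pow N.succ_ne_zero, mul_zero, sub_zero] at this
      exact (mul_eq_zero.1 this).resolve_right (pow_ne_zero _ hj)
    · refine Or.inr ⟨h0, fun j => mul_right_cancel₀ (pow_ne_zero N h0) ?_⟩
      linear_combination h1 j
  refine ⟨fun j => s * b j, fun h0 => hj₀ ?_, fun x hx hxX z hz i l => ?_⟩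
  · rcases key v hv hvX y (hF.2 v hv hvX) with h1 | ⟨-, h1⟩
    · exact absurd (hs.symm.trans h1) one_ne_zero
    · have h2 : eval y (s * b j₀) = 0 := congrFun h0 j₀
      have h3 := h1 j₀
      rw [map_mul, hs, one_mul] at h2
      rw [hs, one_mul, h2, zero_mul] at h3
      exact h3
  · rw [map_mul, map_mul]
    rcases key x hx hxX z hz with h1 | ⟨h0, h1⟩
    · rw [h1]; ring
    · linear_combination eval z (b i) * h1 l - eval z (b l) * h1 i

theorem exists_represents_inverse [IsAlgClosed k] (hX : IsAlgSet X) (hne : X.Nonempty)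
    (hmor : IsMorphismOn X f) (hinj : InjOn f X) {g : Pr k r → Pr k M} (hg : ∀ q ∈ X, g (f q) = q)
    {v : Fin (M + 1) → k} (hv : v ≠ 0)
    (hvX : Projectivization.mk k v hv ∈ X) {d : ℕ}
    {F : Fin (r + 1) → MvPolynomial (Fin (M + 1)) k} (hF : Represents X f d F)
    (hFv : (fun i => eval v (F i)) ≠ 0) (hun : Immersive (coneIdeal X) F v) :
    ∃ (e : ℕ) (B : Fin (M + 1) → MvPolynomial (Fin (r + 1)) k), Represents (f '' X) g e B ∧
      (fun j => eval (fun i => eval v (F i)) (B j)) ≠ 0 := by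
  have : Infinite k := IsAlgClosed.instInfinite
  obtain ⟨B, hBy, hB⟩ := exists_inverse_of_immersive hX hne hmor hinj hv hvX hF hFv hun
  obtain ⟨j, hj⟩ := Function.ne_iff.1 hBy
  rw [Pi.zero_apply] at hj
  obtain ⟨e, he⟩ : ∃ e, eval (fun i => eval v (F i)) (homogeneousComponent e (B j)) ≠ 0 := by
    by_contra! hcon
    refine hj ?_
    rw [← sum_homogeneousComponent (B j), map_sum]
    exact Finset.sum_eq_zero fun d _ => hcon d
  refine ⟨e, fun j => homogeneousComponent e (B j),
    ⟨fun i => homogeneousComponent_isHomogeneous e _, fun z hz hzX i l => ?_⟩,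
    Function.ne_iff.2 ⟨j, he⟩⟩
  obtain ⟨p, hp, hpz⟩ := hzX
  rw [← hpz, hg p hp]
  have h1 := hB p.rep p.rep_nonzero (by rwa [Projectivization.mk_rep])
  rw [Projectivization.mk_rep] at h1
  have h2 : ∀ i l, z i * (f p).rep l = z l * (f p).rep i := by
    rw [← mk_eq_iff_cross_mul hz (Projectivization.rep_nonzero _), Projectivization.mk_rep, hpz]
  have h3 := homogeneousComponent_eval_eq_zero (v := z)
    (f := C (p.rep l) * B i - C (p.rep i) * B l) (fun t => by
      have := h1 (t • z) (fun i l => by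
        simp only [Pi.smul_apply, smul_eq_mul]
        linear_combination t * h2 i l) i l
      rw [map_sub, map_mul, map_mul, eval_C, eval_C]
      linear_combination this) e
  rw [map_sub, homogeneousComponent_C_mul, homogeneousComponent_C_mul, map_sub, map_mul, map_mul,
    eval_C, eval_C] at h3
  linear_combination h3

end Graph

/-- **Fulton–Hansen consequence.** If `X` is a complete (here: projective) irreducible
variety of dimension `n` and `f : X → ℙ^r` is an unramified morphism with `2n > r`,
then `f` is a closed embedding. -/
theorem stmt_13
    (k : Type) [Field k] [IsAlgClosed k] [CharZero k]
    (M r n : ℕ)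
    (X : Set (Pr k M)) (f : Pr k M → Pr k r)
    (hX : IsVariety X) (hdim : HasDim X n)
    (hmor : IsMorphismOn X f) (hunr : ∀ p ∈ X, UnramifiedAt X f p)
    (h2n : r < 2 * n) :
    IsClosedEmbeddingOn X f := by
  obtain ⟨hXa, hXne, -⟩ := id hX
  have hinj : InjOn f X := injOn_of_unramified hX hdim hmor hunr h2n
  refine ⟨hinj, isAlgSet_image hXa hXne hmor, hunr, fun p hp => ?_⟩
  have : Nonempty (Pr k M) := ⟨p⟩
  set g := Function.invFunOn f X with hg
  have hgf : ∀ q ∈ X, g (f q) = q := fun q hq => hinj.leftInvOn_invFunOn hq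
  obtain ⟨v, hv, rfl⟩ : ∃ v hv, p = Projectivization.mk k v hv :=
    ⟨p.rep, p.rep_nonzero, p.mk_rep.symm⟩
  obtain ⟨d, F, hF, hFv⟩ := exists_represents hmor hv hp
  obtain ⟨e, B, hB, hBv⟩ := exists_represents_inverse hXa hXne hmor hinj hgf hv hp hF hFv
    (immersive_of_unramifiedAt hXne hv (hunr _ hp) hF hFv)
  have hfp := hF.eq_mk hv hp hFv
  have hpY : Projectivization.mk k _ hFv ∈ f '' X := ⟨_, hp, hfp⟩
  have hgp : g (Projectivization.mk k _ hFv) = Projectivization.mk k v hv := by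
    rw [← hfp, hgf _ hp]
  refine le_antisymm ?_ (finrank_embTangent_le (mapsTo_image f X) hgf hv hp hF hFv hB hBv)
  have hFB : (fun i => eval (fun j => eval (fun i => eval v (F i)) (B j)) (F i)) ≠ 0 := by
    have h1 := (hB.eq_mk hFv hpY hBv).symm.trans hgp
    obtain ⟨t, ht⟩ := (Projectivization.mk_eq_mk_iff' ..).1 h1
    have ht0 : t ≠ 0 := by
      rintro rfl
      exact hBv (by rw [← ht, zero_smul])
    rw [← ht]
    exact mt (eval_smul_eq_zero_iff hF.1 ht0 v).1 hFv
  have := finrank_embTangent_le (X := f '' X) (Y := X) (f := g) (g := f)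
    (by rintro _ ⟨q, hq, rfl⟩; rwa [hgf q hq]) (by rintro _ ⟨q, hq, rfl⟩; rw [hgf q hq])
    hFv hpY hB hBv hF hFB
  rwa [hgp, ← hfp] at this

end PinchPaper
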